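/- Let m ≥ 1, θ > 1, λ ∈ ℝ, and let f : ℝ^m → ℝ be locally Lipschitz continuous. If the ergodic problem (EP)_λ admits a C² subsolution, then (EP)_λ admits a C² solution, i.e. there exists φ ∈ C²(ℝ^m) with −(1/2)Δφ(y) + (1/θ)|Dφ(y)|^θ = f(y) − λ for all y ∈ ℝ^m. -/

import Mathlib

open Filter

noncomputable def lap {m : ℕ} (φ : EuclideanSpace ℝ (Fin m) → ℝ)
    (y : EuclideanSpace ℝ (Fin m)) : ℝ :=
  ∑ i : Fin m, iteratedFDeriv ℝ 2 φ y ![EuclideanSpace.single i 1, EuclideanSpace.single i 1]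

def IsSubsolution {m : ℕ} (θ : ℝ) (f : EuclideanSpace ℝ (Fin m) → ℝ) (lam : ℝ)
    (φ : EuclideanSpace ℝ (Fin m) → ℝ) : Prop :=
  ContDiff ℝ 2 φ ∧
    ∀ y, -(1/2) * lap φ y + (1/θ) * ‖gradient φ y‖ ^ θ ≤ f y - lam

def IsSupersolution {m : ℕ} (θ : ℝ) (f : EuclideanSpace ℝ (Fin m) → ℝ) (lam : ℝ)
    (φ : EuclideanSpace ℝ (Fin m) → ℝ) : Prop :=
  ContDiff ℝ 2 φ ∧
    ∀ y, -(1/2) * lap φ y + (1/θ) * ‖gradient φ y‖ ^ θ ≥ f y - lam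

def IsSolution {m : ℕ} (θ : ℝ) (f : EuclideanSpace ℝ (Fin m) → ℝ) (lam : ℝ)
    (φ : EuclideanSpace ℝ (Fin m) → ℝ) : Prop :=
  ContDiff ℝ 2 φ ∧
    ∀ y, -(1/2) * lap φ y + (1/θ) * ‖gradient φ y‖ ^ θ = f y - lam

noncomputable def lambdaStar {m : ℕ} (θ : ℝ) (f : EuclideanSpace ℝ (Fin m) → ℝ) : ℝ :=
  sSup {lam : ℝ | ∃ φ, IsSubsolution θ f lam φ}

def H0 {m : ℕ} (f : EuclideanSpace ℝ (Fin m) → ℝ) (α f₀ : ℝ) : Prop :=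
  LocallyLipschitz f ∧ BddBelow (Set.range f) ∧
    ∀ y, DifferentiableAt ℝ f y →
      (1 ≤ α → ‖gradient f y‖ ≤ f₀ * (1 + ‖y‖ ^ (α - 1))) ∧
      (α < 1 → ‖gradient f y‖ ≤ f₀)

def H1 {m : ℕ} (f : EuclideanSpace ℝ (Fin m) → ℝ) (α f₀ : ℝ) : Prop :=
  ∀ y, f₀⁻¹ * (‖y‖ ^ α + 1) ≤ f y ∧ f y ≤ f₀ * (‖y‖ ^ α + 1)

def MemPhi {m : ℕ} (γ : ℝ) (v : EuclideanSpace ℝ (Fin m) → ℝ) : Prop :=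
  ContDiff ℝ 2 v ∧ ∃ c > 1, ∀ y, c⁻¹ * ‖y‖ ^ γ - c ≤ v y ∧ v y ≤ c * (1 + ‖y‖ ^ γ)

def Coercive {m : ℕ} (f : EuclideanSpace ℝ (Fin m) → ℝ) : Prop :=
  Tendsto f (cocompact (EuclideanSpace ℝ (Fin m))) atTop




set_option linter.unusedSectionVars false
set_option linter.unusedVariables false

section EllipticKernel

open MeasureTheory Topology Metric Set

variable {E : Type*} [NormedAddCommGroup E] [InnerProductSpace ℝ E] [FiniteDimensional ℝ E]
  [MeasurableSpace E] [BorelSpace E]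
variable {F : Type*} [NormedAddCommGroup F] [NormedSpace ℝ F] [FiniteDimensional ℝ F]

/-- Continuous kernel supported in the closed unit ball. -/
structure Ker (a : E → F) : Prop where
  cont : Continuous a
  supp : ∀ z, 1 < ‖z‖ → a z = 0

/-- Scaled averaging operator. -/
noncomputable def Mop (a : E → F) (k : E → ℝ) (s : ℝ) (x : E) : F :=
  ∫ z, k (x - s • z) • a z

theorem Ker.hcs {a : E → F} (ha : Ker a) : HasCompactSupport a := by
  apply HasCompactSupport.intro (isCompact_closedBall (0 : E) 1)
  intro z hz
  apply ha.supp
  simpa using hz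

theorem Ker.int {a : E → F} (ha : Ker a) : Integrable a :=
  ha.cont.integrable_of_hasCompactSupport ha.hcs

theorem Ker.fderivK {a : E → F} (ha : Ker a) (h1 : ContDiff ℝ 1 a) : Ker (fderiv ℝ a) := by
  refine ⟨h1.continuous_fderiv one_ne_zero, fun z hz => ?_⟩
  have : a =ᶠ[𝓝 z] fun _ => 0 := by
    have : {y : E | 1 < ‖y‖} ∈ 𝓝 z := (isOpen_lt continuous_const continuous_norm).mem_nhds hz
    filter_upwards [this] with y hy using ha.supp y hy
  rw [this.fderiv_eq]; simp

theorem Mop_int {a : E → F} (ha : Ker a) {k : E → ℝ} (hk : Continuous k) (s : ℝ) (x : E) :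
    Integrable (fun z => k (x - s • z) • a z) := by
  refine Ker.int ⟨by have := ha.cont; fun_prop, fun z hz => by rw [ha.supp z hz, smul_zero]⟩

theorem Mop_bound {a : E → F} (ha : Ker a) {k : E → ℝ} {s B : ℝ} {x : E} (hs : 0 ≤ s)
    (hB : ∀ y, ‖y - x‖ ≤ s → |k y| ≤ B) : ‖Mop a k s x‖ ≤ B * ∫ z, ‖a z‖ := by
  rw [← integral_const_mul]
  apply norm_integral_le_of_norm_le (ha.int.norm.const_mul B)
  refine Eventually.of_forall fun z => ?_
  rw [norm_smul]
  by_cases hz : 1 < ‖z‖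
  · simp [ha.supp z hz]
  · apply mul_le_mul_of_nonneg_right _ (norm_nonneg _)
    apply hB
    rw [sub_sub_cancel_left, norm_neg, norm_smul, Real.norm_of_nonneg hs]
    nlinarith

theorem Mop_sub {a : E → F} (ha : Ker a) {k l : E → ℝ} (hk : Continuous k) (hl : Continuous l)
    (s : ℝ) (x : E) : Mop a (fun y => k y - l y) s x = Mop a k s x - Mop a l s x := by
  unfold Mop
  rw [← integral_sub (Mop_int ha hk s x) (Mop_int ha hl s x)]
  simp only [sub_smul]

theorem Mop_continuous {a : E → F} (ha : Ker a) {k : E → ℝ} (hk : Continuous k) :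
    Continuous (fun q : ℝ × E => Mop a k q.1 q.2) := by
  have h : ∀ q : ℝ × E, Mop a k q.1 q.2 = ∫ z in closedBall (0:E) 1, k (q.2 - q.1 • z) • a z := by
    intro q
    unfold Mop
    rw [setIntegral_eq_integral_of_forall_compl_eq_zero]
    intro z hz
    rw [ha.supp z (by simpa using hz), smul_zero]
  simp_rw [h]
  apply continuous_parametric_integral_of_continuous _ (isCompact_closedBall _ _)
  have := ha.cont
  simp only [Function.uncurry_def]
  fun_prop

theorem Mop_eq_conv (a : E → F) (k : E → ℝ) {s : ℝ} (hs : 0 < s) (x : E) :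
    Mop a k s x = |(s ^ Module.finrank ℝ E)⁻¹| • ∫ t, k (x - t) • a (s⁻¹ • t) := by
  rw [← Measure.integral_comp_smul volume (fun t => k (x - t) • a (s⁻¹ • t)) s]
  unfold Mop
  simp [smul_smul, inv_mul_cancel₀ hs.ne']

theorem Mop_hasFDerivAt {a : E → F} (ha : Ker a) (h1 : ContDiff ℝ 1 a) {k : E → ℝ}
    (hk : Continuous k) {s : ℝ} (hs : 0 < s) (x : E) :
    HasFDerivAt (Mop a k s) (s⁻¹ • Mop (fderiv ℝ a) k s x) x := by
  set a' : E → F := fun t => a (s⁻¹ • t) with ha'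
  have hc : ContDiff ℝ 1 a' := h1.comp (contDiff_const_smul s⁻¹)
  have hcs : HasCompactSupport a' := ha.hcs.comp_smul (inv_ne_zero hs.ne')
  have hd : ∀ t, fderiv ℝ a' t = s⁻¹ • fderiv ℝ a (s⁻¹ • t) := by
    intro t
    have h2 : HasFDerivAt a (fderiv ℝ a (s⁻¹ • t)) (s⁻¹ • t) :=
      (h1.differentiable one_ne_zero _).hasFDerivAt
    have h3 : HasFDerivAt (fun t : E => s⁻¹ • t) (s⁻¹ • ContinuousLinearMap.id ℝ E) t :=
      (hasFDerivAt_id t).const_smul s⁻¹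
    rw [show fderiv ℝ a' t = _ from (h2.comp t h3).fderiv]
    ext v; simp
  have key := hcs.hasFDerivAt_convolution_left (ContinuousLinearMap.lsmul ℝ ℝ : ℝ →L[ℝ] F →L[ℝ] F).flip
    hc (g := k) (μ := volume) hk.locallyIntegrable x
  have key2 := key.const_smul |(s ^ Module.finrank ℝ E)⁻¹|
  refine (key2.congr_of_eventuallyEq (f₁ := Mop a k s) ?_).congr_fderiv ?_
  · refine Eventually.of_forall fun y => ?_
    rw [Mop_eq_conv a k hs]
    rfl
  · rw [Mop_eq_conv _ k hs, smul_comm]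
    congr 1
    rw [← integral_smul]
    unfold convolution
    congr 1
    ext t v
    simp [hd, ContinuousLinearMap.precompL, smul_smul, mul_comm]

theorem Mop_mean_zero {a : E → F} (ha : Ker a) (h0 : ∫ z, a z = 0) {k : E → ℝ}
    (hk : Continuous k) {s C : ℝ} (hs : 0 ≤ s) (hC : 0 ≤ C) {x : E}
    (hH : ∀ y, ‖y - x‖ ≤ s → |k y - k x| ≤ C * √‖y - x‖) :
    ‖Mop a k s x‖ ≤ (C * √s) * ∫ z, ‖a z‖ := by
  have : Mop a k s x = Mop a (fun y => k y - k x) s x := by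
    rw [Mop_sub ha hk continuous_const]
    simp [Mop, integral_smul, h0]
  rw [this]
  apply Mop_bound ha hs
  intro y hy
  refine (hH y hy).trans ?_
  gcongr

theorem Ker.integral_fderiv {a : E → F} (ha : Ker a) (h1 : ContDiff ℝ 1 a) :
    ∫ z, _root_.fderiv ℝ a z = 0 := by
  have h := Mop_hasFDerivAt ha h1 (k := fun _ => 1) continuous_const one_pos 0
  have h2 : HasFDerivAt (Mop a (fun _ => (1:ℝ)) 1) (0 : E →L[ℝ] F) 0 := by
    have : Mop a (fun _ => (1:ℝ)) 1 = fun _ => ∫ z, a z := by ext; simp [Mop]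
    rw [this]; exact hasFDerivAt_const _ _
  have := h.unique h2
  simpa [Mop] using this

end EllipticKernel

set_option linter.unusedSectionVars false
set_option linter.unusedVariables false

section EllipticKernel2

open MeasureTheory Topology Metric Set

variable {E : Type*} [NormedAddCommGroup E] [InnerProductSpace ℝ E] [FiniteDimensional ℝ E]
  [MeasurableSpace E] [BorelSpace E]
variable {F : Type*} [NormedAddCommGroup F] [NormedSpace ℝ F] [FiniteDimensional ℝ F]

noncomputable def Tint (r : ℝ) (ω : ℝ → ℝ) (a : E → F) (k : E → ℝ) (x : E) : F :=
  ∫ s in (0:ℝ)..r, ω s • Mop a k s x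

/-- Locally Hölder of exponent one half. -/
def LH (k : E → ℝ) : Prop :=
  ∀ ρ : ℝ, ∃ C : ℝ, 0 ≤ C ∧ ∀ x y, ‖x‖ ≤ ρ → ‖y‖ ≤ ρ → |k x - k y| ≤ C * √‖x - y‖

theorem LH.continuous {k : E → ℝ} (hk : LH k) : Continuous k := by
  rw [continuous_iff_continuousAt]
  intro x
  obtain ⟨C, hC, h⟩ := hk (‖x‖ + 1)
  rw [ContinuousAt, tendsto_iff_norm_sub_tendsto_zero]
  have h1 : Tendsto (fun y => C * √‖y - x‖) (𝓝 x) (𝓝 0) := by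
    have : Continuous (fun y => C * √‖y - x‖) := by fun_prop
    simpa using this.tendsto x
  refine squeeze_zero' (Eventually.of_forall fun _ => norm_nonneg _) ?_ h1
  filter_upwards [ball_mem_nhds x one_pos] with y hy
  apply h y x _ (by linarith)
  have := norm_le_norm_add_norm_sub' y x
  rw [mem_ball, dist_eq_norm] at hy
  linarith

theorem Mop_cont_s {a : E → F} (ha : Ker a) {k : E → ℝ} (hk : Continuous k) (x : E) :
    Continuous (fun s => Mop a k s x) :=
  (Mop_continuous ha hk).comp (by fun_prop : Continuous fun s : ℝ => (s, x))

theorem intble_sqrt_inv (r : ℝ) (hr : 0 < r) :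
    IntervalIntegrable (fun s : ℝ => √s * s⁻¹) volume 0 r := by
  have h := intervalIntegral.intervalIntegrable_rpow' (a := 0) (b := r) (r := -1/2) (by norm_num)
  refine h.congr (fun s hs => ?_)
  rw [uIoc_of_le hr.le] at hs
  have hs0 : 0 < s := hs.1
  rw [Real.sqrt_eq_rpow, ← Real.rpow_neg_one, ← Real.rpow_add hs0]
  norm_num

theorem Tint_hasFDerivAt_gen {r : ℝ} (hr : 0 < r) {ω : ℝ → ℝ} (hω : Continuous ω)
    {a : E → F} (ha : Ker a) (h1 : ContDiff ℝ 1 a) {k : E → ℝ} (hk : Continuous k)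
    {x₀ : E} {β : ℝ → ℝ} (hβ : IntervalIntegrable β volume 0 r)
    (hb : ∀ x ∈ ball x₀ 1, ∀ s ∈ Ioc 0 r, ‖(ω s * s⁻¹) • Mop (fderiv ℝ a) k s x‖ ≤ β s) :
    HasFDerivAt (Tint r ω a k) (Tint r (fun s => ω s * s⁻¹) (fderiv ℝ a) k x₀) x₀ := by
  unfold Tint
  have hc : ∀ x, Continuous (fun s => ω s • Mop a k s x) := fun x =>
    hω.smul (Mop_cont_s ha hk x)
  refine intervalIntegral.hasFDerivAt_integral_of_dominated_of_fderiv_le (bound := β)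
    (ball_mem_nhds x₀ one_pos)
    (F' := fun x s => (ω s * s⁻¹) • Mop (fderiv ℝ a) k s x) ?_ ?_ ?_ ?_ hβ ?_
  · exact Eventually.of_forall fun x => (hc x).aestronglyMeasurable
  · exact (hc x₀).intervalIntegrable _ _
  · apply AEStronglyMeasurable.fun_smul
    · exact (hω.measurable.mul measurable_inv).aestronglyMeasurable
    · exact (Mop_cont_s (ha.fderivK h1) hk x₀).aestronglyMeasurable
  · refine Eventually.of_forall fun s hs x hx => ?_
    rw [uIoc_of_le hr.le] at hs
    exact hb x hx s hs
  · refine Eventually.of_forall fun s hs x hx => ?_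
    rw [uIoc_of_le hr.le] at hs
    have := (Mop_hasFDerivAt ha h1 hk hs.1 x).const_smul (ω s)
    rw [mul_smul]
    exact this

theorem Tint_continuous {r : ℝ} {w : ℝ → ℝ} (hw : Continuous w)
    {a : E → F} (ha : Ker a) {k : E → ℝ} (hk : Continuous k) : Continuous (Tint r w a k) := by
  unfold Tint
  apply intervalIntegral.continuous_parametric_intervalIntegral_of_continuous'
  simp only [Function.uncurry_def]
  exact (hw.comp continuous_snd).smul
    ((Mop_continuous ha hk).comp (by fun_prop : Continuous fun q : E × ℝ => (q.2, q.1)))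

theorem bdd_on_ball {G : Type*} [NormedAddCommGroup G] {k : E → G} (hk : Continuous k) (ρ : ℝ) :
    ∃ B, 0 ≤ B ∧ ∀ y, ‖y‖ ≤ ρ → ‖k y‖ ≤ B := by
  obtain ⟨B, hB⟩ := (isCompact_closedBall (0:E) ρ).exists_bound_of_continuousOn hk.continuousOn
  exact ⟨max B 0, le_max_right _ _, fun y hy => (hB y (by simpa using hy)).trans (le_max_left _ _)⟩

theorem bdd_Icc {w : ℝ → ℝ} (hw : Continuous w) (r : ℝ) :
    ∃ W, 0 ≤ W ∧ ∀ s ∈ Icc 0 r, |w s| ≤ W := by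
  obtain ⟨B, hB⟩ := (isCompact_Icc (a := 0) (b := r)).exists_bound_of_continuousOn hw.continuousOn
  exact ⟨max B 0, le_max_right _ _, fun y hy => (hB y hy).trans (le_max_left _ _)⟩

theorem Tint_hasFDerivAt_one {r : ℝ} (hr : 0 < r) {w : ℝ → ℝ} (hw : Continuous w)
    {a : E → F} (ha : Ker a) (h1 : ContDiff ℝ 1 a) {k : E → ℝ} (hk : Continuous k) (x : E) :
    HasFDerivAt (Tint r (fun s => s * w s) a k) (Tint r w (fderiv ℝ a) k x) x := by
  obtain ⟨W, hW0, hW⟩ := bdd_Icc hw r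
  obtain ⟨B, hB0, hB⟩ := bdd_on_ball hk (‖x‖ + 1 + r)
  have hI : 0 ≤ ∫ z, ‖fderiv ℝ a z‖ := integral_nonneg fun _ => norm_nonneg _
  have h := Tint_hasFDerivAt_gen hr (ω := fun s => s * w s) (by fun_prop) ha h1 hk (x₀ := x)
    (β := fun _ => W * (B * ∫ z, ‖fderiv ℝ a z‖)) (by simp) ?_
  · convert h using 1
    unfold Tint
    apply intervalIntegral.integral_congr_ae
    refine Eventually.of_forall fun s hs => ?_
    rw [uIoc_of_le hr.le] at hs
    have := hs.1.ne'
    congr 1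
    field_simp
  · intro y hy s hs
    have hs0 := hs.1.ne'
    rw [show s * w s * s⁻¹ = w s by field_simp, norm_smul]
    apply mul_le_mul (hW s ⟨hs.1.le, hs.2⟩) _ (norm_nonneg _) hW0
    apply Mop_bound (ha.fderivK h1) hs.1.le
    intro z hz
    apply hB
    rw [mem_ball, dist_eq_norm] at hy
    have h1 := norm_le_norm_add_norm_sub' z y
    have h2 := norm_le_norm_add_norm_sub' y x
    linarith [hs.2]

theorem Tint_hasFDerivAt_two {r : ℝ} (hr : 0 < r) {w : ℝ → ℝ} (hw : Continuous w)
    {a : E → F} (ha : Ker a) (h1 : ContDiff ℝ 1 a) {k : E → ℝ} (hk : LH k) (x : E) :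
    HasFDerivAt (Tint r w a k) (Tint r (fun s => w s * s⁻¹) (fderiv ℝ a) k x) x := by
  obtain ⟨W, hW0, hW⟩ := bdd_Icc hw r
  obtain ⟨C, hC0, hC⟩ := hk (‖x‖ + 1 + r)
  have hI : 0 ≤ ∫ z, ‖fderiv ℝ a z‖ := integral_nonneg fun _ => norm_nonneg _
  refine Tint_hasFDerivAt_gen hr hw ha h1 hk.continuous (x₀ := x)
    (β := fun s => (W * (C * ∫ z, ‖fderiv ℝ a z‖)) * (√s * s⁻¹)) 
    ((intble_sqrt_inv r hr).const_mul _) ?_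
  intro y hy s hs
  have hs0 := hs.1
  have hM := Mop_mean_zero (ha.fderivK h1) (ha.integral_fderiv h1) hk.continuous hs0.le hC0
    (x := y) ?_
  · rw [norm_smul, norm_mul, norm_inv, Real.norm_of_nonneg hs0.le]
    calc ‖w s‖ * s⁻¹ * ‖Mop (fderiv ℝ a) k s y‖
        ≤ W * s⁻¹ * (C * √s * ∫ z, ‖fderiv ℝ a z‖) := by
          gcongr
          exact hW s ⟨hs.1.le, hs.2⟩
      _ = _ := by ring
  · intro z hz
    rw [mem_ball, dist_eq_norm] at hy
    have h1 := norm_le_norm_add_norm_sub' z y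
    have h2 := norm_le_norm_add_norm_sub' y x
    apply hC <;> linarith [hs.2]

theorem Tint_sing_continuous {r : ℝ} (hr : 0 < r) {w : ℝ → ℝ} (hw : Continuous w)
    {a : E → F} (ha : Ker a) (h0 : ∫ z, a z = 0) {k : E → ℝ} (hk : LH k) :
    Continuous (Tint r (fun s => w s * s⁻¹) a k) := by
  obtain ⟨W, hW0, hW⟩ := bdd_Icc hw r
  rw [continuous_iff_continuousAt]
  intro x
  obtain ⟨C, hC0, hC⟩ := hk (‖x‖ + 1 + r)
  have hI : 0 ≤ ∫ z, ‖a z‖ := integral_nonneg fun _ => norm_nonneg _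
  unfold Tint
  apply intervalIntegral.continuousAt_of_dominated_interval
    (bound := fun s => (W * (C * ∫ z, ‖a z‖)) * (√s * s⁻¹))
  · refine Eventually.of_forall fun y => ?_
    apply AEStronglyMeasurable.fun_smul
    · exact (hw.measurable.mul measurable_inv).aestronglyMeasurable
    · exact (Mop_cont_s ha hk.continuous y).aestronglyMeasurable
  · filter_upwards [ball_mem_nhds x one_pos] with y hy
    refine Eventually.of_forall fun s hs => ?_
    rw [uIoc_of_le hr.le] at hs
    have hs0 := hs.1
    have hM := Mop_mean_zero ha h0 hk.continuous hs0.le hC0 (x := y) ?_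
    · rw [norm_smul, norm_mul, norm_inv, Real.norm_of_nonneg hs0.le]
      calc ‖w s‖ * s⁻¹ * ‖Mop a k s y‖
          ≤ W * s⁻¹ * (C * √s * ∫ z, ‖a z‖) := by
            gcongr
            exact hW s ⟨hs.1.le, hs.2⟩
        _ = _ := by ring
    · intro z hz
      rw [mem_ball, dist_eq_norm] at hy
      have h1 := norm_le_norm_add_norm_sub' z y
      have h2 := norm_le_norm_add_norm_sub' y x
      apply hC <;> linarith [hs.2]
  · exact (intble_sqrt_inv r hr).const_mul _
  · refine Eventually.of_forall fun s hs => ?_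
    apply ContinuousAt.const_smul
    exact ((Mop_continuous ha hk.continuous).comp 
      (by fun_prop : Continuous fun y : E => (s, y))).continuousAt

theorem Mop_tendsto {a : E → F} (ha : Ker a) {k : E → ℝ} {kn : ℕ → E → ℝ} (hk : Continuous k)
    (hkn : ∀ n, Continuous (kn n)) {s : ℝ} (hs : 0 ≤ s) (x : E) {ε : ℕ → ℝ}
    (hε : Tendsto ε atTop (𝓝 0)) (h : ∀ n y, ‖y - x‖ ≤ s → |kn n y - k y| ≤ ε n) :
    Tendsto (fun n => Mop a (kn n) s x) atTop (𝓝 (Mop a k s x)) := by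
  rw [tendsto_iff_norm_sub_tendsto_zero]
  have h2 : Tendsto (fun n => ε n * ∫ z, ‖a z‖) atTop (𝓝 0) := by
    simpa using hε.mul_const (∫ z, ‖a z‖)
  refine squeeze_zero (fun _ => norm_nonneg _) (fun n => ?_) h2
  rw [← Mop_sub ha (hkn n) hk]
  exact Mop_bound ha hs (h n)

theorem Tint_tendsto_sing {r : ℝ} (hr : 0 < r) {w : ℝ → ℝ} (hw : Continuous w)
    {a : E → F} (ha : Ker a) (h0 : ∫ z, a z = 0) {k : E → ℝ} {kn : ℕ → E → ℝ} (hk : Continuous k)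
    (hkn : ∀ n, Continuous (kn n)) (x : E) {ε : ℕ → ℝ}
    (hε : Tendsto ε atTop (𝓝 0)) (h : ∀ n y, ‖y - x‖ ≤ r → |kn n y - k y| ≤ ε n)
    {C : ℝ} (hC0 : 0 ≤ C) (hC : ∀ n y, ‖y - x‖ ≤ r → |kn n y - kn n x| ≤ C * √‖y - x‖) :
    Tendsto (fun n => Tint r (fun s => w s * s⁻¹) a (kn n) x) atTop
      (𝓝 (Tint r (fun s => w s * s⁻¹) a k x)) := by
  obtain ⟨W, hW0, hW⟩ := bdd_Icc hw r
  have hI : 0 ≤ ∫ z, ‖a z‖ := integral_nonneg fun _ => norm_nonneg _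
  unfold Tint
  apply intervalIntegral.tendsto_integral_filter_of_dominated_convergence
    (bound := fun s => (W * (C * ∫ z, ‖a z‖)) * (√s * s⁻¹))
  · refine Eventually.of_forall fun n => ?_
    apply AEStronglyMeasurable.fun_smul
    · exact (hw.measurable.mul measurable_inv).aestronglyMeasurable
    · exact (Mop_cont_s ha (hkn n) x).aestronglyMeasurable
  · refine Eventually.of_forall fun n => Eventually.of_forall fun s hs => ?_
    rw [uIoc_of_le hr.le] at hs
    have hs0 := hs.1
    have hM := Mop_mean_zero ha h0 (hkn n) hs0.le hC0 (x := x) 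
      (fun y hy => hC n y (hy.trans hs.2))
    rw [norm_smul, norm_mul, norm_inv, Real.norm_of_nonneg hs0.le]
    calc ‖w s‖ * s⁻¹ * ‖Mop a (kn n) s x‖
        ≤ W * s⁻¹ * (C * √s * ∫ z, ‖a z‖) := by
          gcongr
          exact hW s ⟨hs.1.le, hs.2⟩
      _ = _ := by ring
  · exact (intble_sqrt_inv r hr).const_mul _
  · refine Eventually.of_forall fun s hs => ?_
    rw [uIoc_of_le hr.le] at hs
    exact (Mop_tendsto ha hk hkn hs.1.le x hε (fun n y hy => h n y (hy.trans hs.2))).const_smul _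

theorem Tint_bound {r : ℝ} (hr : 0 ≤ r) {w : ℝ → ℝ} {W B : ℝ} (hW : ∀ s ∈ Icc 0 r, |w s| ≤ W)
    {a : E → F} (ha : Ker a) {k : E → ℝ} {x : E}
    (hB : ∀ y, ‖y - x‖ ≤ r → |k y| ≤ B) : 
    ‖Tint r w a k x‖ ≤ W * (B * ∫ z, ‖a z‖) * r := by
  have hB0 : 0 ≤ B := (abs_nonneg _).trans (hB x (by simpa))
  have hI : 0 ≤ ∫ z, ‖a z‖ := integral_nonneg fun _ => norm_nonneg _
  have := intervalIntegral.norm_integral_le_of_norm_le_const (a := 0) (b := r) 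
    (f := fun s => w s • Mop a k s x) (C := W * (B * ∫ z, ‖a z‖)) ?_
  · simpa [Tint, abs_of_nonneg hr] using this
  · intro s hs
    rw [uIoc_of_le hr] at hs
    rw [norm_smul]
    have hw := hW s ⟨hs.1.le, hs.2⟩
    exact mul_le_mul hw (Mop_bound ha hs.1.le fun y hy => hB y (hy.trans hs.2)) (norm_nonneg _)
      ((abs_nonneg _).trans hw)

theorem Tint_sub {r : ℝ} {w : ℝ → ℝ} (hw : Continuous w)
    {a : E → F} (ha : Ker a) {k l : E → ℝ} (hk : Continuous k) (hl : Continuous l) (x : E) :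
    Tint r w a (fun y => k y - l y) x = Tint r w a k x - Tint r w a l x := by
  unfold Tint
  rw [← intervalIntegral.integral_sub]
  · simp only [Mop_sub ha hk hl, smul_sub]
  · exact (hw.smul (Mop_cont_s ha hk x)).intervalIntegrable _ _
  · exact (hw.smul (Mop_cont_s ha hl x)).intervalIntegrable _ _

theorem Tint_tendsto {r : ℝ} (hr : 0 < r) {w : ℝ → ℝ} (hw : Continuous w)
    {a : E → F} (ha : Ker a) {k : E → ℝ} {kn : ℕ → E → ℝ} (hk : Continuous k)
    (hkn : ∀ n, Continuous (kn n)) (x : E) {ε : ℕ → ℝ}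
    (hε : Tendsto ε atTop (𝓝 0)) (h : ∀ n y, ‖y - x‖ ≤ r → |kn n y - k y| ≤ ε n) :
    Tendsto (fun n => Tint r w a (kn n) x) atTop (𝓝 (Tint r w a k x)) := by
  obtain ⟨W, hW0, hW⟩ := bdd_Icc hw r
  rw [tendsto_iff_norm_sub_tendsto_zero]
  have h2 : Tendsto (fun n => W * (ε n * ∫ z, ‖a z‖) * r) atTop (𝓝 0) := by
    simpa using ((hε.mul_const (∫ z, ‖a z‖)).const_mul W).mul_const r
  refine squeeze_zero (fun _ => norm_nonneg _) (fun n => ?_) h2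
  rw [← Tint_sub hw ha (hkn n) hk]
  exact Tint_bound hr.le hW ha (h n)

theorem Tint_holder {r : ℝ} (hr : 0 < r) {w : ℝ → ℝ} (hw : Continuous w)
    {a : E → F} (ha : Ker a) (h1 : ContDiff ℝ 1 a) :
    ∃ C, 0 ≤ C ∧ ∀ (k : E → ℝ) (ρ B : ℝ), Continuous k → 0 ≤ B → (∀ y, ‖y‖ ≤ ρ + r → |k y| ≤ B) →
      ∀ x y, ‖x‖ ≤ ρ → ‖y‖ ≤ ρ → ‖Tint r w a k x - Tint r w a k y‖ ≤ C * B * √‖x - y‖ := by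
  obtain ⟨W, hW0, hW⟩ := bdd_Icc hw r
  set I0 := ∫ z, ‖a z‖ with hI0
  set I1 := ∫ z, ‖fderiv ℝ a z‖ with hI1
  have hI0p : 0 ≤ I0 := integral_nonneg fun _ => norm_nonneg _
  have hI1p : 0 ≤ I1 := integral_nonneg fun _ => norm_nonneg _
  have hInteg := intble_sqrt_inv r hr
  have hJ : 0 ≤ ∫ s in (0:ℝ)..r, √s * s⁻¹ := by
    apply intervalIntegral.integral_nonneg hr.le
    intro s hs
    have := hs.1
    positivity
  refine ⟨W * √(2 * I0 * I1) * ∫ s in (0:ℝ)..r, √s * s⁻¹, by positivity, ?_⟩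
  intro k ρ B hk hB hkB x y hx hy
  have e : Tint r w a k x - Tint r w a k y = ∫ s in (0:ℝ)..r, w s • (Mop a k s x - Mop a k s y) := by
    unfold Tint
    rw [← intervalIntegral.integral_sub]
    · simp only [smul_sub]
    · exact (hw.smul (Mop_cont_s ha hk x)).intervalIntegrable _ _
    · exact (hw.smul (Mop_cont_s ha hk y)).intervalIntegrable _ _
  rw [e]
  have e2 : W * √(2 * I0 * I1) * (∫ s in (0:ℝ)..r, √s * s⁻¹) * B * √‖x - y‖ = 
      ∫ s in (0:ℝ)..r, (W * √(2 * I0 * I1) * B * √‖x - y‖) * (√s * s⁻¹) := by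
    rw [intervalIntegral.integral_const_mul]; ring
  rw [e2]
  apply intervalIntegral.norm_integral_le_of_norm_le hr.le _ (hInteg.const_mul _)
  refine Eventually.of_forall fun s hs => ?_
  have hs0 : 0 < s := hs.1
  have hbd : ∀ z, ‖z‖ ≤ ρ → ∀ v, ‖v - z‖ ≤ s → |k v| ≤ B := by
    intro z hz v hv
    apply hkB
    have := norm_le_norm_add_norm_sub' v z
    linarith [hs.2]
  have b1 : ‖Mop a k s x - Mop a k s y‖ ≤ 2 * B * I0 := by
    have h1 := Mop_bound ha hs0.le (hbd x hx)
    have h2 := Mop_bound ha hs0.le (hbd y hy)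
    have := norm_sub_le (Mop a k s x) (Mop a k s y)
    linarith
  have b2 : ‖Mop a k s x - Mop a k s y‖ ≤ s⁻¹ * (B * I1) * ‖x - y‖ := by
    apply (convex_closedBall (0:E) ρ).norm_image_sub_le_of_norm_hasFDerivWithin_le
      (f' := fun x => s⁻¹ • Mop (fderiv ℝ a) k s x) (𝕜 := ℝ)
    · intro z _
      exact (Mop_hasFDerivAt ha h1 hk hs0 z).hasFDerivWithinAt
    · intro z hz
      rw [norm_smul, norm_inv, Real.norm_of_nonneg hs0.le]
      gcongr
      exact Mop_bound (ha.fderivK h1) hs0.le (hbd z (by simpa using hz))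
    · simpa using hy
    · simpa using hx
  have b3 : ‖Mop a k s x - Mop a k s y‖ ≤ √(2 * I0 * I1) * B * √‖x - y‖ * (√s * s⁻¹) := by
    refine (sq_le_sq₀ (norm_nonneg _) (by positivity)).1 ?_
    have hss : √s * √s = s := Real.mul_self_sqrt hs0.le
    have : (√(2 * I0 * I1) * B * √‖x - y‖ * (√s * s⁻¹))^2 = (2 * B * I0) * (s⁻¹ * (B * I1) * ‖x - y‖) := by
      rw [mul_pow, mul_pow, mul_pow, mul_pow, Real.sq_sqrt (by positivity), Real.sq_sqrt (by positivity),
        Real.sq_sqrt hs0.le]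
      field_simp
    rw [this, sq]
    exact mul_le_mul b1 b2 (norm_nonneg _) (by positivity)
  rw [norm_smul]
  calc ‖w s‖ * ‖Mop a k s x - Mop a k s y‖ ≤ W * (√(2 * I0 * I1) * B * √‖x - y‖ * (√s * s⁻¹)) := by
        gcongr
        exact hW s ⟨hs0.le, hs.2⟩
    _ = _ := by ring

end EllipticKernel2

set_option linter.unusedSectionVars false
set_option linter.unusedVariables false

section Kernels

open MeasureTheory Topology Metric Set

noncomputable def posP (n : ℕ) (t : ℝ) : ℝ := (max t 0) ^ n

theorem posP_hasDerivAt (n : ℕ) (t : ℝ) :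
    HasDerivAt (posP (n + 2)) ((n + 2 : ℝ) * posP (n + 1) t) t := by
  have hp : ∀ t : ℝ, HasDerivAt (fun t : ℝ => t ^ (n + 2)) ((n + 2 : ℝ) * t ^ (n + 1)) t := by
    intro t
    have := hasDerivAt_pow (n + 2) t
    simpa using this
  have h1 : ∀ t : ℝ, 0 ≤ t → posP (n + 2) t = t ^ (n + 2) := fun t ht => by
    simp [posP, max_eq_left ht]
  have h2 : ∀ t : ℝ, t ≤ 0 → posP (n + 2) t = 0 := fun t ht => by
    simp [posP, max_eq_right ht]
  rcases lt_trichotomy t 0 with h | h | h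
  · have e : posP (n + 2) =ᶠ[𝓝 t] fun _ => 0 := by
      filter_upwards [Iio_mem_nhds h] with s hs using h2 s hs.le
    have : posP (n + 1) t = 0 := by simp [posP, max_eq_right h.le]
    rw [this, mul_zero]
    exact (hasDerivAt_const t (0:ℝ)).congr_of_eventuallyEq e
  · subst h
    have a1 : HasDerivWithinAt (posP (n + 2)) 0 (Ici 0) 0 := by
      have := (hp 0).hasDerivWithinAt (s := Ici 0)
      simp at this
      exact this.congr (fun s hs => h1 s hs) (h1 0 le_rfl)
    have a2 : HasDerivWithinAt (posP (n + 2)) 0 (Iic 0) 0 :=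
      (hasDerivWithinAt_const (0:ℝ) (Iic 0) (0:ℝ)).congr (fun s hs => h2 s hs) (h2 0 le_rfl)
    have := a2.union a1
    rw [Iic_union_Ici, hasDerivWithinAt_univ] at this
    simpa [posP] using this
  · have e : posP (n + 2) =ᶠ[𝓝 t] fun t => t ^ (n + 2) := by
      filter_upwards [Ioi_mem_nhds h] with s hs using h1 s (le_of_lt hs)
    have : posP (n + 1) t = t ^ (n + 1) := by simp [posP, max_eq_left h.le]
    rw [this]
    exact (hp t).congr_of_eventuallyEq e

theorem posP_contDiff (n : ℕ) : ContDiff ℝ n (posP (n + 1)) := by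
  induction n with
  | zero => 
    simp only [Nat.cast_zero, contDiff_zero]
    unfold posP
    fun_prop
  | succ n ih =>
    have : ((n + 1 : ℕ) : WithTop ℕ∞) = (n : WithTop ℕ∞) + 1 := by push_cast; rfl
    rw [this, contDiff_succ_iff_deriv]
    refine ⟨fun t => (posP_hasDerivAt n t).differentiableAt, by simp, ?_⟩
    have : deriv (posP (n + 1 + 1)) = fun t => (n + 2 : ℝ) * posP (n + 1) t := by
      ext t; exact (posP_hasDerivAt n t).deriv
    rw [this]
    exact contDiff_const.mul ih

variable {E : Type*} [NormedAddCommGroup E] [InnerProductSpace ℝ E] [FiniteDimensional ℝ E]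
  [MeasurableSpace E] [BorelSpace E]

noncomputable def rho0 (z : E) : ℝ := 8 * posP 3 (1 - ‖z‖ ^ 2)

variable (E) in
noncomputable def kc : ℝ := (∫ z : E, rho0 z)⁻¹

noncomputable def rho (z : E) : ℝ := kc E * rho0 z
noncomputable def kap (z : E) : ℝ := kc E * posP 4 (1 - ‖z‖ ^ 2)

theorem rho0_ker : Ker (rho0 : E → ℝ) := by
  refine ⟨?_, fun z hz => ?_⟩
  · unfold rho0 posP; fun_prop
  · have : 1 - ‖z‖^2 ≤ 0 := by nlinarith
    simp [rho0, posP, max_eq_right this]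

theorem posP_nonneg (n : ℕ) (t : ℝ) : 0 ≤ posP n t := pow_nonneg (le_max_right _ _) _

theorem rho0_nonneg (z : E) : 0 ≤ rho0 z := mul_nonneg (by norm_num) (posP_nonneg _ _)

theorem kc_pos : 0 < kc E := by
  apply inv_pos.2
  apply Continuous.integral_pos_of_hasCompactSupport_nonneg_nonzero (x := 0) rho0_ker.cont
    rho0_ker.hcs (fun z => rho0_nonneg z)
  simp [rho0, posP]

theorem rho_ker : Ker (rho : E → ℝ) :=
  ⟨continuous_const.mul rho0_ker.cont, fun z hz => by simp [rho, rho0_ker.supp z hz]⟩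

theorem kap_ker : Ker (kap : E → ℝ) := by
  refine ⟨?_, fun z hz => ?_⟩
  · unfold kap posP; fun_prop
  · have : 1 - ‖z‖^2 ≤ 0 := by nlinarith
    simp [kap, posP, max_eq_right this]

theorem rho_contDiff : ContDiff ℝ 2 (rho : E → ℝ) := by
  have h : ContDiff ℝ 2 (fun z : E => 1 - ‖z‖^2) := contDiff_const.sub (contDiff_norm_sq ℝ)
  exact contDiff_const.mul (contDiff_const.mul ((posP_contDiff 2).comp h))

theorem kap_contDiff : ContDiff ℝ 2 (kap : E → ℝ) := by
  have h : ContDiff ℝ 2 (fun z : E => 1 - ‖z‖^2) := contDiff_const.sub (contDiff_norm_sq ℝ)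
  exact contDiff_const.mul (((posP_contDiff 3).of_le (by norm_cast)).comp h)

theorem rho_integral : ∫ z : E, rho z = 1 := by
  unfold rho
  rw [integral_const_mul]
  exact inv_mul_cancel₀ (inv_pos.1 (kc_pos (E := E))).ne'

theorem rho_nonneg (z : E) : 0 ≤ rho z := mul_nonneg kc_pos.le (rho0_nonneg z)
theorem kap_nonneg (z : E) : 0 ≤ kap z := mul_nonneg kc_pos.le (posP_nonneg _ _)

theorem kap_le_rho (z : E) : 8 * kap z ≤ rho z := by
  unfold kap rho rho0
  have h : posP 4 (1 - ‖z‖ ^ 2) ≤ posP 3 (1 - ‖z‖ ^ 2) := by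
    unfold posP
    apply pow_le_pow_of_le_one (le_max_right _ _) _ (by norm_num)
    apply max_le _ zero_le_one
    nlinarith [sq_nonneg ‖z‖]
  have := mul_le_mul_of_nonneg_left h (kc_pos (E := E)).le
  linarith

theorem kap_pos_integral : 0 < ∫ z : E, kap z := by
  apply Continuous.integral_pos_of_hasCompactSupport_nonneg_nonzero (x := 0) kap_ker.cont
    kap_ker.hcs (fun z => kap_nonneg z)
  simp [kap, posP, (kc_pos (E := E)).ne']

theorem kap_fderiv (z v : E) : fderiv ℝ kap z v = - (rho z * inner ℝ z v) := by
  have h1 : HasFDerivAt (fun z : E => 1 - ‖z‖^2) (-(2 • innerSL ℝ z)) z := by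
    have := (hasStrictFDerivAt_norm_sq z).hasFDerivAt.const_sub 1
    exact this
  have h2 := (posP_hasDerivAt 2 (1 - ‖z‖^2)).comp_hasFDerivAt z h1
  have h3 := h2.const_mul (kc E)
  have : fderiv ℝ kap z = _ := h3.fderiv
  rw [this]
  simp [rho, rho0]
  ring

end Kernels

set_option linter.unusedSectionVars false
set_option linter.unusedVariables false

section EllipticKernel4

open MeasureTheory Topology Metric Set

variable {m : ℕ}

theorem lap_eq (k : EuclideanSpace ℝ (Fin m) → ℝ) (y : EuclideanSpace ℝ (Fin m)) :
    lap k y = ∑ i : Fin m, fderiv ℝ (fderiv ℝ k) y (EuclideanSpace.single i 1)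
      (EuclideanSpace.single i 1) := by
  unfold lap
  simp [iteratedFDeriv_two_apply]

theorem Mop_apply {E : Type*} [NormedAddCommGroup E] [InnerProductSpace ℝ E]
    [FiniteDimensional ℝ E] [MeasurableSpace E] [BorelSpace E]
    {F : Type*} [NormedAddCommGroup F] [NormedSpace ℝ F] [FiniteDimensional ℝ F]
    {a : E → E →L[ℝ] F} (ha : Ker a) {k : E → ℝ} (hk : Continuous k) (s : ℝ) (x e : E) :
    Mop a k s x e = Mop (fun z => a z e) k s x := by
  unfold Mop
  rw [ContinuousLinearMap.integral_apply (Mop_int ha hk s x)]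
  simp

theorem Ker.applyK {E : Type*} [NormedAddCommGroup E] [InnerProductSpace ℝ E]
    [FiniteDimensional ℝ E] [MeasurableSpace E] [BorelSpace E]
    {F : Type*} [NormedAddCommGroup F] [NormedSpace ℝ F] [FiniteDimensional ℝ F]
    {a : E → E →L[ℝ] F} (ha : Ker a) (e : E) : Ker (fun z => a z e) :=
  ⟨by have := ha.cont; fun_prop, fun z hz => by simp [ha.supp z hz]⟩

theorem Mop_swap {E : Type*} [NormedAddCommGroup E] [InnerProductSpace ℝ E]
    [FiniteDimensional ℝ E] [MeasurableSpace E] [BorelSpace E]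
    {a : E → ℝ} (ha : Ker a) (h1 : ContDiff ℝ 1 a) {k : E → ℝ} (hk : ContDiff ℝ 1 k)
    (s : ℝ) (x e : E) :
    Mop (fderiv ℝ a) k s x e = s * Mop a (fun y => fderiv ℝ k y e) s x := by
  rw [Mop_apply (ha.fderivK h1) hk.continuous]
  have hd : ∀ z, HasFDerivAt (fun z => k (x - s • z)) (-(s • fderiv ℝ k (x - s • z))) z := by
    intro z
    have h2 : HasFDerivAt k (fderiv ℝ k (x - s • z)) (x - s • z) :=
      (hk.differentiable one_ne_zero _).hasFDerivAt
    have h3 : HasFDerivAt (fun z : E => x - s • z) (-(s • ContinuousLinearMap.id ℝ E)) z := by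
      simpa using ((hasFDerivAt_id z).const_smul s).const_sub x
    refine (h2.comp z h3).congr_fderiv ?_
    ext v; simp
  have hkc : Continuous (fun y => fderiv ℝ k y e) :=
    (hk.continuous_fderiv one_ne_zero).clm_apply continuous_const
  have := integral_mul_fderiv_eq_neg_fderiv_mul_of_integrable (μ := (volume : Measure E))
    (f := fun z => k (x - s • z)) (g := a) (v := e) ?_ ?_ ?_
    (fun z _ => (hd z).differentiableAt) (fun z _ => h1.differentiable one_ne_zero z)
  · unfold Mop
    simp only [smul_eq_mul]
    rw [this, ← integral_neg, ← integral_const_mul]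
    congr 1; ext z
    rw [(hd z).fderiv]
    simp; ring
  · have := (Mop_int ha hkc s x).const_mul (-s)
    refine this.congr (Eventually.of_forall fun z => ?_)
    simp only [(hd z).fderiv]
    simp; ring
  · exact Mop_int ((ha.fderivK h1).applyK e) hk.continuous s x
  · exact Mop_int ha hk.continuous s x

theorem Mop_swap2 {E : Type*} [NormedAddCommGroup E] [InnerProductSpace ℝ E]
    [FiniteDimensional ℝ E] [MeasurableSpace E] [BorelSpace E]
    {a : E → ℝ} (ha : Ker a) (h1 : ContDiff ℝ 2 a) {k : E → ℝ} (hk : ContDiff ℝ 2 k)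
    (s : ℝ) (x e e' : E) :
    Mop (fderiv ℝ (fderiv ℝ a)) k s x e e' =
      s ^ 2 * Mop a (fun y => fderiv ℝ (fderiv ℝ k) y e' e) s x := by
  have ha1 : ContDiff ℝ 1 a := h1.of_le one_le_two
  have hk1 : ContDiff ℝ 1 k := hk.of_le one_le_two
  have hf : ContDiff ℝ 1 (fderiv ℝ a) := h1.fderiv_right (m := 1) (by norm_num [one_add_one_eq_two])
  have hfk : ContDiff ℝ 1 (fderiv ℝ k) := hk.fderiv_right (m := 1) (by norm_num [one_add_one_eq_two])
  have hA := (ha.fderivK ha1).fderivK hf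
  have hb : ContDiff ℝ 1 (fun z => fderiv ℝ a z e') := hf.clm_apply contDiff_const
  rw [Mop_apply hA hk.continuous, Mop_apply (hA.applyK e) hk.continuous]
  have e1 : ∀ z, fderiv ℝ (fderiv ℝ a) z e e' = fderiv ℝ (fun z => fderiv ℝ a z e') z e := by
    intro z
    rw [fderiv_clm_apply (hf.differentiable one_ne_zero z) (differentiableAt_const _)]
    simp
  have hB := (ha.fderivK ha1).applyK e'
  have h2 := Mop_swap hB hb hk1 s x e
  rw [Mop_apply (hB.fderivK hb) hk.continuous] at h2
  simp only [e1]
  rw [h2]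
  have hb' : ContDiff ℝ 1 (fun y => fderiv ℝ k y e) := hfk.clm_apply contDiff_const
  have h3 := Mop_swap ha ha1 hb' s x e'
  rw [Mop_apply (ha.fderivK ha1) hb'.continuous] at h3
  rw [h3]
  have e2 : ∀ y, fderiv ℝ (fun y => fderiv ℝ k y e) y e' = fderiv ℝ (fderiv ℝ k) y e' e := by
    intro z
    rw [fderiv_clm_apply (hfk.differentiable one_ne_zero z) (differentiableAt_const _)]
    simp
  simp only [e2]
  ring

theorem lap_continuous {k : EuclideanSpace ℝ (Fin m) → ℝ} (hk : ContDiff ℝ 2 k) :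
    Continuous (lap k) := by
  have : lap k = fun y => ∑ i : Fin m, fderiv ℝ (fderiv ℝ k) y (EuclideanSpace.single i 1)
      (EuclideanSpace.single i 1) := by ext y; exact lap_eq k y
  rw [this]
  have hfk : ContDiff ℝ 1 (fderiv ℝ k) := hk.fderiv_right (m := 1) (by norm_num [one_add_one_eq_two])
  have := hfk.continuous_fderiv one_ne_zero
  fun_prop

theorem Mop_sum {E : Type*} [NormedAddCommGroup E] [InnerProductSpace ℝ E]
    [FiniteDimensional ℝ E] [MeasurableSpace E] [BorelSpace E]
    {ι : Type*} (t : Finset ι)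
    {a : E → ℝ} (ha : Ker a) {k : ι → E → ℝ} (hk : ∀ i, Continuous (k i))
    (s : ℝ) (x : E) : Mop a (fun y => ∑ i ∈ t, k i y) s x = ∑ i ∈ t, Mop a (k i) s x := by
  unfold Mop
  rw [← integral_finsetSum _ (fun i _ => Mop_int ha (hk i) s x)]
  simp [Finset.sum_mul]

theorem Mop_trace {a : EuclideanSpace ℝ (Fin m) → ℝ} (ha : Ker a) (h1 : ContDiff ℝ 2 a)
    {k : EuclideanSpace ℝ (Fin m) → ℝ} (hk : ContDiff ℝ 2 k) (s : ℝ) (x) :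
    ∑ i : Fin m, Mop (fderiv ℝ (fderiv ℝ a)) k s x (EuclideanSpace.single i 1)
      (EuclideanSpace.single i 1) = s ^ 2 * Mop a (lap k) s x := by
  have : lap k = fun y => ∑ i : Fin m, fderiv ℝ (fderiv ℝ k) y (EuclideanSpace.single i 1)
      (EuclideanSpace.single i 1) := by ext y; exact lap_eq k y
  have hfk : ContDiff ℝ 1 (fderiv ℝ k) := hk.fderiv_right (m := 1) (by norm_num [one_add_one_eq_two])
  have hc := hfk.continuous_fderiv one_ne_zero
  rw [this, Mop_sum _ ha (fun i => by fun_prop), Finset.mul_sum]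
  exact Finset.sum_congr rfl fun i _ => Mop_swap2 ha h1 hk s x _ _

theorem Mop_rho_hasDerivAt {k : EuclideanSpace ℝ (Fin m) → ℝ} (hk : ContDiff ℝ 2 k) (s : ℝ) (x) :
    HasDerivAt (fun s => Mop rho k s x) (s * Mop kap (lap k) s x) s := by
  have hk1 : ContDiff ℝ 1 k := hk.of_le one_le_two
  have hfk : ContDiff ℝ 1 (fderiv ℝ k) := hk.fderiv_right (m := 1) (by norm_num [one_add_one_eq_two])
  have hc := hfk.continuous
  have hkap1 : ContDiff ℝ 1 (kap : EuclideanSpace ℝ (Fin m) → ℝ) := kap_contDiff.of_le one_le_two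
  obtain ⟨B, hB0, hB⟩ := bdd_on_ball hc (‖x‖ + (|s| + 1))
  have key := hasDerivAt_integral_of_dominated_loc_of_deriv_le (𝕜 := ℝ)
    (μ := (volume : Measure (EuclideanSpace ℝ (Fin m))))
    (F := fun s z => k (x - s • z) • rho z)
    (F' := fun s z => -(fderiv ℝ k (x - s • z) z) * rho z) (x₀ := s)
    (s := ball s 1) (bound := fun z => B * rho z) (ball_mem_nhds s one_pos)
    (Eventually.of_forall fun s => (Mop_int rho_ker hk.continuous s x).aestronglyMeasurable)
    (Mop_int rho_ker hk.continuous s x) ?_ ?_ (rho_ker.int.const_mul B) ?_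
  · refine (key.2).congr_deriv ?_
    have e1 : ∀ z : EuclideanSpace ℝ (Fin m), -(fderiv ℝ k (x - s • z) z) * rho z =
        ∑ i : Fin m, fderiv ℝ k (x - s • z) (EuclideanSpace.single i 1)
          • fderiv ℝ kap z (EuclideanSpace.single i 1) := by
      intro z
      have hz : z = ∑ i : Fin m, z i • EuclideanSpace.single i (1:ℝ) := by
        ext j; simp [Finset.sum_apply, Pi.single_apply]
      conv_lhs => rw [hz]
      simp only [map_sum, map_smul, kap_fderiv]
      rw [← hz, ← Finset.sum_neg_distrib, Finset.sum_mul]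
      refine Finset.sum_congr rfl fun i _ => ?_
      simp [EuclideanSpace.inner_single_right]
      ring
    simp only [e1]
    have hcont : ∀ i : Fin m, ContDiff ℝ 1 (fun y => fderiv ℝ k y (EuclideanSpace.single i 1)) :=
      fun i => hfk.clm_apply contDiff_const
    have hK := (kap_ker (E := EuclideanSpace ℝ (Fin m))).fderivK hkap1
    rw [integral_finsetSum _ (fun i _ => Mop_int (hK.applyK _) (hcont i).continuous s x)]
    have hl : lap k = fun y => ∑ i : Fin m, fderiv ℝ (fderiv ℝ k) y (EuclideanSpace.single i 1)
      (EuclideanSpace.single i 1) := by ext y; exact lap_eq k y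
    have hc2 := hfk.continuous_fderiv one_ne_zero
    rw [hl, Mop_sum _ kap_ker (fun i => by fun_prop), Finset.mul_sum]
    refine Finset.sum_congr rfl fun i _ => ?_
    have := Mop_swap kap_ker hkap1 (hcont i) s x (EuclideanSpace.single i 1)
    rw [Mop_apply hK (hcont i).continuous] at this
    refine this.trans ?_
    congr 2; ext y
    rw [fderiv_clm_apply (hfk.differentiable one_ne_zero y) (differentiableAt_const _)]
    simp
  · refine Continuous.aestronglyMeasurable ?_
    have := rho_ker (E := EuclideanSpace ℝ (Fin m)).cont
    fun_prop
  · refine Eventually.of_forall fun z t ht => ?_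
    rw [norm_mul, norm_neg, Real.norm_of_nonneg (rho_nonneg z)]
    by_cases hz : 1 < ‖z‖
    · simp [rho_ker.supp z hz]
    · refine mul_le_mul_of_nonneg_right ?_ (rho_nonneg z)
      have hz' := not_lt.1 hz
      refine (ContinuousLinearMap.le_opNorm _ _).trans ?_
      refine (mul_le_of_le_one_right (norm_nonneg _) hz').trans (hB _ ?_)
      refine (norm_sub_le _ _).trans (add_le_add_right ?_ _)
      rw [norm_smul]
      have : |t| ≤ |s| + 1 := by
        rw [mem_ball, Real.dist_eq] at ht
        have := abs_sub_abs_le_abs_sub t s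
        linarith
      calc ‖t‖ * ‖z‖ ≤ ‖t‖ * 1 := by gcongr
        _ ≤ _ := by simpa using this
  · refine Eventually.of_forall fun z t _ => ?_
    have h2 : HasFDerivAt k (fderiv ℝ k (x - t • z)) (x - t • z) :=
      (hk1.differentiable one_ne_zero _).hasFDerivAt
    have h3 : HasDerivAt (fun t : ℝ => x - t • z) (-z) t := by
      simpa using ((hasDerivAt_id t).smul_const z).const_sub x
    have := (h2.comp_hasDerivAt t h3).mul_const (rho z)
    simpa using this

noncomputable def Eop (r : ℝ) (k : EuclideanSpace ℝ (Fin m) → ℝ) : EuclideanSpace ℝ (Fin m) → ℝ :=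
  Tint r (fun s => s * (2 * (1 - s ^ 2 / r ^ 2))) kap k
noncomputable def Aop (r : ℝ) (k : EuclideanSpace ℝ (Fin m) → ℝ) : EuclideanSpace ℝ (Fin m) → ℝ :=
  Tint r (fun s => s * (2 / r ^ 2)) rho k

theorem Eop_lap {r : ℝ} (hr : 0 < r) {k : EuclideanSpace ℝ (Fin m) → ℝ} (hk : ContDiff ℝ 2 k) (x) :
    Eop r (lap k) x = 2 * (Aop r k x - k x) := by
  have hd : ∀ s, HasDerivAt (fun s => 2 * (1 - s ^ 2 / r ^ 2) * Mop rho k s x)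
      (s * (2 * (1 - s ^ 2 / r ^ 2)) * Mop kap (lap k) s x - 2 * (s * (2 / r ^ 2) * Mop rho k s x)) s := by
    intro s
    have h1 : HasDerivAt (fun s : ℝ => 2 * (1 - s ^ 2 / r ^ 2)) (2 * (-(2 * s / r ^ 2))) s := by
      have := ((((hasDerivAt_id s).pow 2).div_const (r ^ 2)).const_sub 1).const_mul 2
      simpa using this
    refine (h1.mul (Mop_rho_hasDerivAt hk s x)).congr_deriv ?_
    ring
  have c1 : Continuous fun s => s * (2 * (1 - s ^ 2 / r ^ 2)) * Mop kap (lap k) s x := by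
    have := Mop_cont_s kap_ker (lap_continuous hk) x
    fun_prop
  have c2 : Continuous fun s => (s * (2 / r ^ 2) * Mop rho k s x) := by
    have := Mop_cont_s rho_ker hk.continuous x
    fun_prop
  have h := intervalIntegral.integral_eq_sub_of_hasDerivAt (a := 0) (b := r) (fun s _ => hd s)
    ((c1.sub (c2.const_mul 2)).intervalIntegrable _ _)
  rw [intervalIntegral.integral_sub (c1.intervalIntegrable _ _) ((c2.const_mul 2).intervalIntegrable _ _),
    intervalIntegral.integral_const_mul] at h
  have h0 : Mop rho k 0 x = k x := by
    simp [Mop, integral_const_mul, rho_integral]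
  simp only [Eop, Aop, Tint, smul_eq_mul]
  rw [div_self (pow_ne_zero 2 hr.ne')] at h
  simp [h0] at h
  linarith

end EllipticKernel4

set_option linter.unusedSectionVars false
set_option linter.unusedVariables false

section EllipticKernel5

open MeasureTheory Topology Metric Set

section gen
variable {E : Type*} [NormedAddCommGroup E] [InnerProductSpace ℝ E] [FiniteDimensional ℝ E]
  [MeasurableSpace E] [BorelSpace E]
variable {F : Type*} [NormedAddCommGroup F] [NormedSpace ℝ F] [FiniteDimensional ℝ F]

theorem clm_intble {F G : Type*} [NormedAddCommGroup F] [NormedSpace ℝ F]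
    [NormedAddCommGroup G] [NormedSpace ℝ G] (L : F →L[ℝ] G) {f : ℝ → F} {a b : ℝ}
    (h : IntervalIntegrable f volume a b) : IntervalIntegrable (fun s => L (f s)) volume a b :=
  ⟨L.integrable_comp h.1, L.integrable_comp h.2⟩

theorem contDiff_two_of {G : Type*} [NormedAddCommGroup G] [NormedSpace ℝ G]
    {u : E → G} {u' : E → E →L[ℝ] G} {u'' : E → E →L[ℝ] E →L[ℝ] G}
    (h1 : ∀ x, HasFDerivAt u (u' x) x) (h2 : ∀ x, HasFDerivAt u' (u'' x) x) (hc : Continuous u'') :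
    ContDiff ℝ 2 u ∧ fderiv ℝ u = u' ∧ fderiv ℝ (fderiv ℝ u) = u'' := by
  have e1 : fderiv ℝ u = u' := funext fun x => (h1 x).fderiv
  have e2 : fderiv ℝ u' = u'' := funext fun x => (h2 x).fderiv
  refine ⟨?_, e1, by rw [e1, e2]⟩
  rw [show (2 : WithTop ℕ∞) = 1 + 1 by norm_num [one_add_one_eq_two], contDiff_succ_iff_fderiv]
  refine ⟨fun x => (h1 x).differentiableAt, by simp, ?_⟩
  rw [e1, contDiff_one_iff_fderiv]
  refine ⟨fun x => (h2 x).differentiableAt, ?_⟩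
  rw [e2]; exact hc

theorem Tint_C2 {r : ℝ} (hr : 0 < r) {w : ℝ → ℝ} (hw : Continuous w)
    {a : E → ℝ} (ha : Ker a) (h2 : ContDiff ℝ 2 a) {k : E → ℝ} (hk : LH k) :
    ContDiff ℝ 2 (Tint r (fun s => s * w s) a k) ∧
    fderiv ℝ (Tint r (fun s => s * w s) a k) = Tint r w (fderiv ℝ a) k ∧
    fderiv ℝ (fderiv ℝ (Tint r (fun s => s * w s) a k)) =
      Tint r (fun s => w s * s⁻¹) (fderiv ℝ (fderiv ℝ a)) k := by
  have h1 : ContDiff ℝ 1 a := h2.of_le one_le_two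
  have hf : ContDiff ℝ 1 (fderiv ℝ a) := h2.fderiv_right (m := 1) (by norm_num [one_add_one_eq_two])
  have hK := ha.fderivK h1
  exact contDiff_two_of (fun x => Tint_hasFDerivAt_one hr hw ha h1 hk.continuous x)
    (fun x => Tint_hasFDerivAt_two hr hw hK hf hk x)
    (Tint_sing_continuous hr hw (hK.fderivK hf) (hK.integral_fderiv hf) hk)

theorem LH_of_C1 {k : E → ℝ} (hk : ContDiff ℝ 1 k) : LH k := by
  intro ρ
  obtain ⟨B, hB0, hB⟩ := bdd_on_ball (hk.continuous_fderiv one_ne_zero) ρ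
  refine ⟨B * √(2 * ρ), by positivity, fun x y hx hy => ?_⟩
  have h := (convex_closedBall (0:E) ρ).norm_image_sub_le_of_norm_fderiv_le (𝕜 := ℝ) (f := k)
    (C := B) (fun z _ => hk.differentiable one_ne_zero z) (fun z hz => hB z (by simpa using hz))
    (x := y) (y := x) (by simpa using hy) (by simpa using hx)
  rw [Real.norm_eq_abs] at h
  refine h.trans ?_
  rw [mul_assoc]
  gcongr
  have h3 : ‖x - y‖ ≤ 2 * ρ := (norm_sub_le _ _).trans (by linarith)
  rw [← Real.sqrt_mul ((norm_nonneg _).trans h3)]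
  apply Real.le_sqrt_of_sq_le
  nlinarith [norm_nonneg (x - y)]

theorem Mop_C2 {a : E → ℝ} (ha : Ker a) (h2 : ContDiff ℝ 2 a) {k : E → ℝ} (hk : Continuous k)
    {s : ℝ} (hs : 0 < s) : ContDiff ℝ 2 (Mop a k s) := by
  have h1 : ContDiff ℝ 1 a := h2.of_le one_le_two
  have hf : ContDiff ℝ 1 (fderiv ℝ a) := h2.fderiv_right (m := 1) (by norm_num [one_add_one_eq_two])
  have hK := ha.fderivK h1
  refine (contDiff_two_of (u' := fun x => s⁻¹ • Mop (fderiv ℝ a) k s x)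
    (u'' := fun x => s⁻¹ • s⁻¹ • Mop (fderiv ℝ (fderiv ℝ a)) k s x)
    (fun x => Mop_hasFDerivAt ha h1 hk hs x)
    (fun x => (Mop_hasFDerivAt hK hf hk hs x).const_smul s⁻¹) ?_).1
  have := (Mop_continuous (hK.fderivK hf) hk).comp (by fun_prop : Continuous fun y : E => (s, y))
  exact (Continuous.const_smul (Continuous.const_smul this s⁻¹) s⁻¹)

theorem Tint_sing_intble {r : ℝ} (hr : 0 < r) {w : ℝ → ℝ} (hw : Continuous w)
    {a : E → F} (ha : Ker a) (h0 : ∫ z, a z = 0) {k : E → ℝ} (hk : LH k) (x : E) :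
    IntervalIntegrable (fun s => (w s * s⁻¹) • Mop a k s x) volume 0 r := by
  obtain ⟨W, hW0, hW⟩ := bdd_Icc hw r
  obtain ⟨C, hC0, hC⟩ := hk (‖x‖ + r)
  have := (intble_sqrt_inv r hr).const_mul (W * (C * ∫ z, ‖a z‖))
  refine this.mono_fun ?_ ?_
  · refine AEStronglyMeasurable.smul ?_ ?_
    · exact (hw.measurable.mul measurable_inv).aestronglyMeasurable
    · exact (Mop_cont_s ha hk.continuous x).aestronglyMeasurable
  · refine (ae_restrict_mem measurableSet_uIoc).mono fun s hs => ?_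
    rw [uIoc_of_le hr.le] at hs
    have hs0 := hs.1
    have hM := Mop_mean_zero ha h0 hk.continuous hs0.le hC0 (x := x) (fun y hy => hC _ _ (by
      have h1 := norm_le_norm_add_norm_sub' y x
      linarith [hs.2]) (by linarith))
    beta_reduce
    rw [norm_smul, norm_mul, norm_inv, Real.norm_of_nonneg hs0.le]
    refine le_trans ?_ (le_abs_self _)
    calc ‖w s‖ * s⁻¹ * ‖Mop a k s x‖
        ≤ W * s⁻¹ * (C * √s * ∫ z, ‖a z‖) := by
          gcongr
          exact hW s ⟨hs.1.le, hs.2⟩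
      _ = _ := by ring

theorem Mop_rho_approx {k : E → ℝ} (hk : LH k) (x : E) (r : ℝ) (hr : 0 < r) :
    ∃ (kn : ℕ → E → ℝ) (ε : ℕ → ℝ) (C : ℝ), (∀ n, ContDiff ℝ 2 (kn n)) ∧
      Tendsto ε atTop (𝓝 0) ∧ (∀ n y, ‖y - x‖ ≤ r → |kn n y - k y| ≤ ε n) ∧ 0 ≤ C ∧
      (∀ n y, ‖y - x‖ ≤ r → |kn n y - kn n x| ≤ C * √‖y - x‖) := by
  obtain ⟨C, hC0, hC⟩ := hk (‖x‖ + r + 1)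
  set s : ℕ → ℝ := fun n => 1 / ((n:ℝ) + 1) with hs
  have hs0 : ∀ n, 0 < s n := fun n => by simp only [hs]; positivity
  have hs1 : ∀ n, s n ≤ 1 := fun n => by
    simp only [hs]; rw [div_le_one (by positivity)]; linarith [n.cast_nonneg (α := ℝ)]
  refine ⟨fun n => Mop rho k (s n), fun n => C * √(s n), C, fun n =>
    Mop_C2 rho_ker rho_contDiff hk.continuous (hs0 n), ?_, ?_, hC0, ?_⟩
  · have h1 : Tendsto s atTop (𝓝 0) := tendsto_one_div_add_atTop_nhds_zero_nat
    have : Continuous fun t => C * √t := by fun_prop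
    have h2 := (this.tendsto 0).comp h1
    simp only [Real.sqrt_zero, mul_zero] at h2
    exact h2
  · intro n y hy
    have e : k y = Mop rho (fun _ => k y) (s n) y := by
      simp [Mop, integral_const_mul, rho_integral]
    have hy' := norm_le_norm_add_norm_sub' y x
    rw [e, ← Mop_sub rho_ker hk.continuous continuous_const]
    have hb := Mop_bound (E := E) rho_ker (k := fun z => k z - k y) (s := s n) (x := y)
      (B := C * √(s n)) (hs0 n).le ?_
    · rw [show ∫ z : E, ‖rho z‖ = 1 by
        simp only [Real.norm_of_nonneg (rho_nonneg _)]; exact rho_integral, mul_one] at hb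
      exact hb
    · intro z hz
      have hz' := norm_le_norm_add_norm_sub' z y
      refine (hC z y (by linarith [hs1 n]) (by linarith)).trans ?_
      gcongr
  · intro n y hy
    have hy' := norm_le_norm_add_norm_sub' y x
    have e : Mop rho k (s n) y - Mop rho k (s n) x =
        ∫ z, (k (y - s n • z) - k (x - s n • z)) • rho z := by
      unfold Mop
      rw [← integral_sub (Mop_int rho_ker hk.continuous _ _) (Mop_int rho_ker hk.continuous _ _)]
      simp only [sub_smul]
    rw [e]
    have : ‖∫ z, (k (y - s n • z) - k (x - s n • z)) • rho z‖ ≤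
        ∫ z : E, (C * √‖y - x‖) * rho z := by
      refine norm_integral_le_of_norm_le (rho_ker.int.const_mul _) (Eventually.of_forall fun z => ?_)
      rw [norm_smul, Real.norm_of_nonneg (rho_nonneg z)]
      by_cases hz : 1 < ‖z‖
      · simp [rho_ker.supp z hz]
      · refine mul_le_mul_of_nonneg_right ?_ (rho_nonneg z)
        have hz' := not_lt.1 hz
        have h1 : ‖s n • z‖ ≤ 1 := by
          rw [norm_smul, Real.norm_of_nonneg (hs0 n).le]
          exact mul_le_one₀ (hs1 n) (norm_nonneg _) hz'
        have := hC (y - s n • z) (x - s n • z) ((norm_sub_le _ _).trans (by linarith))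
          ((norm_sub_le _ _).trans (by linarith))
        simpa using this
    rw [integral_const_mul, rho_integral, mul_one] at this
    exact this

end gen

variable {m : ℕ}

theorem lap_Eop_C2 {r : ℝ} (hr : 0 < r) {k : EuclideanSpace ℝ (Fin m) → ℝ} (hk : ContDiff ℝ 2 k) (x) :
    lap (Eop r k) x = 2 * (Aop r k x - k x) := by
  rw [← Eop_lap hr hk]
  have hw : Continuous fun s : ℝ => 2 * (1 - s ^ 2 / r ^ 2) := by fun_prop
  have hkL := LH_of_C1 (hk.of_le one_le_two)
  have hC := (Tint_C2 hr hw (kap_ker (E := EuclideanSpace ℝ (Fin m))) kap_contDiff hkL).2.2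
  have ha1 : ContDiff ℝ 1 (kap : EuclideanSpace ℝ (Fin m) → ℝ) := kap_contDiff.of_le one_le_two
  have hf : ContDiff ℝ 1 (fderiv ℝ (kap : EuclideanSpace ℝ (Fin m) → ℝ)) :=
    kap_contDiff.fderiv_right (m := 1) (by norm_num [one_add_one_eq_two])
  have hK := (kap_ker (E := EuclideanSpace ℝ (Fin m))).fderivK ha1
  have hI := Tint_sing_intble hr hw (hK.fderivK hf) (hK.integral_fderiv hf) hkL x
  rw [lap_eq]
  unfold Eop
  rw [hC]
  set e : Fin m → EuclideanSpace ℝ (Fin m) := fun i => EuclideanSpace.single i 1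
  have e1 : ∀ i, Tint r (fun s => (2 * (1 - s ^ 2 / r ^ 2)) * s⁻¹) (fderiv ℝ (fderiv ℝ kap)) k x
      (e i) (e i) = ∫ s in (0:ℝ)..r, (2 * (1 - s ^ 2 / r ^ 2)) * s⁻¹ *
        (Mop (fderiv ℝ (fderiv ℝ kap)) k s x (e i) (e i)) := by
    intro i
    unfold Tint
    have hI2 : IntervalIntegrable (fun s => (2 * (1 - s ^ 2 / r ^ 2) * s⁻¹) •
        Mop (fderiv ℝ (fderiv ℝ kap)) k s x (e i)) volume 0 r := by
      have := clm_intble ((ContinuousLinearMap.apply ℝ (EuclideanSpace ℝ (Fin m) →L[ℝ] ℝ) (e i))) hI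
      simpa using this
    rw [ContinuousLinearMap.intervalIntegral_apply hI]
    simp only [_root_.smul_apply]
    rw [ContinuousLinearMap.intervalIntegral_apply hI2]
    simp
  have e2 : ∀ i, IntervalIntegrable (fun s => (2 * (1 - s ^ 2 / r ^ 2)) * s⁻¹ *
        (Mop (fderiv ℝ (fderiv ℝ kap)) k s x (e i) (e i))) volume 0 r := by
    intro i
    have := clm_intble ((ContinuousLinearMap.apply ℝ ℝ (e i)) ∘L (ContinuousLinearMap.apply ℝ (EuclideanSpace ℝ (Fin m) →L[ℝ] ℝ) (e i))) hI
    simpa using this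
  rw [Finset.sum_congr rfl fun i _ => e1 i, ← intervalIntegral.integral_finsetSum (fun i _ => e2 i)]
  unfold Tint
  refine intervalIntegral.integral_congr_ae ?_
  refine Eventually.of_forall fun s hs => ?_
  rw [uIoc_of_le hr.le] at hs
  rw [← Finset.mul_sum, Mop_trace kap_ker kap_contDiff hk]
  have := hs.1.ne'
  simp only [smul_eq_mul]
  field_simp

theorem Eop_C2 {r : ℝ} (hr : 0 < r) {k : EuclideanSpace ℝ (Fin m) → ℝ} (hk : LH k) :
    ContDiff ℝ 2 (Eop r k) :=
  (Tint_C2 hr (by fun_prop) kap_ker kap_contDiff hk).1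

theorem Aop_C2 {r : ℝ} (hr : 0 < r) {k : EuclideanSpace ℝ (Fin m) → ℝ} (hk : LH k) :
    ContDiff ℝ 2 (Aop r k) :=
  (Tint_C2 hr (w := fun _ => 2 / r ^ 2) (by fun_prop) rho_ker rho_contDiff hk).1

theorem lap_Eop {r : ℝ} (hr : 0 < r) {k : EuclideanSpace ℝ (Fin m) → ℝ} (hk : LH k) (x) :
    lap (Eop r k) x = 2 * (Aop r k x - k x) := by
  obtain ⟨kn, ε, C, h1, h2, h3, h4, h5⟩ := Mop_rho_approx hk x r hr
  have hw : Continuous fun s : ℝ => 2 * (1 - s ^ 2 / r ^ 2) := by fun_prop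
  have ha1 : ContDiff ℝ 1 (kap : EuclideanSpace ℝ (Fin m) → ℝ) := kap_contDiff.of_le one_le_two
  have hf : ContDiff ℝ 1 (fderiv ℝ (kap : EuclideanSpace ℝ (Fin m) → ℝ)) :=
    kap_contDiff.fderiv_right (m := 1) (by norm_num [one_add_one_eq_two])
  have hK := (kap_ker (E := EuclideanSpace ℝ (Fin m))).fderivK ha1
  have t1 := Tint_tendsto_sing hr hw (hK.fderivK hf) (hK.integral_fderiv hf) hk.continuous
    (fun n => (h1 n).continuous) x h2 h3 h4 h5
  have t2 : Tendsto (fun n => Aop r (kn n) x) atTop (𝓝 (Aop r k x)) :=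
    Tint_tendsto hr (by fun_prop) rho_ker hk.continuous (fun n => (h1 n).continuous) x h2 h3
  have t3 : Tendsto (fun n => kn n x) atTop (𝓝 (k x)) := by
    rw [tendsto_iff_norm_sub_tendsto_zero]
    exact squeeze_zero (fun _ => norm_nonneg _) (fun n => h3 n x (by simpa using hr.le)) h2
  have t4 : Tendsto (fun n => lap (Eop r (kn n)) x) atTop (𝓝 (lap (Eop r k) x)) := by
    simp only [lap_eq]
    refine tendsto_finsetSum _ fun i _ => ?_
    have e1 : ∀ n, fderiv ℝ (fderiv ℝ (Eop r (kn n))) = _ := fun n =>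
      (Tint_C2 hr hw kap_ker kap_contDiff (LH_of_C1 ((h1 n).of_le one_le_two))).2.2
    have e2 : fderiv ℝ (fderiv ℝ (Eop r k)) = _ :=
      (Tint_C2 hr hw kap_ker kap_contDiff hk).2.2
    simp only [e1, e2]
    have hc : Continuous fun L : EuclideanSpace ℝ (Fin m) →L[ℝ] EuclideanSpace ℝ (Fin m) →L[ℝ] ℝ =>
      L (EuclideanSpace.single i 1) (EuclideanSpace.single i 1) := by fun_prop
    exact (hc.tendsto _).comp t1
  refine tendsto_nhds_unique t4 ?_
  simp only [fun n => lap_Eop_C2 hr (h1 n) x]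
  exact (t2.sub t3).const_mul 2

end EllipticKernel5

set_option linter.unusedSectionVars false
set_option linter.unusedVariables false

section EllipticKernel6

open MeasureTheory Topology Metric Set

abbrev XX (m : ℕ) := EuclideanSpace ℝ (Fin m)

variable {m : ℕ}

theorem Eop_const {r : ℝ} (hr : 0 < r) (c : ℝ) (x : XX m) :
    Eop r (fun _ => c) x = c * (∫ z : XX m, kap z) * (r ^ 2 / 2) := by
  unfold Eop Tint
  have : ∀ s, Mop kap (fun _ => c) s x = c * ∫ z : XX m, kap z := by
    intro s; simp [Mop, integral_const_mul]
  simp only [this, smul_eq_mul]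
  rw [intervalIntegral.integral_mul_const]
  have hd : ∀ s ∈ uIcc 0 r, HasDerivAt (fun s : ℝ => s ^ 2 - s ^ 4 / (2 * r ^ 2))
      (s * (2 * (1 - s ^ 2 / r ^ 2))) s := by
    intro s _
    refine ((hasDerivAt_pow 2 s).sub ((hasDerivAt_pow 4 s).div_const (2 * r ^ 2))).congr_deriv ?_
    field_simp
    norm_num; ring
  rw [intervalIntegral.integral_eq_sub_of_hasDerivAt hd
    (Continuous.intervalIntegrable (by fun_prop) _ _)]
  field_simp
  ring

theorem Eop_zero {q : XX m → ℝ} (hq : Continuous q) (x : XX m)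
    (h : ∀ r, 0 < r → Eop r q x = 0) : q x = 0 := by
  by_contra hne
  have hc : 0 < |q x| := abs_pos.2 hne
  have hcont := Metric.continuousAt_iff.1 (hq.continuousAt (x := x)) (|q x| / 5) (by positivity)
  obtain ⟨d, hd, hdd⟩ := hcont
  have hr : 0 < d / 2 := by positivity
  set r := d / 2 with hrd
  have h1 := h r hr
  have hb := Tint_bound hr.le (w := fun s => s * (2 * (1 - s ^ 2 / r ^ 2))) (W := 2 * r)
    (B := |q x| / 5) ?_ (kap_ker (E := XX m)) (k := fun y => q y - q x) (x := x) ?_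
  · have e : Tint r (fun s => s * (2 * (1 - s ^ 2 / r ^ 2))) kap (fun y => q y - q x) x =
        Eop r q x - Eop r (fun _ => q x) x :=
      Tint_sub (by fun_prop) kap_ker hq continuous_const x
    rw [e, h1, Eop_const hr, zero_sub, norm_neg, norm_mul, norm_mul] at hb
    have hk := kap_pos_integral (E := XX m)
    have e2 : ∫ z : XX m, ‖(kap z : ℝ)‖ = ∫ z : XX m, kap z := by
      simp only [Real.norm_of_nonneg (kap_nonneg _)]
    rw [e2, Real.norm_of_nonneg hk.le, Real.norm_of_nonneg (by positivity : 0 ≤ r ^ 2 / 2),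
      Real.norm_eq_abs] at hb
    have : 0 < |q x| * (∫ z : XX m, kap z) * r ^ 2 := by positivity
    nlinarith
  · intro s hs
    have h0 := hs.1
    have h2 : 0 ≤ 1 - s ^ 2 / r ^ 2 := by
      rw [sub_nonneg, div_le_one (by positivity)]
      exact pow_le_pow_left₀ h0 hs.2 2
    have h3 : 1 - s ^ 2 / r ^ 2 ≤ 1 := by
      have : 0 ≤ s ^ 2 / r ^ 2 := by positivity
      linarith
    rw [abs_of_nonneg (by positivity)]
    nlinarith [hs.2, mul_nonneg h0 h2, mul_nonneg h0 (sub_nonneg.2 h3)]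
  · intro y hy
    have := hdd (x := y) (by rw [dist_eq_norm]; linarith)
    rw [Real.dist_eq] at this
    exact this.le

theorem Tint_C1 {r : ℝ} (hr : 0 < r) {w : ℝ → ℝ} (hw : Continuous w)
    {a : XX m → ℝ} (ha : Ker a) (h1 : ContDiff ℝ 1 a) {k : XX m → ℝ} (hk : Continuous k) :
    ContDiff ℝ 1 (Tint r (fun s => s * w s) a k) := by
  rw [contDiff_one_iff_fderiv]
  have h := fun x => Tint_hasFDerivAt_one hr hw ha h1 hk x
  refine ⟨fun x => (h x).differentiableAt, ?_⟩
  rw [funext fun x => (h x).fderiv]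
  exact Tint_continuous hw (ha.fderivK h1) hk

theorem Eop_C1 {r : ℝ} (hr : 0 < r) {k : XX m → ℝ} (hk : Continuous k) : ContDiff ℝ 1 (Eop r k) :=
  Tint_C1 hr (by fun_prop) kap_ker (kap_contDiff.of_le one_le_two) hk

theorem Aop_C1 {r : ℝ} (hr : 0 < r) {k : XX m → ℝ} (hk : Continuous k) : ContDiff ℝ 1 (Aop r k) :=
  Tint_C1 hr (w := fun _ => 2 / r ^ 2) (by fun_prop) rho_ker (rho_contDiff.of_le one_le_two) hk

theorem repr_C2 {u k : XX m → ℝ} (hu : Continuous u) (hk : LH k)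
    (h : ∀ r, 0 < r → ∀ x, u x = Aop r u x + Eop r k x) :
    ContDiff ℝ 2 u ∧ ∀ x, -(1/2) * lap u x = k x := by
  have e1 : u = fun x => Aop 1 u x + Eop 1 k x := funext (h 1 one_pos)
  have h1 : ContDiff ℝ 1 u := by
    rw [e1]; exact (Aop_C1 one_pos hu).add (Eop_C1 one_pos hk.continuous)
  have h2 : ContDiff ℝ 2 u := by
    rw [e1]; exact (Aop_C2 one_pos (LH_of_C1 h1)).add (Eop_C2 one_pos hk)
  refine ⟨h2, fun x => ?_⟩
  have hq : (fun y => (-(1/2) * lap u y) - k y) x = 0 := by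
    have hl := lap_continuous h2
    have hkc := hk.continuous
    have hqc : Continuous (fun y => (-(1/2) * lap u y) - k y) := by fun_prop
    refine Eop_zero hqc x fun r hr => ?_
    have e : Eop r (fun y => (-(1/2) * lap u y) - k y) x = Eop r (fun y => -(1/2) * lap u y) x - Eop r k x :=
      Tint_sub (by fun_prop) kap_ker (by fun_prop) hkc x
    have e3 : Eop r (fun y => -(1/2) * lap u y) x = -(1/2) * Eop r (lap u) x := by
      have : ∀ s, Mop kap (fun y => -(1/2) * lap u y) s x = -(1/2) * Mop kap (lap u) s x := by
        intro s
        simp only [Mop, smul_eq_mul, mul_assoc]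
        rw [integral_const_mul]
      unfold Eop Tint
      rw [← intervalIntegral.integral_const_mul]
      congr 1; ext s
      rw [this, smul_eq_mul, smul_eq_mul]; ring
    rw [e, e3, Eop_lap hr h2]
    linarith [h r hr x]
  linarith

/-! coordinate derivatives -/

noncomputable def ee (i : Fin m) : XX m := EuclideanSpace.single i 1

noncomputable def dd (i : Fin m) (k : XX m → ℝ) (y : XX m) : ℝ := fderiv ℝ k y (ee i)

theorem dd_C1 {k : XX m → ℝ} (hk : ContDiff ℝ 2 k) (i : Fin m) : ContDiff ℝ 1 (dd i k) :=
  (hk.fderiv_right (m := 1) (by norm_num [one_add_one_eq_two])).clm_apply contDiff_const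

theorem dd_diff {k : XX m → ℝ} (hk : ContDiff ℝ 2 k) (i : Fin m) (y) :
    DifferentiableAt ℝ (dd i k) y := (dd_C1 hk i).differentiable one_ne_zero y

theorem dd_dd {k : XX m → ℝ} (hk : ContDiff ℝ 2 k) (i j : Fin m) (y) :
    dd i (dd j k) y = fderiv ℝ (fderiv ℝ k) y (ee i) (ee j) := by
  have hfk : ContDiff ℝ 1 (fderiv ℝ k) := hk.fderiv_right (m := 1) (by norm_num [one_add_one_eq_two])
  have : dd j k = fun y => fderiv ℝ k y (ee j) := rfl
  unfold dd
  rw [fderiv_clm_apply (hfk.differentiable one_ne_zero y) (differentiableAt_const _)]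
  simp

theorem lap_dd {k : XX m → ℝ} (hk : ContDiff ℝ 2 k) (y) :
    lap k y = ∑ i, dd i (dd i k) y := by
  rw [lap_eq]
  exact Finset.sum_congr rfl fun i _ => (dd_dd hk i i y).symm

theorem C2_diff {k : XX m → ℝ} (hk : ContDiff ℝ 2 k) (y) : DifferentiableAt ℝ k y :=
  hk.differentiable two_ne_zero y

theorem dd_add {f g : XX m → ℝ} {y} (hf : DifferentiableAt ℝ f y) (hg : DifferentiableAt ℝ g y)
    (i : Fin m) : dd i (fun y => f y + g y) y = dd i f y + dd i g y := by
  unfold dd; rw [fderiv_fun_add hf hg]; rfl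

theorem dd_sub {f g : XX m → ℝ} {y} (hf : DifferentiableAt ℝ f y) (hg : DifferentiableAt ℝ g y)
    (i : Fin m) : dd i (fun y => f y - g y) y = dd i f y - dd i g y := by
  unfold dd; rw [fderiv_fun_sub hf hg]; rfl

theorem dd_const_mul {g : XX m → ℝ} {y} (c : ℝ) (hg : DifferentiableAt ℝ g y)
    (i : Fin m) : dd i (fun y => c * g y) y = c * dd i g y := by
  unfold dd; rw [fderiv_const_mul hg]; rfl

theorem dd_mul {f g : XX m → ℝ} {y} (hf : DifferentiableAt ℝ f y) (hg : DifferentiableAt ℝ g y)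
    (i : Fin m) : dd i (fun y => f y * g y) y = f y * dd i g y + g y * dd i f y := by
  unfold dd; rw [fderiv_fun_mul hf hg]; simp

theorem dd_sum {ι : Type*} (t : Finset ι) {f : ι → XX m → ℝ} {y} 
    (hf : ∀ j ∈ t, DifferentiableAt ℝ (f j) y)
    (i : Fin m) : dd i (fun y => ∑ j ∈ t, f j y) y = ∑ j ∈ t, dd i (f j) y := by
  unfold dd; rw [fderiv_fun_sum hf]; simp

theorem lap_add {f g : XX m → ℝ} (hf : ContDiff ℝ 2 f) (hg : ContDiff ℝ 2 g) (y) :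
    lap (fun y => f y + g y) y = lap f y + lap g y := by
  rw [lap_dd (hf.add hg), lap_dd hf, lap_dd hg, ← Finset.sum_add_distrib]
  refine Finset.sum_congr rfl fun i _ => ?_
  rw [funext fun y => dd_add (C2_diff hf y) (C2_diff hg y) i, dd_add (dd_diff hf i y) (dd_diff hg i y)]

theorem lap_sub {f g : XX m → ℝ} (hf : ContDiff ℝ 2 f) (hg : ContDiff ℝ 2 g) (y) :
    lap (fun y => f y - g y) y = lap f y - lap g y := by
  rw [lap_dd (hf.sub hg), lap_dd hf, lap_dd hg, ← Finset.sum_sub_distrib]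
  refine Finset.sum_congr rfl fun i _ => ?_
  rw [funext fun y => dd_sub (C2_diff hf y) (C2_diff hg y) i, dd_sub (dd_diff hf i y) (dd_diff hg i y)]

theorem lap_const_mul {g : XX m → ℝ} (c : ℝ) (hg : ContDiff ℝ 2 g) (y) :
    lap (fun y => c * g y) y = c * lap g y := by
  rw [lap_dd (contDiff_const.mul hg), lap_dd hg, Finset.mul_sum]
  refine Finset.sum_congr rfl fun i _ => ?_
  rw [funext fun y => dd_const_mul c (C2_diff hg y) i, dd_const_mul c (dd_diff hg i y)]

theorem lap_sum {ι : Type*} (t : Finset ι) {f : ι → XX m → ℝ} (hf : ∀ j, ContDiff ℝ 2 (f j)) (y) :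
    lap (fun y => ∑ j ∈ t, f j y) y = ∑ j ∈ t, lap (f j) y := by
  rw [lap_dd (ContDiff.sum fun j _ => hf j)]
  simp only [fun j => lap_dd (hf j)]
  rw [Finset.sum_comm]
  refine Finset.sum_congr rfl fun i _ => ?_
  rw [funext fun y => dd_sum t (fun j _ => C2_diff (hf j) y) i, dd_sum t (fun j _ => dd_diff (hf j) i y)]

theorem lap_mul {f g : XX m → ℝ} (hf : ContDiff ℝ 2 f) (hg : ContDiff ℝ 2 g) (y) :
    lap (fun y => f y * g y) y = f y * lap g y + g y * lap f y + 2 * ∑ i, dd i f y * dd i g y := by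
  rw [lap_dd (hf.mul hg), lap_dd hf, lap_dd hg, Finset.mul_sum, Finset.mul_sum, Finset.mul_sum,
    ← Finset.sum_add_distrib, ← Finset.sum_add_distrib]
  refine Finset.sum_congr rfl fun i _ => ?_
  rw [funext fun y => dd_mul (C2_diff hf y) (C2_diff hg y) i,
    dd_add ((C2_diff hf y).fun_mul (dd_diff hg i y)) ((C2_diff hg y).fun_mul (dd_diff hf i y)),
    dd_mul (C2_diff hf y) (dd_diff hg i y), dd_mul (C2_diff hg y) (dd_diff hf i y)]
  ring

theorem lap_const (c : ℝ) (y : XX m) : lap (fun _ => c) y = 0 := by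
  rw [lap_dd contDiff_const]
  have : ∀ i : Fin m, dd i (fun _ : XX m => c) = fun _ => 0 := fun i => by ext; simp [dd]
  simp only [this]
  simp [dd]

theorem dd_normsq (i : Fin m) (y : XX m) : dd i (fun y => ‖y‖ ^ 2) y = 2 * y i := by
  unfold dd
  rw [((hasStrictFDerivAt_norm_sq y).hasFDerivAt).fderiv]
  simp [ee, EuclideanSpace.inner_single_right]

theorem dd_coord (i j : Fin m) (y : XX m) : dd i (fun y => y j) y = if i = j then 1 else 0 := by
  unfold dd
  have : HasFDerivAt (fun y : XX m => y j) (EuclideanSpace.proj j : XX m →L[ℝ] ℝ) y :=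
    (EuclideanSpace.proj j : XX m →L[ℝ] ℝ).hasFDerivAt
  rw [this.fderiv]
  simp [ee, Pi.single_apply, eq_comm]

theorem lap_normsq (y : XX m) : lap (fun y => ‖y‖ ^ 2) y = 2 * m := by
  rw [lap_dd (contDiff_norm_sq ℝ)]
  have hd : ∀ i : Fin m, DifferentiableAt ℝ (fun y : XX m => y i) y := fun i =>
    (EuclideanSpace.proj i : XX m →L[ℝ] ℝ).differentiableAt
  have : ∀ i : Fin m, dd i (dd i (fun y : XX m => ‖y‖ ^ 2)) y = 2 := by
    intro i
    rw [funext fun y => dd_normsq i y, dd_const_mul 2 (hd i), dd_coord]; simp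
  simp [this, mul_comm]

theorem norm_fderiv_sq (k : XX m → ℝ) (y : XX m) : ‖fderiv ℝ k y‖ ^ 2 = ∑ i, (dd i k y) ^ 2 := by
  have h1 : ‖gradient k y‖ = ‖fderiv ℝ k y‖ := by simp [gradient]
  rw [← h1, EuclideanSpace.norm_sq_eq]
  refine Finset.sum_congr rfl fun i _ => ?_
  have : (gradient k y) i = dd i k y := by
    have h := EuclideanSpace.inner_single_right (𝕜 := ℝ) i 1 (gradient k y)
    unfold gradient at h ⊢
    rw [InnerProductSpace.toDual_symm_apply] at h
    unfold dd ee
    rw [h]; simp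
  rw [this]; simp

theorem deriv2_line {g : XX m → ℝ} (hg : ContDiff ℝ 2 g) (x e : XX m) :
    (deriv fun t : ℝ => g (x + t • e)) = (fun t : ℝ => fderiv ℝ g (x + t • e) e) ∧
    deriv (deriv fun t : ℝ => g (x + t • e)) 0 = fderiv ℝ (fderiv ℝ g) x e e := by
  have hline : ∀ t : ℝ, HasDerivAt (fun t : ℝ => x + t • e) e t := fun t => by
    simpa using ((hasDerivAt_id t).smul_const e).const_add x
  have h1 : (deriv fun t : ℝ => g (x + t • e)) = (fun t : ℝ => fderiv ℝ g (x + t • e) e) := by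
    ext t
    exact ((C2_diff hg _).hasFDerivAt.comp_hasDerivAt t (hline t)).deriv
  refine ⟨h1, ?_⟩
  rw [h1]
  have hfk : ContDiff ℝ 1 (fderiv ℝ g) := hg.fderiv_right (m := 1) (by norm_num [one_add_one_eq_two])
  have h2 := (hfk.differentiable one_ne_zero (x + (0:ℝ) • e)).hasFDerivAt.comp_hasDerivAt 0 (hline 0)
  have h3 := (h2.clm_apply (hasDerivAt_const 0 e)).deriv
  simp at h3
  convert h3 using 2

theorem second_deriv_max {g : XX m → ℝ} (hg : ContDiff ℝ 2 g) {x : XX m} (hx : IsLocalMax g x)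
    (e : XX m) : fderiv ℝ (fderiv ℝ g) x e e ≤ 0 := by
  by_contra hpos
  push Not at hpos
  obtain ⟨h1, h2⟩ := deriv2_line hg x e
  have hc : Continuous fun t : ℝ => g (x + t • e) := by have := hg.continuous; fun_prop
  have hmin := isLocalMin_of_deriv_deriv_pos (f := fun t : ℝ => g (x + t • e)) (x₀ := 0)
    (by rw [h2]; exact hpos) (by rw [h1]; simp [hx.fderiv_eq_zero]) hc.continuousAt
  have hmax : IsLocalMax (fun t : ℝ => g (x + t • e)) 0 := by
    have : Tendsto (fun t : ℝ => x + t • e) (𝓝 0) (𝓝 x) := by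
      have h : Continuous fun t : ℝ => x + t • e := by fun_prop
      simpa using h.tendsto 0
    have := this.eventually hx
    simpa [IsLocalMax, IsMaxFilter] using this
  have hconst : (fun t : ℝ => g (x + t • e)) =ᶠ[𝓝 0] fun _ => g x := by
    filter_upwards [hmin, hmax] with t ht1 ht2
    simp at ht1 ht2
    exact le_antisymm ht2 ht1
  have h3 := hconst.deriv.deriv_eq
  rw [h2] at h3
  simp at h3
  linarith

theorem lap_nonpos_of_max {g : XX m → ℝ} (hg : ContDiff ℝ 2 g) {x : XX m} (hx : IsLocalMax g x) :
    lap g x ≤ 0 := by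
  rw [lap_eq]
  exact Finset.sum_nonpos fun i _ => second_deriv_max hg hx _

theorem comparison {w : XX m → ℝ} (hw : ContDiff ℝ 2 w) {W N δ κ : ℝ} (hW : ∀ x, w x ≤ W)
    (hN : 0 ≤ N) (hδ : 0 < δ) (hκ : 0 ≤ κ)
    (h : ∀ x, 0 < w x → δ * w x ≤ (1/2) * lap w x + N * ‖fderiv ℝ w x‖ + κ) (y : XX m) :
    w y ≤ κ / δ := by
  by_contra hcon
  push Not at hcon
  have hD : 0 ≤ W - w 0 := by linarith [hW 0]
  set D := W - w 0 with hDd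
  -- key estimate
  have key : ∀ η : ℝ, 0 < η → 0 < w y - η ^ 2 * ‖y‖ ^ 2 →
      δ * (w y - η ^ 2 * ‖y‖ ^ 2) ≤ m * η ^ 2 + N * (η * (1 + D)) + κ := by
    intro η hη hpos
    set G : XX m → ℝ := fun x => w x - η ^ 2 * ‖x‖ ^ 2 with hG
    have hns : ContDiff ℝ 2 (fun x : XX m => ‖x‖ ^ 2) := contDiff_norm_sq ℝ
    have hns2 : ContDiff ℝ 2 (fun x : XX m => η ^ 2 * ‖x‖ ^ 2) := contDiff_const.mul hns
    have hGC : ContDiff ℝ 2 G := hw.sub hns2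
    obtain ⟨x, hx⟩ : ∃ x, ∀ z, G z ≤ G x := by
      have hcomp : IsCompact (closedBall (0 : XX m) ((D + 1) / η)) := isCompact_closedBall _ _
      obtain ⟨x, hxm, hx⟩ := hcomp.exists_isMaxOn ⟨0, by simp; positivity⟩ hGC.continuous.continuousOn
      refine ⟨x, fun z => ?_⟩
      by_cases hz : z ∈ closedBall (0 : XX m) ((D + 1) / η)
      · exact hx hz
      · have h0 : G 0 ≤ G x := hx (by simp; positivity)
        refine le_trans ?_ h0
        simp only [hG]
        simp at hz
        rw [div_lt_iff₀ hη] at hz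
        have h1 : (D + 1) ^ 2 ≤ (‖z‖ * η) ^ 2 := pow_le_pow_left₀ (by positivity) hz.le 2
        have h2 : D ≤ (D + 1) ^ 2 := by nlinarith
        simp only [norm_zero]
        have := hW z
        nlinarith
    have hmax : IsLocalMax G x := Eventually.of_forall hx
    have hl := lap_nonpos_of_max hGC hmax
    rw [hG, lap_sub hw hns2, lap_const_mul _ hns, lap_normsq] at hl
    have hf : fderiv ℝ w x = η ^ 2 • (2 • innerSL ℝ x) := by
      have h0 := hmax.fderiv_eq_zero
      rw [hG, fderiv_fun_sub (C2_diff hw x) (C2_diff hns2 x), sub_eq_zero] at h0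
      rw [h0, fderiv_const_mul (C2_diff hns x), ((hasStrictFDerivAt_norm_sq x).hasFDerivAt).fderiv]
    have hfn : ‖fderiv ℝ w x‖ ≤ η * (1 + D) := by
      rw [hf, norm_smul, Real.norm_of_nonneg (by positivity)]
      have h2 : ‖(2:ℕ) • innerSL ℝ x‖ ≤ 2 * ‖x‖ := by
        rw [two_smul]
        refine (norm_add_le _ _).trans ?_
        rw [innerSL_apply_norm]; linarith
      have h0 := hx 0
      simp only [hG, norm_zero] at h0
      have h3 : η ^ 2 * ‖x‖ ^ 2 ≤ D := by have := hW x; linarith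
      have h4 : 2 * (η * ‖x‖) ≤ 1 + D := by nlinarith [sq_nonneg (η * ‖x‖ - 1)]
      calc η ^ 2 * ‖(2:ℕ) • innerSL ℝ x‖ ≤ η ^ 2 * (2 * ‖x‖) := by gcongr
        _ = η * (2 * (η * ‖x‖)) := by ring
        _ ≤ _ := by gcongr
    have hxy := hx y
    simp only [hG] at hxy
    have hη2 : 0 ≤ η ^ 2 * ‖x‖ ^ 2 := by positivity
    have hwx : w y - η ^ 2 * ‖y‖ ^ 2 ≤ w x := by linarith
    have hh := h x (by linarith)
    have h5 : N * ‖fderiv ℝ w x‖ ≤ N * (η * (1 + D)) := by gcongr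
    have h6 : δ * (w y - η ^ 2 * ‖y‖ ^ 2) ≤ δ * w x := by gcongr
    linarith
  have hwy : 0 < w y := lt_of_le_of_lt (by positivity) hcon
  have t1 : Tendsto (fun η : ℝ => w y - η ^ 2 * ‖y‖ ^ 2) (𝓝[>] 0) (𝓝 (w y)) := by
    have : Continuous (fun η : ℝ => w y - η ^ 2 * ‖y‖ ^ 2) := by fun_prop
    have := (this.tendsto 0).mono_left (nhdsWithin_le_nhds (s := Ioi 0))
    simpa using this
  have t2 : Tendsto (fun η : ℝ => m * η ^ 2 + N * (η * (1 + D)) + κ) (𝓝[>] 0) (𝓝 κ) := by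
    have : Continuous (fun η : ℝ => m * η ^ 2 + N * (η * (1 + D)) + κ) := by fun_prop
    have := (this.tendsto 0).mono_left (nhdsWithin_le_nhds (s := Ioi 0))
    simpa using this
  have := le_of_tendsto_of_tendsto (t1.const_mul δ) t2 (by
    filter_upwards [t1.eventually (lt_mem_nhds hwy), self_mem_nhdsWithin] with η h1 h2
    exact key η h2 h1)
  rw [div_lt_iff₀ hδ] at hcon
  linarith

end EllipticKernel6

set_option linter.unusedSectionVars false
set_option linter.unusedVariables false

section EllipticKernel7

open MeasureTheory Topology Metric Set
open scoped BoundedContinuousFunction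

variable {m : ℕ}

noncomputable def DE (r : ℝ) (k : XX m → ℝ) (x : XX m) : XX m →L[ℝ] ℝ :=
  Tint r (fun s => 2 * (1 - s ^ 2 / r ^ 2)) (fderiv ℝ kap) k x

theorem kapK : Ker (fderiv ℝ (kap : XX m → ℝ)) :=
  kap_ker.fderivK (kap_contDiff.of_le one_le_two)

theorem kapK1 : ContDiff ℝ 1 (fderiv ℝ (kap : XX m → ℝ)) :=
  kap_contDiff.fderiv_right (m := 1) (by norm_num [one_add_one_eq_two])

theorem Eop_fderiv {r : ℝ} (hr : 0 < r) {k : XX m → ℝ} (hk : Continuous k) (x : XX m) :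
    fderiv ℝ (Eop r k) x = DE r k x :=
  (Tint_hasFDerivAt_one hr (by fun_prop) kap_ker (kap_contDiff.of_le one_le_two) hk x).fderiv

theorem w_bound {r : ℝ} (hr : 0 < r) : ∀ s ∈ Icc 0 r, |2 * (1 - s ^ 2 / r ^ 2)| ≤ 2 := by
  intro s hs
  have h0 := hs.1
  have h2 : 0 ≤ 1 - s ^ 2 / r ^ 2 := by
    rw [sub_nonneg, div_le_one (by positivity)]
    exact pow_le_pow_left₀ h0 hs.2 2
  have : 0 ≤ s ^ 2 / r ^ 2 := by positivity
  rw [abs_of_nonneg (by positivity)]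
  linarith

theorem DE_bound {r : ℝ} (hr : 0 < r) {k : XX m → ℝ} {B : ℝ} {x : XX m}
    (hB : ∀ y, ‖y - x‖ ≤ r → |k y| ≤ B) :
    ‖DE r k x‖ ≤ 2 * (B * ∫ z, ‖fderiv ℝ (kap : XX m → ℝ) z‖) * r :=
  Tint_bound hr.le (w_bound hr) kapK hB

theorem DE_sub {r : ℝ} {k l : XX m → ℝ} (hk : Continuous k) (hl : Continuous l) (x : XX m) :
    DE r (fun y => k y - l y) x = DE r k x - DE r l x :=
  Tint_sub (by fun_prop) kapK hk hl x

theorem Eop_sub {r : ℝ} {k l : XX m → ℝ} (hk : Continuous k) (hl : Continuous l) (x : XX m) :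
    Eop r (fun y => k y - l y) x = Eop r k x - Eop r l x :=
  Tint_sub (by fun_prop) kap_ker hk hl x

theorem Aop_sub {r : ℝ} {k l : XX m → ℝ} (hk : Continuous k) (hl : Continuous l) (x : XX m) :
    Aop r (fun y => k y - l y) x = Aop r k x - Aop r l x :=
  Tint_sub (by fun_prop) rho_ker hk hl x

theorem Aop_const {r : ℝ} (hr : 0 < r) (c : ℝ) (x : XX m) : Aop r (fun _ => c) x = c := by
  unfold Aop Tint
  have : ∀ s, Mop rho (fun _ => c) s x = c := by
    intro s; simp [Mop, integral_const_mul, rho_integral]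
  simp only [this, smul_eq_mul]
  rw [intervalIntegral.integral_mul_const, intervalIntegral.integral_mul_const, integral_id]
  field_simp; ring

theorem AE_mono {r : ℝ} (hr : 0 < r) {l : XX m → ℝ} (hl : Continuous l) (h0 : ∀ y, 0 ≤ l y) (x) :
    8 / r ^ 2 * Eop r l x ≤ Aop r l x := by
  unfold Eop Aop Tint
  rw [← intervalIntegral.integral_const_mul]
  have c1 := Mop_cont_s kap_ker hl x
  have c2 := Mop_cont_s rho_ker hl x
  refine intervalIntegral.integral_mono_on hr.le (Continuous.intervalIntegrable (by fun_prop) _ _)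
    (Continuous.intervalIntegrable (by fun_prop) _ _) ?_
  intro s hs
  have hs0 := hs.1
  have h2 : 0 ≤ 1 - s ^ 2 / r ^ 2 := by
    rw [sub_nonneg, div_le_one (by positivity)]
    exact pow_le_pow_left₀ hs0 hs.2 2
  have h3 : 1 - s ^ 2 / r ^ 2 ≤ 1 := by
    have : 0 ≤ s ^ 2 / r ^ 2 := by positivity
    linarith
  have hM : 8 * Mop kap l s x ≤ Mop rho l s x := by
    unfold Mop
    rw [← integral_const_mul]
    refine integral_mono ((Mop_int kap_ker hl s x).const_mul 8) (Mop_int rho_ker hl s x) ?_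
    intro z
    simp only [smul_eq_mul]
    nlinarith [mul_le_mul_of_nonneg_left (kap_le_rho z) (h0 (x - s • z))]
  have hM0 : 0 ≤ Mop kap l s x := integral_nonneg fun z => mul_nonneg (h0 _) (kap_nonneg z)
  simp only [smul_eq_mul]
  have h5 : (1 - s ^ 2 / r ^ 2) * (8 * Mop kap l s x) ≤ Mop rho l s x := by
    refine le_trans ?_ hM
    exact mul_le_of_le_one_left (by positivity) h3
  have h6 : 0 ≤ 2 * s / r ^ 2 := by positivity
  have := mul_le_mul_of_nonneg_left h5 h6
  calc _ = 2 * s / r ^ 2 * ((1 - s ^ 2 / r ^ 2) * (8 * Mop kap l s x)) := by ring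
    _ ≤ _ := this
    _ = _ := by ring

theorem AE_bound {r : ℝ} (hr : 0 < r) {k : XX m → ℝ} (hk : Continuous k) {B : ℝ}
    (hB : ∀ y, |k y| ≤ B) (x) :
    |Aop r k x - 8 / r ^ 2 * Eop r k x| ≤ (1 - 4 * ∫ z : XX m, kap z) * B := by
  have e : ∀ c : ℝ, Aop r (fun _ => c) x - 8 / r ^ 2 * Eop r (fun _ => c) x =
      (1 - 4 * ∫ z : XX m, kap z) * c := by
    intro c
    rw [Aop_const hr, Eop_const hr]; field_simp; ring
  have h1 := AE_mono hr (l := fun y => B - k y) (by fun_prop)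
    (fun y => by linarith [(abs_le.1 (hB y)).2]) x
  have h2 := AE_mono hr (l := fun y => k y - (-B)) (by fun_prop)
    (fun y => by linarith [(abs_le.1 (hB y)).1]) x
  rw [Eop_sub continuous_const hk, Aop_sub continuous_const hk] at h1
  rw [Eop_sub hk continuous_const, Aop_sub hk continuous_const] at h2
  have e1 := e B
  have e2 := e (-B)
  rw [abs_le]
  constructor <;> nlinarith

noncomputable def Phi (r : ℝ) (G : (XX m →L[ℝ] ℝ) → ℝ) (h : XX m → ℝ) (x : XX m) : ℝ :=
  Aop r h x - 8 / r ^ 2 * Eop r h x - G (DE r h x)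

theorem Phi_contr (N Λ0 : ℝ) (hN : 0 ≤ N) : ∃ r q : ℝ, 0 < r ∧ Λ0 ≤ 8 / r ^ 2 ∧ 0 ≤ q ∧ q < 1 ∧
    ∀ G : (XX m →L[ℝ] ℝ) → ℝ, (∀ p p', |G p - G p'| ≤ N * ‖p - p'‖) →
    ∀ (h h' : XX m → ℝ) (d : ℝ), Continuous h → Continuous h' → (∀ y, |h y - h' y| ≤ d) →
      ∀ x, |Phi r G h x - Phi r G h' x| ≤ q * d := by
  set kb := ∫ z : XX m, kap z with hkb
  have hkb0 : 0 < kb := kap_pos_integral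
  set I1 := ∫ z, ‖fderiv ℝ (kap : XX m → ℝ) z‖ with hI1
  have hI10 : 0 ≤ I1 := integral_nonneg fun _ => norm_nonneg _
  have hkb1 : 8 * kb ≤ 1 := by
    rw [← rho_integral (E := XX m), hkb, ← integral_const_mul]
    exact integral_mono (kap_ker.int.const_mul 8) rho_ker.int (fun z => kap_le_rho z)
  set r := min (kb / (N * I1 + 1)) (1 / (|Λ0| + 1)) with hr
  have hr0 : 0 < r := lt_min (by positivity) (by positivity)
  refine ⟨r, 1 - 2 * kb, hr0, ?_, by linarith, by linarith, ?_⟩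
  · have h1 : r ≤ 1 / (|Λ0| + 1) := min_le_right _ _
    rw [le_div_iff₀ (by positivity)] at h1 ⊢
    have h2 : r ≤ 1 := by nlinarith [abs_nonneg Λ0]
    have h3 := le_abs_self Λ0
    have h4 : 0 ≤ |Λ0| := abs_nonneg _
    calc Λ0 * r ^ 2 ≤ |Λ0| * r ^ 2 := by gcongr
      _ ≤ |Λ0| * r := by
        gcongr; nlinarith
      _ ≤ 8 := by nlinarith
  · intro G hG h h' d hh hh' hd x
    have hd0 : 0 ≤ d := (abs_nonneg _).trans (hd x)
    have b1 := AE_bound hr0 (k := fun y => h y - h' y) (by fun_prop) hd x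
    have b2 := DE_bound hr0 (k := fun y => h y - h' y) (x := x) (fun y _ => hd y)
    rw [Aop_sub hh hh', Eop_sub hh hh'] at b1
    rw [DE_sub hh hh'] at b2
    have b3 := hG (DE r h x) (DE r h' x)
    have hrr : r * (N * I1 + 1) ≤ kb := by
      have : r ≤ kb / (N * I1 + 1) := min_le_left _ _
      rwa [le_div_iff₀ (by positivity)] at this
    have b4 : |G (DE r h x) - G (DE r h' x)| ≤ 2 * kb * d := by
      calc _ ≤ N * ‖DE r h x - DE r h' x‖ := b3
        _ ≤ N * (2 * (d * I1) * r) := by gcongr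
        _ = 2 * d * (r * (N * I1)) := by ring
        _ ≤ 2 * d * kb := by gcongr; linarith
        _ = _ := by ring
    have e : Phi r G h x - Phi r G h' x = (Aop r h x - Aop r h' x -
      8 / r ^ 2 * (Eop r h x - Eop r h' x)) - (G (DE r h x) - G (DE r h' x)) := by
      unfold Phi; ring
    rw [e]
    refine (abs_sub _ _).trans ?_
    linarith

theorem Phi_cont {r N : ℝ} (hr : 0 < r) {G : (XX m →L[ℝ] ℝ) → ℝ}
    (hG : Continuous G) {h : XX m → ℝ} (hh : Continuous h) : Continuous (Phi r G h) := by
  have h1 := (Aop_C1 hr hh).continuous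
  have h2 := (Eop_C1 hr hh).continuous
  have h3 : Continuous (DE r h) := Tint_continuous (by fun_prop) kapK hh
  unfold Phi
  fun_prop

theorem LH.add {k l : XX m → ℝ} (hk : LH k) (hl : LH l) : LH (fun x => k x + l x) := by
  intro ρ
  obtain ⟨C, hC0, hC⟩ := hk ρ
  obtain ⟨D, hD0, hD⟩ := hl ρ
  refine ⟨C + D, by positivity, fun x y hx hy => ?_⟩
  have h1 := hC x y hx hy
  have h2 := hD x y hx hy
  rw [show k x + l x - (k y + l y) = (k x - k y) + (l x - l y) by ring, add_mul]
  exact (abs_add_le _ _).trans (add_le_add h1 h2)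

theorem LH.const_mul {k : XX m → ℝ} (hk : LH k) (c : ℝ) : LH (fun x => c * k x) := by
  intro ρ
  obtain ⟨C, hC0, hC⟩ := hk ρ
  refine ⟨|c| * C, by positivity, fun x y hx hy => ?_⟩
  rw [← mul_sub, abs_mul, mul_assoc]
  exact mul_le_mul_of_nonneg_left (hC x y hx hy) (abs_nonneg _)

theorem LH.mul {k l : XX m → ℝ} (hk : LH k) (hl : LH l) : LH (fun x => k x * l x) := by
  intro ρ
  obtain ⟨C, hC0, hC⟩ := hk ρ
  obtain ⟨D, hD0, hD⟩ := hl ρ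
  obtain ⟨B1, hB10, hB1⟩ := bdd_on_ball hk.continuous ρ
  obtain ⟨B2, hB20, hB2⟩ := bdd_on_ball hl.continuous ρ
  refine ⟨B1 * D + B2 * C, by positivity, fun x y hx hy => ?_⟩
  have h1 := hC x y hx hy
  have h2 := hD x y hx hy
  rw [show k x * l x - (k y * l y) = k x * (l x - l y) + l y * (k x - k y) by ring, add_mul]
  refine (abs_add_le _ _).trans ?_
  rw [abs_mul, abs_mul, mul_assoc, mul_assoc]
  exact add_le_add (mul_le_mul (hB1 x hx) h2 (abs_nonneg _) hB10)
    (mul_le_mul (hB2 y hy) h1 (abs_nonneg _) hB20)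

theorem DE_holder {r : ℝ} (hr : 0 < r) : ∃ C, 0 ≤ C ∧ ∀ (k : XX m → ℝ) (ρ B : ℝ), Continuous k →
    0 ≤ B → (∀ y, ‖y‖ ≤ ρ + r → |k y| ≤ B) →
      ∀ x y, ‖x‖ ≤ ρ → ‖y‖ ≤ ρ → ‖DE r k x - DE r k y‖ ≤ C * B * √‖x - y‖ :=
  Tint_holder hr (by fun_prop) kapK kapK1

theorem Phi_LH {r N : ℝ} (hr : 0 < r) {G : (XX m →L[ℝ] ℝ) → ℝ}
    (hN : 0 ≤ N) (hG : ∀ p p', |G p - G p'| ≤ N * ‖p - p'‖)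
    {h : XX m → ℝ} (hh : Continuous h) : LH (Phi r G h) := by
  have h1 := LH_of_C1 (Aop_C1 hr hh)
  have h2 := LH_of_C1 (Eop_C1 hr hh)
  have h3 : LH (fun x => G (DE r h x)) := by
    intro ρ
    obtain ⟨C, hC0, hC⟩ := DE_holder (m := m) hr
    obtain ⟨B, hB0, hB⟩ := bdd_on_ball hh (ρ + r)
    refine ⟨N * (C * B), by positivity, fun x y hx hy => ?_⟩
    refine (hG _ _).trans ?_
    rw [mul_assoc]
    gcongr
    exact hC h ρ B hh hB0 hB x y hx hy
  have := (h1.add (h2.const_mul (-(8 / r ^ 2)))).add (h3.const_mul (-1))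
  convert this using 2
  unfold Phi; ring

theorem fix_exists {r q N : ℝ} (hr : 0 < r) (hq0 : 0 ≤ q) (hq1 : q < 1)
    {G : (XX m →L[ℝ] ℝ) → ℝ} (hGc : Continuous G)
    (hP : ∀ (h h' : XX m → ℝ) (d : ℝ), Continuous h → Continuous h' → (∀ y, |h y - h' y| ≤ d) →
      ∀ x, |Phi r G h x - Phi r G h' x| ≤ q * d) (g : XX m →ᵇ ℝ) :
    ∃ h : XX m →ᵇ ℝ, ∀ x, h x = Phi r G h x + g x := by
  have hdist : ∀ (h h' : XX m →ᵇ ℝ) y, |h y - h' y| ≤ dist h h' := fun h h' y => by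
    rw [← Real.dist_eq]; exact BoundedContinuousFunction.dist_coe_le_dist y
  have hbd : ∀ h : XX m →ᵇ ℝ, ∃ C, ∀ x, ‖Phi r G h x + g x‖ ≤ C := by
    intro h
    have h0 : ∃ B, ∀ x, |Phi r G (fun _ => 0) x| ≤ B := by
      refine ⟨|G 0|, fun x => ?_⟩
      have : DE r (fun _ : XX m => (0:ℝ)) x = 0 := by simp [DE, Tint, Mop]
      have h1 : Eop r (fun _ : XX m => (0:ℝ)) x = 0 := by simp [Eop, Tint, Mop]
      have h2 : Aop r (fun _ : XX m => (0:ℝ)) x = 0 := by simp [Aop, Tint, Mop]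
      unfold Phi
      rw [this, h1, h2]; simp
    obtain ⟨B, hB⟩ := h0
    refine ⟨B + q * ‖h‖ + ‖g‖, fun x => ?_⟩
    have := hP h (fun _ => 0) ‖h‖ h.continuous continuous_const (fun y => by
      simpa using h.norm_coe_le_norm y) x
    have h3 := g.norm_coe_le_norm x
    rw [Real.norm_eq_abs] at h3 ⊢
    calc |Phi r G h x + g x| = |(Phi r G h x - Phi r G (fun _ => 0) x) + Phi r G (fun _ => 0) x + g x| := by
          congr 1; ring
      _ ≤ _ := (abs_add_three _ _ _).trans (by linarith [hB x])
  choose C hC using hbd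
  set T : (XX m →ᵇ ℝ) → (XX m →ᵇ ℝ) := fun h => BoundedContinuousFunction.ofNormedAddCommGroup
    (fun x => Phi r G h x + g x) ((Phi_cont (N := N) hr hGc h.continuous).add g.continuous) (C h) (hC h) with hT
  have hc : ContractingWith ⟨q, hq0⟩ T := by
    refine ⟨by exact_mod_cast hq1, LipschitzWith.of_dist_le_mul fun h h' => ?_⟩
    refine (BoundedContinuousFunction.dist_le (by positivity)).2 fun x => ?_
    rw [Real.dist_eq]
    simp only [hT, BoundedContinuousFunction.coe_ofNormedAddCommGroup]
    rw [add_sub_add_right_eq_sub]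
    exact hP h h' _ h.continuous h'.continuous (hdist h h') x
  refine ⟨ContractingWith.fixedPoint T hc, fun x => ?_⟩
  have := hc.fixedPoint_isFixedPt
  conv_lhs => rw [← this]
  rfl

end EllipticKernel7

set_option linter.unusedSectionVars false
set_option linter.unusedVariables false

section EllipticKernel8

open MeasureTheory Topology Metric Set
open scoped BoundedContinuousFunction

variable {m : ℕ}

theorem Eop_bound {r : ℝ} (hr : 0 < r) {k : XX m → ℝ} {B : ℝ} {x : XX m}
    (hB : ∀ y, ‖y - x‖ ≤ r → |k y| ≤ B) :
    |Eop r k x| ≤ (2 * r * (∫ z : XX m, ‖kap z‖) * r) * B := by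
  have := Tint_bound hr.le (w := fun s => s * (2 * (1 - s ^ 2 / r ^ 2))) (W := r * 2) (fun s hs => by
    rw [abs_mul, abs_of_nonneg hs.1]
    exact mul_le_mul hs.2 (w_bound hr s hs) (abs_nonneg _) hr.le) kap_ker hB
  refine this.trans (le_of_eq ?_)
  ring

theorem lip_cont {N : ℝ} {V : Type*} [NormedAddCommGroup V] {G : V → ℝ}
    (hG : ∀ p p', |G p - G p'| ≤ N * ‖p - p'‖) : Continuous G := by
  have : LipschitzWith (Real.toNNReal N) G := LipschitzWith.of_dist_le_mul fun p p' => by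
    rw [Real.dist_eq, dist_eq_norm]
    refine (hG p p').trans ?_
    gcongr
    exact Real.le_coe_toNNReal N
  exact this.continuous

theorem exists_sol {N δ cb Bg : ℝ} (hN : 0 ≤ N) (hδ : 0 < δ) {G : (XX m →L[ℝ] ℝ) → ℝ}
    (hG : ∀ p p', |G p - G p'| ≤ N * ‖p - p'‖) {c g : XX m → ℝ} (hc : LH c) (hg : LH g)
    (hc1 : ∀ x, δ ≤ c x) (hc2 : ∀ x, c x ≤ cb) (hgB : ∀ x, |g x| ≤ Bg) :
    ∃ u : XX m → ℝ, ContDiff ℝ 2 u ∧ (∃ B, ∀ x, |u x| ≤ B) ∧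
      ∀ x, c x * u x - (1/2) * lap u x + G (fderiv ℝ u x) = g x := by
  obtain ⟨r, q, hr, hΛc, hq0, hq1, hP0⟩ := Phi_contr (m := m) N cb hN
  have hP := hP0 G hG
  have hGc := lip_cont hG
  set Λ := 8 / r ^ 2 with hΛ
  have hΛ0 : 0 < Λ := by positivity
  have hdist : ∀ (h h' : XX m →ᵇ ℝ) y, |h y - h' y| ≤ dist h h' := fun h h' y => by
    rw [← Real.dist_eq]; exact BoundedContinuousFunction.dist_coe_le_dist y
  have hcc := hc.continuous
  have hgc := hg.continuous
  have hΛ1 : ∀ x, 0 ≤ Λ - c x := fun x => by linarith [hc2 x]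
  have hΛ2 : ∀ x, Λ - c x ≤ Λ - δ := fun x => by linarith [hc1 x]
  have hΛδ : 0 ≤ Λ - δ := (hΛ1 0).trans (hΛ2 0)
  have hfix : ∀ U : XX m →ᵇ ℝ, ∃ h : XX m →ᵇ ℝ, ∀ x, h x = Phi r G h x + (g x + (Λ - c x) * U x) := by
    intro U
    obtain ⟨h, hh⟩ := fix_exists (N := N) hr hq0 hq1 hGc hP
      (BoundedContinuousFunction.ofNormedAddCommGroup (fun x => g x + (Λ - c x) * U x)
        (by fun_prop) (Bg + (Λ - δ) * ‖U‖) (fun x => by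
          refine (norm_add_le _ _).trans (add_le_add (hgB x) ?_)
          rw [norm_mul, Real.norm_of_nonneg (hΛ1 x)]
          exact mul_le_mul (hΛ2 x) (U.norm_coe_le_norm x) (norm_nonneg _) hΛδ))
    exact ⟨h, hh⟩
  choose F hF using hfix
  set K := 2 * r * (∫ z : XX m, ‖kap z‖) * r with hK
  have hI : 0 ≤ ∫ z : XX m, ‖kap z‖ := integral_nonneg fun _ => norm_nonneg _
  have hK0 : 0 ≤ K := by positivity
  set S : (XX m →ᵇ ℝ) → (XX m →ᵇ ℝ) := fun U => BoundedContinuousFunction.ofNormedAddCommGroup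
    (Eop r (F U)) (Eop_C1 hr (F U).continuous).continuous (K * ‖F U‖)
      (fun x => Eop_bound hr (fun y _ => (F U).norm_coe_le_norm y)) with hS
  have hSe : ∀ U x, S U x = Eop r (F U) x := fun U x => rfl
  have hSe' : ∀ U, (S U : XX m → ℝ) = Eop r (F U) := fun U => rfl
  -- stability
  have hstabF : ∀ U U', dist (F U) (F U') ≤ Λ / (1 - q) * dist U U' := by
    intro U U'
    have : dist (F U) (F U') ≤ q * dist (F U) (F U') + Λ * dist U U' := by
      refine (BoundedContinuousFunction.dist_le (by positivity)).2 fun x => ?_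
      rw [Real.dist_eq, hF U x, hF U' x]
      have h1 := hP (F U) (F U') _ (F U).continuous (F U').continuous (hdist _ _) x
      have h2 : |(Λ - c x) * (U x - U' x)| ≤ Λ * dist U U' := by
        rw [abs_mul, abs_of_nonneg (hΛ1 x)]
        exact mul_le_mul (by linarith [hΛ2 x]) (hdist U U' x) (abs_nonneg _) hΛ0.le
      calc _ = |(Phi r G (F U) x - Phi r G (F U') x) + (Λ - c x) * (U x - U' x)| := by
            congr 1; ring
        _ ≤ _ := (abs_add_le _ _).trans (add_le_add h1 h2)
    rw [div_mul_eq_mul_div, le_div_iff₀ (by linarith)]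
    linarith
  have hSlip : ∀ U U', dist (S U) (S U') ≤ K * (Λ / (1 - q)) * dist U U' := by
    intro U U'
    have h1q : 0 < 1 - q := by linarith
    refine (BoundedContinuousFunction.dist_le (by positivity)).2 fun x => ?_
    rw [Real.dist_eq, hSe, hSe, ← Eop_sub (F U).continuous (F U').continuous, mul_assoc]
    refine (Eop_bound hr (fun y _ => hdist (F U) (F U') y)).trans ?_
    gcongr
    exact hstabF U U'
  have hScont : Continuous S := by
    have : LipschitzWith (Real.toNNReal (K * (Λ / (1 - q)))) S :=
      LipschitzWith.of_dist_le_mul fun p p' => by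
        refine (hSlip p p').trans ?_
        gcongr
        exact Real.le_coe_toNNReal _
    exact this.continuous
  -- regularity
  have hreg : ∀ U : XX m →ᵇ ℝ, LH U → ContDiff ℝ 2 (S U) ∧
      ∀ x, Λ * S U x - (1/2) * lap (S U) x + G (fderiv ℝ (S U) x) = g x + (Λ - c x) * U x := by
    intro U hU
    have hL : LH (F U) := by
      have h1 := Phi_LH (N := N) hr hN hG (F U).continuous
      have h2 : LH (fun x => (Λ + (-1) * c x)) := by
        have : LH (fun _ : XX m => Λ) := LH_of_C1 contDiff_const
        exact this.add (hc.const_mul (-1))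
      have h3 := h1.add (hg.add (h2.mul hU))
      have : (F U : XX m → ℝ) = _ := funext (hF U)
      rw [this]
      convert h3 using 4
      ring
    refine ⟨Eop_C2 hr hL, fun x => ?_⟩
    rw [hSe', lap_Eop hr hL, Eop_fderiv hr (F U).continuous]
    have := hF U x
    unfold Phi at this
    linarith
  have hcontr : ∀ U U' : XX m →ᵇ ℝ, LH U → LH U' → ∀ x,
      S U x - S U' x ≤ (Λ - δ) * dist U U' / Λ := by
    intro U U' hU hU' x
    obtain ⟨a1, a2⟩ := hreg U hU
    obtain ⟨b1, b2⟩ := hreg U' hU'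
    refine comparison (a1.sub b1) (W := dist (S U) (S U')) (N := N)
      (fun x => (le_abs_self _).trans (hdist _ _ x)) hN hΛ0 (by positivity) ?_ x
    intro x _
    have e1 : lap (fun x => S U x - S U' x) x = lap (S U) x - lap (S U') x := lap_sub a1 b1 x
    have e2 : fderiv ℝ (fun x => S U x - S U' x) x = fderiv ℝ (S U) x - fderiv ℝ (S U') x :=
      fderiv_fun_sub (C2_diff a1 x) (C2_diff b1 x)
    have e1' : lap ((S U : XX m → ℝ) - (S U' : XX m → ℝ)) x = lap (S U) x - lap (S U') x := e1
    have e2' : fderiv ℝ ((S U : XX m → ℝ) - (S U' : XX m → ℝ)) x =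
      fderiv ℝ (S U) x - fderiv ℝ (S U') x := e2
    simp only [e1, e2]
    have h1 := a2 x
    have h2 := b2 x
    have h3 := (abs_le.1 (hG (fderiv ℝ (S U) x) (fderiv ℝ (S U') x))).1
    have h4 : (Λ - c x) * (U x - U' x) ≤ (Λ - δ) * dist U U' :=
      (mul_le_mul_of_nonneg_left ((le_abs_self _).trans (hdist U U' x)) (hΛ1 x)).trans
        (mul_le_mul_of_nonneg_right (hΛ2 x) dist_nonneg)
    linarith
  have hcontr' : ∀ U U' : XX m →ᵇ ℝ, LH U → LH U' →
      dist (S U) (S U') ≤ (1 - δ / Λ) * dist U U' := by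
    intro U U' hU hU'
    have e : (1 - δ / Λ) * dist U U' = (Λ - δ) * dist U U' / Λ := by field_simp
    rw [e]
    refine (BoundedContinuousFunction.dist_le (by positivity)).2 fun x => ?_
    rw [Real.dist_eq, abs_sub_le_iff]
    refine ⟨hcontr U U' hU hU' x, ?_⟩
    rw [dist_comm]
    exact hcontr U' U hU' hU x
  set V : ℕ → (XX m →ᵇ ℝ) := fun n => S^[n] 0 with hV
  have hVs : ∀ n, V (n + 1) = S (V n) := fun n => Function.iterate_succ_apply' S n 0
  have hVL : ∀ n, LH (V n) := by
    intro n
    cases n with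
    | zero =>
      have : LH (fun _ : XX m => (0:ℝ)) := LH_of_C1 contDiff_const
      exact this
    | succ n => rw [hVs]; exact LH_of_C1 (Eop_C1 hr (F (V n)).continuous)
  have hgeo : ∀ n, dist (V n) (V (n + 1)) ≤ dist (V 0) (V 1) * (1 - δ / Λ) ^ n := by
    intro n
    induction n with
    | zero => simp
    | succ n ih =>
      rw [hVs n, hVs (n+1)]
      refine (hcontr' _ _ (hVL n) (hVL (n+1))).trans ?_
      have : 0 ≤ 1 - δ / Λ := by rw [sub_nonneg, div_le_one hΛ0]; linarith
      calc _ ≤ (1 - δ / Λ) * (dist (V 0) (V 1) * (1 - δ / Λ) ^ n) := by gcongr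
        _ = _ := by ring
  have hlt : 1 - δ / Λ < 1 := by
    have : 0 < δ / Λ := by positivity
    linarith
  have hcauchy := cauchySeq_of_le_geometric (1 - δ / Λ) (dist (V 0) (V 1)) hlt hgeo
  obtain ⟨U, hU⟩ := cauchySeq_tendsto_of_complete hcauchy
  have hfixU : S U = U := by
    have t1 : Tendsto (fun n => V (n + 1)) atTop (𝓝 U) := hU.comp (tendsto_add_atTop_nat 1)
    have t2 : Tendsto (fun n => S (V n)) atTop (𝓝 (S U)) := (hScont.tendsto U).comp hU
    simp only [hVs] at t1
    exact tendsto_nhds_unique t2 t1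
  have hUL : LH U := by rw [← hfixU]; exact LH_of_C1 (Eop_C1 hr (F U).continuous)
  obtain ⟨d1, d2⟩ := hreg U hUL
  rw [hfixU] at d1 d2
  refine ⟨U, d1, ⟨‖U‖, fun x => U.norm_coe_le_norm x⟩, fun x => ?_⟩
  linarith [d2 x]

end EllipticKernel8

set_option linter.unusedSectionVars false
set_option linter.unusedVariables false

section EllipticKernel9

open MeasureTheory Topology Metric Set
open scoped BoundedContinuousFunction

variable {m : ℕ}

noncomputable def Gtr (θ M : ℝ) (p : XX m →L[ℝ] ℝ) : ℝ := (1/θ) * (min ‖p‖ M) ^ θ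

theorem Gtr_lip {θ M : ℝ} (hθ : 1 < θ) (hM : 0 ≤ M) (p p' : XX m →L[ℝ] ℝ) :
    |Gtr θ M p - Gtr θ M p'| ≤ M ^ (θ - 1) * ‖p - p'‖ := by
  have h1 : ∀ t ∈ Icc 0 M, HasDerivWithinAt (fun t : ℝ => (1/θ) * t ^ θ) (t ^ (θ - 1)) (Icc 0 M) t := by
    intro t ht
    have := (Real.hasDerivAt_rpow_const (x := t) (p := θ) (Or.inr hθ.le)).const_mul (1/θ)
    refine (this.congr_deriv ?_).hasDerivWithinAt
    field_simp
  have h2 := (convex_Icc 0 M).norm_image_sub_le_of_norm_hasDerivWithin_le (C := M ^ (θ - 1)) h1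
    (fun t ht => by
      rw [Real.norm_of_nonneg (Real.rpow_nonneg ht.1 _)]
      exact Real.rpow_le_rpow ht.1 ht.2 (by linarith))
    (x := min ‖p'‖ M) (y := min ‖p‖ M) ⟨le_min (norm_nonneg _) hM, min_le_right _ _⟩
    ⟨le_min (norm_nonneg _) hM, min_le_right _ _⟩
  refine h2.trans ?_
  gcongr
  rw [Real.norm_eq_abs]
  refine (abs_min_sub_min_le_max _ _ _ _).trans ?_
  simp only [sub_self, abs_zero]
  rw [max_eq_left (abs_nonneg _)]
  exact abs_norm_sub_norm_le p p'

theorem Gtr_nonneg {θ M : ℝ} (hθ : 1 < θ) (hM : 0 ≤ M) (p : XX m →L[ℝ] ℝ) : 0 ≤ Gtr θ M p :=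
  mul_nonneg (by positivity) (Real.rpow_nonneg (le_min (norm_nonneg _) hM) _)

theorem Gtr_le {θ M : ℝ} (hθ : 1 < θ) (hM : 0 ≤ M) (p : XX m →L[ℝ] ℝ) :
    Gtr θ M p ≤ (1/θ) * ‖p‖ ^ θ := by
  unfold Gtr
  exact mul_le_mul_of_nonneg_left (Real.rpow_le_rpow (le_min (norm_nonneg _) hM)
    (min_le_left _ _) (by linarith)) (by positivity)

theorem Gtr_eq {θ M : ℝ} {p : XX m →L[ℝ] ℝ} (h : ‖p‖ ≤ M) : Gtr θ M p = (1/θ) * ‖p‖ ^ θ := by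
  unfold Gtr; rw [min_eq_left h]

theorem comparison2 {N δ B : ℝ} (hN : 0 ≤ N) (hδ : 0 < δ) {G : (XX m →L[ℝ] ℝ) → ℝ}
    (hG : ∀ p p', |G p - G p'| ≤ N * ‖p - p'‖) {c u v : XX m → ℝ}
    (hu : ContDiff ℝ 2 u) (hv : ContDiff ℝ 2 v) (hB : ∀ x, v x - u x ≤ B) (hc : ∀ x, δ ≤ c x)
    {κ : ℝ} (hκ : 0 ≤ κ)
    (h : ∀ x, c x * v x - (1/2) * lap v x + G (fderiv ℝ v x) ≤
      c x * u x - (1/2) * lap u x + G (fderiv ℝ u x) + κ) (x) : v x - u x ≤ κ / δ := by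
  refine comparison (hv.sub hu) (N := N) hB hN hδ hκ ?_ x
  intro x hx
  have e1 : lap (fun x => v x - u x) x = lap v x - lap u x := lap_sub hv hu x
  have e2 : fderiv ℝ (fun x => v x - u x) x = fderiv ℝ v x - fderiv ℝ u x :=
    fderiv_fun_sub (C2_diff hv x) (C2_diff hu x)
  simp only [e1, e2]
  have h1 := h x
  have h3 := (abs_le.1 (hG (fderiv ℝ v x) (fderiv ℝ u x))).1
  have h4 : δ * (v x - u x) ≤ c x * (v x - u x) := mul_le_mul_of_nonneg_right (hc x) hx.le
  linarith

theorem lap_translate {u : XX m → ℝ} (hu : ContDiff ℝ 2 u) (z x : XX m) :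
    ContDiff ℝ 2 (fun y => u (y + z)) ∧ lap (fun y => u (y + z)) x = lap u (x + z) ∧
      fderiv ℝ (fun y => u (y + z)) x = fderiv ℝ u (x + z) := by
  have h1 : ContDiff ℝ 2 (fun y => u (y + z)) := hu.comp (contDiff_id.add contDiff_const)
  have e : ∀ (i : Fin m) (k : XX m → ℝ) , dd i (fun y => k (y + z)) = fun y => dd i k (y + z) := by
    intro i k; ext y; unfold dd; rw [fderiv_comp_add_right]
  refine ⟨h1, ?_, by rw [fderiv_comp_add_right]⟩
  rw [lap_dd h1, lap_dd hu]
  refine Finset.sum_congr rfl fun i _ => ?_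
  rw [e, e]

theorem grad_bound {N δ Lc Lg Bu : ℝ} (hN : 0 ≤ N) (hδ : 0 < δ) (hLc : 0 ≤ Lc) (hLg : 0 ≤ Lg)
    {G : (XX m →L[ℝ] ℝ) → ℝ}
    (hG : ∀ p p', |G p - G p'| ≤ N * ‖p - p'‖) {c g u : XX m → ℝ}
    (hu : ContDiff ℝ 2 u) (hB : ∀ x, |u x| ≤ Bu) (hc : ∀ x, δ ≤ c x)
    (hcL : ∀ x y, |c x - c y| ≤ Lc * ‖x - y‖) (hgL : ∀ x y, |g x - g y| ≤ Lg * ‖x - y‖)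
    (h : ∀ x, c x * u x - (1/2) * lap u x + G (fderiv ℝ u x) = g x) (x) :
    ‖fderiv ℝ u x‖ ≤ (Lg + Lc * Bu) / δ := by
  have hBu : 0 ≤ Bu := (abs_nonneg _).trans (hB 0)
  have key : ∀ x z, u (x + z) - u x ≤ (Lg + Lc * Bu) / δ * ‖z‖ := by
    intro x z
    have e := fun x => lap_translate hu z x
    have := comparison2 hN hδ hG hu (e 0).1 (B := 2 * Bu) (c := fun x => c x)
      (κ := (Lg + Lc * Bu) * ‖z‖) (fun x => by
        have h1 := (abs_le.1 (hB (x + z))).2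
        have h2 := (abs_le.1 (hB x)).1
        linarith) hc (by positivity) ?_ x
    · rw [div_mul_eq_mul_div]; exact this
    · intro x
      rw [(e x).2.1, (e x).2.2]
      have h1 := h (x + z)
      have h2 := h x
      have h3 : g (x + z) - g x ≤ Lg * ‖z‖ := by
        have := (abs_le.1 (hgL (x + z) x)).2; simpa using this
      have h4 : (c x - c (x + z)) * u (x + z) ≤ Lc * Bu * ‖z‖ := by
        refine (le_abs_self _).trans ?_
        rw [abs_mul]
        have h5 := hcL x (x + z)
        simp at h5
        calc _ ≤ (Lc * ‖z‖) * Bu := mul_le_mul h5 (hB _) (abs_nonneg _) (by positivity)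
          _ = _ := by ring
      nlinarith
  set L := (Lg + Lc * Bu) / δ with hL
  have hL0 : 0 ≤ L := by positivity
  have hlip : LipschitzWith (Real.toNNReal L) u := LipschitzWith.of_dist_le_mul fun a b => by
    rw [Real.coe_toNNReal _ hL0, Real.dist_eq, dist_eq_norm, abs_sub_le_iff]
    have h1 := key b (a - b)
    have h2 := key a (b - a)
    simp at h1 h2
    exact ⟨by linarith, by rw [norm_sub_rev]; linarith⟩
  have := norm_fderiv_le_of_lipschitz ℝ hlip (x₀ := x)
  rwa [Real.coe_toNNReal _ hL0] at this

theorem LH_of_lip {k : XX m → ℝ} {L : ℝ} (hL : 0 ≤ L) (h : ∀ x y, |k x - k y| ≤ L * ‖x - y‖) : LH k := by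
  intro ρ
  refine ⟨L * √(2 * ρ), by positivity, fun x y hx hy => (h x y).trans ?_⟩
  rw [mul_assoc]
  gcongr
  have h3 : ‖x - y‖ ≤ 2 * ρ := (norm_sub_le _ _).trans (by linarith)
  rw [← Real.sqrt_mul ((norm_nonneg _).trans h3)]
  apply Real.le_sqrt_of_sq_le
  nlinarith [norm_nonneg (x - y)]

theorem lip_extend {F : XX m → ℝ} (hF : LocallyLipschitz F) (R : ℝ) :
    ∃ (g : XX m → ℝ) (L B : ℝ), 0 ≤ L ∧ 0 ≤ B ∧ (∀ x y, |g x - g y| ≤ L * ‖x - y‖) ∧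
      (∀ x, |g x| ≤ B) ∧ ∀ x, ‖x‖ ≤ R → g x = F x := by
  obtain ⟨K, hK⟩ := LocallyLipschitzOn.exists_lipschitzOnWith_of_compact
    (isCompact_closedBall (0 : XX m) R) (hF.locallyLipschitzOn)
  obtain ⟨g, hg, hgF⟩ := hK.extend_real
  obtain ⟨B, hB0, hB⟩ := bdd_on_ball hF.continuous R
  refine ⟨fun x => max (-B) (min B (g x)), K, B, K.2, hB0, ?_, ?_, ?_⟩
  · intro x y
    have h1 := hg.dist_le_mul x y
    rw [Real.dist_eq, dist_eq_norm] at h1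
    refine le_trans ?_ h1
    refine (abs_max_sub_max_le_max _ _ _ _).trans ?_
    refine max_le (by simp) ?_
    refine (abs_min_sub_min_le_max _ _ _ _).trans ?_
    exact max_le (by simp) le_rfl
  · intro x
    rw [abs_le]
    exact ⟨le_max_left _ _, max_le (by linarith) (min_le_left _ _)⟩
  · intro x hx
    have h1 : F x = g x := hgF (by simpa using hx)
    have h2 := abs_le.1 (hB x hx)
    simp only [← h1]
    rw [min_eq_right h2.2, max_eq_right h2.1]

theorem cpt_bdd {φ : XX m → ℝ} (h : ContDiff ℝ 2 φ) (hs : HasCompactSupport φ) :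
    ∃ B, 0 ≤ B ∧ ∀ x, |φ x| ≤ B ∧ |lap φ x| ≤ B ∧ ‖fderiv ℝ φ x‖ ≤ B := by
  obtain ⟨B1, hB1⟩ := h.continuous.bounded_above_of_compact_support hs
  obtain ⟨B2, hB2⟩ := (h.continuous_fderiv two_ne_zero).bounded_above_of_compact_support (hs.fderiv ℝ)
  have hl : HasCompactSupport (lap φ) := by
    refine ((hs.fderiv ℝ).fderiv ℝ).mono ?_
    intro x hx hne
    apply hx
    rw [lap_eq, hne]; simp
  obtain ⟨B3, hB3⟩ := (lap_continuous h).bounded_above_of_compact_support hl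
  refine ⟨max 0 (max B1 (max B2 B3)), le_max_left _ _, fun x => ⟨(hB1 x).trans ?_, (hB3 x).trans ?_, (hB2 x).trans ?_⟩⟩
  all_goals simp

end EllipticKernel9

set_option linter.unusedSectionVars false
set_option linter.unusedVariables false

section EllipticKernel10

open MeasureTheory Topology Metric Set
open scoped BoundedContinuousFunction

variable {m : ℕ}

theorem lap_congr {u v : XX m → ℝ} {x : XX m} (h : u =ᶠ[𝓝 x] v) : lap u x = lap v x := by
  rw [lap_eq, lap_eq, h.fderiv.fderiv_eq]

theorem stepA (hm : 1 ≤ m) {θ lam : ℝ} (hθ : 1 < θ) {f : XX m → ℝ} (hf : LocallyLipschitz f)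
    {ψ : XX m → ℝ} (hψ : ContDiff ℝ 2 ψ)
    (hsub : ∀ y, -(1/2) * lap ψ y + (1/θ) * ‖fderiv ℝ ψ y‖ ^ θ ≤ f y - lam)
    {R : ℝ} (hR : 1 ≤ R) :
    ∃ (u : XX m → ℝ) (δ : ℝ), ContDiff ℝ 2 u ∧ 0 < δ ∧ δ ≤ 1 ∧ (∀ y, |δ * u y| ≤ 1 / R) ∧
      ∀ y, ‖y‖ ≤ R → -(1/2) * lap u y + (1/θ) * ‖fderiv ℝ u y‖ ^ θ = f y - lam - δ * u y := by
  obtain ⟨P0, hP00, hP0⟩ := bdd_on_ball hψ.continuous (R + 3)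
  let ζ : ContDiffBump (0 : XX m) := ⟨R + 2, R + 3, by linarith, by linarith⟩
  have hζ : ContDiff ℝ 2 ζ := ζ.contDiff
  have hζ1 : ∀ y : XX m, ‖y‖ ≤ R + 1 → (ζ : XX m → ℝ) =ᶠ[𝓝 y] 1 := by
    intro y hy
    refine ζ.eventuallyEq_one_of_mem_ball ?_
    rw [mem_ball_zero_iff]
    show ‖y‖ < R + 2
    linarith
  -- the truncated subsolution
  let ψt : XX m → ℝ := fun y => ζ y * (ψ y - P0)
  have hψt : ContDiff ℝ 2 ψt := hζ.mul (hψ.sub contDiff_const)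
  have hψs : HasCompactSupport ψt := ζ.hasCompactSupport.mul_right
  have hψ0 : ∀ y, ψt y ≤ 0 := by
    intro y
    by_cases hy : ‖y‖ ≤ R + 3
    · have := (abs_le.1 (hP0 y hy)).2
      exact mul_nonpos_of_nonneg_of_nonpos ζ.nonneg (by linarith)
    · have : ζ y = 0 := ζ.zero_of_le_dist (by
        rw [dist_zero_right]; show R + 3 ≤ ‖y‖; linarith)
      show ζ y * (ψ y - P0) ≤ 0
      rw [this]; simp
  have hψe : ∀ y : XX m, ‖y‖ ≤ R + 1 → ψt =ᶠ[𝓝 y] fun y => ψ y - P0 := by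
    intro y hy
    filter_upwards [hζ1 y hy] with z hz
    show ζ z * (ψ z - P0) = _
    rw [hz]; simp
  obtain ⟨Bψ, hBψ0, hBψ⟩ := cpt_bdd hψt hψs
  let w : XX m → ℝ := fun y => ζ y * ‖y‖ ^ 2
  have hw : ContDiff ℝ 2 w := hζ.mul (contDiff_norm_sq ℝ)
  have hws : HasCompactSupport w := ζ.hasCompactSupport.mul_right
  have hw0 : ∀ y, 0 ≤ w y := fun y => mul_nonneg ζ.nonneg (by positivity)
  have hwe : ∀ y : XX m, ‖y‖ ≤ R + 1 → w =ᶠ[𝓝 y] fun y => ‖y‖ ^ 2 := by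
    intro y hy
    filter_upwards [hζ1 y hy] with z hz
    show ζ z * _ = _
    rw [hz]; simp
  obtain ⟨Bw, hBw0, hBw⟩ := cpt_bdd hw hws
  have hF : LocallyLipschitz fun y => f y - lam := by
    simpa using hf.sub (LocallyLipschitz.const lam)
  obtain ⟨g0, L0, B0, hL0, hB0, hg0L, hg0B, hg0⟩ := lip_extend hF (R + 1)
  let ξ : XX m → ℝ := fun y => min 1 (max 0 (‖y‖ - R))
  have hξL : ∀ x y, |ξ x - ξ y| ≤ 1 * ‖x - y‖ := by
    intro x y
    refine (abs_min_sub_min_le_max _ _ _ _).trans ?_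
    refine max_le (by simp) ?_
    refine (abs_max_sub_max_le_max _ _ _ _).trans ?_
    refine max_le (by simp) ?_
    have := abs_norm_sub_norm_le x y
    simpa using this
  have hξ0 : ∀ x, 0 ≤ ξ x := fun x => le_min zero_le_one (le_max_left _ _)
  have hξ1 : ∀ x, ξ x ≤ 1 := fun x => min_le_left _ _
  have hξin : ∀ x, ‖x‖ ≤ R → ξ x = 0 := by
    intro x hx
    show min 1 (max 0 (‖x‖ - R)) = 0
    rw [max_eq_left (by linarith)]; simp
  have hξout : ∀ x, R + 1 < ‖x‖ → ξ x = 1 := by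
    intro x hx
    show min 1 (max 0 (‖x‖ - R)) = 1
    rw [max_eq_right (by linarith), min_eq_left (by linarith)]
  set C0 := (1/2) * Bψ + (1/θ) * Bψ ^ θ with hC0
  have hC00 : 0 ≤ C0 := by positivity
  set A := C0 + B0 with hA
  have hA0 : 0 ≤ A := by positivity
  let g : XX m → ℝ := fun x => g0 x + A * ξ x
  have hgL : ∀ x y, |g x - g y| ≤ (L0 + A) * ‖x - y‖ := by
    intro x y
    have h1 := hg0L x y
    have h2 := hξL x y
    have : g x - g y = (g0 x - g0 y) + A * (ξ x - ξ y) := by simp only [g]; ring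
    rw [this]
    refine (abs_add_le _ _).trans ?_
    rw [abs_mul, abs_of_nonneg hA0]
    have := mul_le_mul_of_nonneg_left h2 hA0
    linarith
  have hgB : ∀ x, |g x| ≤ B0 + A := by
    intro x
    refine (abs_add_le _ _).trans (add_le_add (hg0B x) ?_)
    rw [abs_mul, abs_of_nonneg hA0, abs_of_nonneg (hξ0 x)]
    exact mul_le_of_le_one_right hA0 (hξ1 x)
  set b := B0 + A with hb
  have hb0 : 0 ≤ b := by positivity
  set A' := b + 2 * b * Bw with hA'
  set Bu := Bψ + A' with hBu
  have hA'0 : 0 ≤ A' := by positivity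
  have hBu0 : 0 ≤ Bu := by positivity
  set δ := min 1 (1 / (R * (Bu + 1))) with hδ
  have hδ0 : 0 < δ := lt_min one_pos (by positivity)
  have hδ1 : δ ≤ 1 := min_le_left _ _
  have hδR : δ * (R * (Bu + 1)) ≤ 1 := by
    have h1 : δ ≤ 1 / (R * (Bu + 1)) := min_le_right _ _
    have h2 : 0 < R * (Bu + 1) := by positivity
    rwa [le_div_iff₀ h2] at h1
  set M := ((L0 + A) + 1 * Bu) / δ with hM
  have hM0 : 0 ≤ M := by positivity
  let c : XX m → ℝ := fun x => δ + ξ x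
  have hcL : ∀ x y, |c x - c y| ≤ 1 * ‖x - y‖ := by
    intro x y; simpa [c] using hξL x y
  have hc1 : ∀ x, δ ≤ c x := fun x => by simp only [c]; linarith [hξ0 x]
  have hc2 : ∀ x, c x ≤ 2 := fun x => by simp only [c]; linarith [hξ1 x]
  have hN : 0 ≤ M ^ (θ - 1) := Real.rpow_nonneg hM0 _
  obtain ⟨u, hu, ⟨Bb, hBb⟩, heq⟩ := exists_sol hN hδ0 (Gtr_lip (m := m) hθ hM0)
    (LH_of_lip zero_le_one hcL) (LH_of_lip (by positivity) hgL) hc1 hc2 hgB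
  -- lower bound
  have hlow : ∀ x, -Bψ ≤ u x := by
    intro x
    have := comparison2 hN hδ0 (Gtr_lip (m := m) hθ hM0) hu hψt (B := Bψ + Bb) (c := c) (κ := 0)
      (fun x => by
        have h1 := (abs_le.1 (hBψ x).1).2
        have h2 := (abs_le.1 (hBb x)).1
        linarith) hc1 le_rfl ?_ x
    · have h1 := (abs_le.1 (hBψ x).1).1
      simp at this
      linarith
    · intro x
      rw [heq x, add_zero]
      have h0 : c x * ψt x ≤ 0 :=
        mul_nonpos_of_nonneg_of_nonpos (hδ0.le.trans (hc1 x)) (hψ0 x)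
      have hG := Gtr_le hθ hM0 (fderiv ℝ ψt x)
      by_cases hx : ‖x‖ ≤ R + 1
      · have e1 : lap ψt x = lap ψ x := by
          rw [lap_congr (hψe x hx), lap_sub hψ contDiff_const, lap_const]; simp
        have e2 : fderiv ℝ ψt x = fderiv ℝ ψ x := by
          rw [(hψe x hx).fderiv_eq, fderiv_sub_const]
        have h3 := hsub x
        rw [e2] at hG ⊢
        rw [e1]
        have h4 : g x = f x - lam + A * ξ x := by simp only [g]; rw [hg0 x hx]
        have h5 := mul_nonneg hA0 (hξ0 x)
        linarith
      · have h4 : g x = g0 x + A := by simp only [g]; rw [hξout x (by linarith)]; ring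
        have h5 := (abs_le.1 (hg0B x)).1
        have h6 := (abs_le.1 (hBψ x).2.1).1
        have h7 : (1/θ) * ‖fderiv ℝ ψt x‖ ^ θ ≤ (1/θ) * Bψ ^ θ :=
          mul_le_mul_of_nonneg_left (Real.rpow_le_rpow (norm_nonneg _) (hBψ x).2.2 (by linarith))
            (by positivity)
        linarith
  have hup : ∀ x, u x ≤ A' := by
    intro x
    have hV : ContDiff ℝ 2 (fun x => A' - b * w x) := contDiff_const.sub (contDiff_const.mul hw)
    have hbw : ∀ x, b * w x ≤ b * Bw := fun x =>
      mul_le_mul_of_nonneg_left ((le_abs_self _).trans (hBw x).1) hb0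
    have := comparison2 hN hδ0 (Gtr_lip (m := m) hθ hM0) hV hu (B := Bb + b * Bw) (c := c) (κ := 0)
      (fun x => by
        have h2 := (abs_le.1 (hBb x)).2
        have := hbw x
        linarith) hc1 le_rfl ?_ x
    · have := mul_nonneg hb0 (hw0 x)
      simp at *
      linarith
    · intro x
      rw [heq x, add_zero]
      have hl : lap (fun x => A' - b * w x) x = - (b * lap w x) := by
        rw [lap_sub contDiff_const (contDiff_const.mul hw), lap_const, lap_const_mul b hw]; ring
      have hG := Gtr_nonneg hθ hM0 (fderiv ℝ (fun x => A' - b * w x) x)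
      rw [hl]
      have hgx := (abs_le.1 (hgB x)).2
      have hV0 : b + b * Bw ≤ A' - b * w x := by have := hbw x; linarith
      have hbB : 0 ≤ b * Bw := by positivity
      by_cases hx : ‖x‖ ≤ R + 1
      · have e1 : lap w x = 2 * m := by rw [lap_congr (hwe x hx), lap_normsq]
        have h1 : 0 ≤ c x * (A' - b * w x) :=
          mul_nonneg (hδ0.le.trans (hc1 x)) (by linarith)
        have h2 : (1 : ℝ) ≤ m := by exact_mod_cast hm
        have h3 : b ≤ b * m := le_mul_of_one_le_right hb0 h2
        rw [e1]
        linarith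
      · have h4 : c x = δ + 1 := by simp only [c]; rw [hξout x (by linarith)]
        have h5 : (A' - b * w x) ≤ c x * (A' - b * w x) := 
          le_mul_of_one_le_left (by linarith) (by linarith)
        have h6 : b * (-Bw) ≤ b * lap w x := mul_le_mul_of_nonneg_left (abs_le.1 (hBw x).2.1).1 hb0
        linarith
  have hBB : ∀ x, |u x| ≤ Bu := fun x => abs_le.2 ⟨by linarith [hlow x], by linarith [hup x]⟩
  have hgrad := grad_bound hN hδ0 zero_le_one (by positivity) (Gtr_lip (m := m) hθ hM0) hu hBB hc1
    hcL hgL heq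
  refine ⟨u, δ, hu, hδ0, hδ1, fun y => ?_, fun y hy => ?_⟩
  · rw [abs_mul, abs_of_pos hδ0, le_div_iff₀ (by linarith)]
    have := hBB y
    calc δ * |u y| * R = (δ * R) * |u y| := by ring
      _ ≤ (δ * R) * (Bu + 1) := by gcongr; linarith
      _ ≤ 1 := by linarith
  · have h1 := heq y
    rw [Gtr_eq (hgrad y)] at h1
    simp only [c, g, hξin y hy, hg0 y (by linarith)] at h1
    linarith

end EllipticKernel10

set_option linter.unusedSectionVars false
set_option linter.unusedVariables false

section EllipticKernel11

open MeasureTheory Topology Metric Set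
open scoped BoundedContinuousFunction

variable {m : ℕ}

theorem coord_diff (i : Fin m) (y : XX m) : DifferentiableAt ℝ (fun y : XX m => y i) y :=
  (EuclideanSpace.proj i : XX m →L[ℝ] ℝ).differentiableAt

noncomputable def eta (y : XX m) : ℝ := 1 - ‖y‖ ^ 2

theorem eta_C2 : ContDiff ℝ 2 (eta (m := m)) := contDiff_const.sub (contDiff_norm_sq ℝ)

theorem dd_eta (i : Fin m) (y : XX m) : dd i eta y = -2 * y i := by
  have h : DifferentiableAt ℝ (fun y : XX m => ‖y‖ ^ 2) y := C2_diff (contDiff_norm_sq ℝ) y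
  have := dd_sub (f := fun _ : XX m => (1 : ℝ)) (differentiableAt_const 1) h i
  rw [dd_normsq] at this
  show dd i (fun y => 1 - ‖y‖ ^ 2) y = _
  rw [this]
  simp [dd]

theorem dd_eta_pow (n : ℕ) (i : Fin m) (y : XX m) :
    dd i (fun y => eta y ^ (n + 1)) y = -2 * (n + 1) * (eta y ^ n * y i) := by
  have h : DifferentiableAt ℝ (eta (m := m)) y := C2_diff eta_C2 y
  have h1 := dd_eta i y
  unfold dd at h1 ⊢
  rw [(h.hasFDerivAt.pow (n + 1)).fderiv]
  simp [h1]
  ring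

theorem lap_eta_pow (n : ℕ) (y : XX m) :
    lap (fun y => eta y ^ (n + 2)) y =
      4 * (n + 2) * (n + 1) * eta y ^ n * ‖y‖ ^ 2 - 2 * (n + 2) * m * eta y ^ (n + 1) := by
  rw [lap_dd (eta_C2.pow _)]
  have h1 : ∀ i : Fin m, dd i (fun y : XX m => eta y ^ (n + 2)) =
      fun y => (-2 * ((n : ℝ) + 2)) * (eta y ^ (n + 1) * y i) := by
    intro i; ext y
    have := dd_eta_pow (n + 1) i y
    rw [this]; push_cast; ring
  have h2 : ∀ i : Fin m, dd i (dd i (fun y : XX m => eta y ^ (n + 2))) y =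
      4 * (n + 2) * (n + 1) * eta y ^ n * (y i) ^ 2 - 2 * (n + 2) * eta y ^ (n + 1) := by
    intro i
    have hd : DifferentiableAt ℝ (fun y : XX m => eta y ^ (n + 1)) y := C2_diff (eta_C2.pow _) y
    rw [h1, dd_const_mul (g := fun y : XX m => eta y ^ (n + 1) * y i) _ (hd.mul (coord_diff i y)), dd_mul hd (coord_diff i y), dd_coord,
      dd_eta_pow]
    simp
    ring
  simp only [h2]
  rw [Finset.sum_sub_distrib, ← Finset.mul_sum, EuclideanSpace.norm_sq_eq]
  simp
  ring

theorem max_calc {v : XX m → ℝ} (hv : ContDiff ℝ 2 v) (n : ℕ) {x : XX m} (hx : ‖x‖ < 1)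
    (hv0 : 0 ≤ v x)
    (hmax : IsLocalMax (fun y => eta y ^ (n + 2) * v y) x) :
    (∀ j, eta x * dd j v x = 2 * (n + 2) * (x j * v x)) ∧
      eta x ^ 2 * lap v x ≤ (8 * (n + 2) ^ 2 + 2 * (n + 2) * m) * v x := by
  have hη : 0 < eta x := by unfold eta; nlinarith [norm_nonneg x]
  have hη1 : eta x ≤ 1 := by unfold eta; nlinarith [norm_nonneg x]
  have hq : ContDiff ℝ 2 (fun y : XX m => eta y ^ (n + 2)) := eta_C2.pow _
  have hdq : ∀ j, dd j (fun y : XX m => eta y ^ (n + 2)) x = -2 * (n + 2) * (eta x ^ (n + 1) * x j) := by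
    intro j
    have := dd_eta_pow (n + 1) j x
    rw [this]; push_cast; ring
  have h1 : ∀ j, eta x * dd j v x = 2 * (n + 2) * (x j * v x) := by
    intro j
    have h0 := hmax.fderiv_eq_zero
    have h2 : dd j (fun y => eta y ^ (n + 2) * v y) x = 0 := by unfold dd; rw [h0]; rfl
    rw [dd_mul (C2_diff hq x) (C2_diff hv x), hdq] at h2
    have h3 : eta x ^ (n + 1) ≠ 0 := (pow_pos hη _).ne'
    apply mul_left_cancel₀ h3
    linear_combination h2
  refine ⟨h1, ?_⟩
  have h2 := lap_nonpos_of_max (hq.mul hv) hmax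
  rw [lap_mul hq hv, lap_eta_pow] at h2
  simp only [hdq] at h2
  have h3 : ∑ i, -2 * ((n : ℝ) + 2) * (eta x ^ (n + 1) * x i) * dd i v x =
      - 4 * (n + 2) ^ 2 * eta x ^ n * v x * ‖x‖ ^ 2 := by
    rw [EuclideanSpace.norm_sq_eq, Finset.mul_sum]
    refine Finset.sum_congr rfl fun i _ => ?_
    have := h1 i
    simp only [Real.norm_eq_abs, sq_abs]
    linear_combination (-2 * ((n : ℝ) + 2) * eta x ^ n * x i) * this
  rw [h3] at h2
  have h4 : 0 < eta x ^ n := pow_pos hη _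
  have h5 : eta x ^ n * (eta x ^ 2 * lap v x + v x * (4 * (n + 2) * (n + 1) * ‖x‖ ^ 2
      - 2 * (n + 2) * m * eta x) - 8 * (n + 2) ^ 2 * v x * ‖x‖ ^ 2) ≤ 0 := by
    refine le_trans (le_of_eq ?_) h2
    ring
  have h6 := nonpos_of_mul_nonpos_right h5 h4
  have h7 : ‖x‖ ^ 2 ≤ 1 := by nlinarith [norm_nonneg x]
  have h8 : 0 ≤ v x * (4 * (n + 2) * (n + 1) * ‖x‖ ^ 2) := by positivity
  have h9 : 8 * ((n : ℝ) + 2) ^ 2 * v x * ‖x‖ ^ 2 ≤ 8 * (n + 2) ^ 2 * v x :=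
    mul_le_of_le_one_right (by positivity) h7
  have h10 : v x * (2 * (n + 2) * m * eta x) ≤ v x * (2 * (n + 2) * m) := by
    exact mul_le_mul_of_nonneg_left (mul_le_of_le_one_right (by positivity) hη1) hv0
  linarith

theorem sumsq_calc {p : Fin m → XX m → ℝ} (hp : ∀ i, ContDiff ℝ 2 (p i)) (x : XX m) :
    (∀ j, dd j (fun y => ∑ i, p i y ^ 2) x = ∑ i, 2 * p i x * dd j (p i) x) ∧
    lap (fun y => ∑ i, p i y ^ 2) x =
      2 * ∑ i, p i x * lap (p i) x + 2 * ∑ i, ∑ j, (dd j (p i) x) ^ 2 := by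
  have e : (fun y => ∑ i, p i y ^ 2) = fun y => ∑ i, p i y * p i y := by
    ext y; simp only [pow_two]
  rw [e]
  constructor
  · intro j
    rw [dd_sum Finset.univ (f := fun i y => p i y * p i y)
      (fun i _ => (C2_diff (hp i) x).mul (C2_diff (hp i) x))]
    refine Finset.sum_congr rfl fun i _ => ?_
    rw [dd_mul (C2_diff (hp i) x) (C2_diff (hp i) x)]; ring
  · rw [lap_sum Finset.univ (f := fun i y => p i y * p i y) (fun i => (hp i).mul (hp i)),
      Finset.mul_sum, Finset.mul_sum, ← Finset.sum_add_distrib]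
    refine Finset.sum_congr rfl fun i _ => ?_
    rw [lap_mul (hp i) (hp i)]
    simp only [← pow_two]
    ring


theorem bern_alg {θ K s η σ S2 D v B E C1 c2 k : ℝ} {mm : ℝ} (hm : 1 ≤ mm) (hK : 1 ≤ K)
    (hk : 0 ≤ k) (hC1 : 0 ≤ C1) (hc2 : 0 ≤ c2)
    (hs : 1 ≤ s) (hη : 0 < η) (hη1 : η ≤ 1) (hσ : 0 ≤ σ) (hv : v = s ^ 2)
    (hD : D ^ 2 ≤ mm * S2) (hσD : σ * s ≤ K * (1 + |D|))
    (hB : |B| ≤ K * (c2 * σ)) (hE : |E| ≤ mm * (s * (K * (1 + s))))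
    (hmain : η ^ 2 * (2 * S2) + 2 * η * (2 * k * (v * B)) - 4 * η ^ 2 * E ≤ C1 * v) :
    η * σ ≤ (2 * K ^ 2 + K ^ 2 * mm * (C1 + 8 * mm * K)) + 4 * k * K ^ 3 * mm * c2 + 1 := by
  subst hv
  have hs2 : 1 ≤ s ^ 2 := by nlinarith
  have h1 : (σ * s) ^ 2 ≤ 2 * K ^ 2 * (1 + mm * S2) := by
    have h0 : 0 ≤ σ * s := by positivity
    calc (σ * s) ^ 2 ≤ (K * (1 + |D|)) ^ 2 := pow_le_pow_left₀ h0 hσD 2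
      _ = K ^ 2 * (1 + |D|) ^ 2 := by ring
      _ ≤ K ^ 2 * (2 * (1 + D ^ 2)) := by
          gcongr
          nlinarith [sq_abs D, sq_nonneg (1 - |D|)]
      _ ≤ K ^ 2 * (2 * (1 + mm * S2)) := by gcongr
      _ = _ := by ring
  have h2 : -(2 * η * (2 * k * (s ^ 2 * B))) ≤ 4 * k * K * c2 * (η * σ) * s ^ 2 := by
    have h3 := (abs_le.1 hB).1
    have h4 : 0 ≤ 4 * η * k * s ^ 2 := by positivity
    nlinarith [mul_le_mul_of_nonneg_left h3 h4]
  have h5 : 4 * η ^ 2 * E ≤ 8 * mm * K * s ^ 2 := by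
    have h6 : E ≤ mm * (s * (K * (1 + s))) := (le_abs_self _).trans hE
    have h7 : mm * (s * (K * (1 + s))) ≤ 2 * mm * K * s ^ 2 := by
      have : 0 ≤ mm * K * s := by positivity
      nlinarith
    have h8 : η ^ 2 ≤ 1 := by nlinarith
    have h9 : 0 ≤ 2 * mm * K * s ^ 2 := by positivity
    calc 4 * η ^ 2 * E ≤ 4 * η ^ 2 * (2 * mm * K * s ^ 2) := by
          gcongr; linarith
      _ ≤ 4 * 1 * (2 * mm * K * s ^ 2) := by gcongr
      _ = _ := by ring
  have h10 : η ^ 2 * (2 * S2) ≤ (C1 + 8 * mm * K + 4 * k * K * c2 * (η * σ)) * s ^ 2 := by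
    linarith
  have h11 : (η * σ) ^ 2 * s ^ 2 ≤ (2 * K ^ 2 + K ^ 2 * mm * (C1 + 8 * mm * K)
      + 4 * k * K ^ 3 * mm * c2 * (η * σ)) * s ^ 2 := by
    calc (η * σ) ^ 2 * s ^ 2 = η ^ 2 * (σ * s) ^ 2 := by ring
      _ ≤ η ^ 2 * (2 * K ^ 2 * (1 + mm * S2)) := by gcongr
      _ = 2 * K ^ 2 * η ^ 2 + K ^ 2 * mm * (η ^ 2 * (2 * S2)) := by ring
      _ ≤ 2 * K ^ 2 * s ^ 2 + K ^ 2 * mm * ((C1 + 8 * mm * K + 4 * k * K * c2 * (η * σ)) * s ^ 2) := by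
          gcongr; linarith
      _ = _ := by ring
  have h12 := le_of_mul_le_mul_right h11 (by linarith)
  set z := η * σ with hz
  set a := 2 * K ^ 2 + K ^ 2 * mm * (C1 + 8 * mm * K) with ha
  set b := 4 * k * K ^ 3 * mm * c2 with hb
  have ha0 : 0 ≤ a := by positivity
  have hb0 : 0 ≤ b := by positivity
  by_contra hcon
  push Not at hcon
  nlinarith [mul_nonneg ha0 (by linarith : 0 ≤ z - 1)]

theorem bernstein_est (hm : 1 ≤ m) {θ K : ℝ} (hθ : 1 < θ) (hK : 1 ≤ K) :
    ∃ C : ℝ, ∀ p : Fin m → XX m → ℝ, (∀ i, ContDiff ℝ 2 (p i)) →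
      (∀ x : XX m, ‖x‖ ≤ 1 → ∀ s : ℝ, s = √(∑ i, p i x ^ 2) →
        s ^ θ ≤ K * (1 + |∑ i, dd i (p i) x|) ∧
        ∃ b : XX m, ‖b‖ ≤ K * (1 + s) ^ (θ - 1) ∧
          ∀ i, |-(1/2) * lap (p i) x + ∑ j, b j * dd j (p i) x| ≤ K * (1 + s)) →
      ∑ i, p i 0 ^ 2 ≤ C := by
  obtain ⟨n, hn⟩ := exists_nat_ge (2 / (θ - 1))
  have hn2 : 2 ≤ (θ - 1) * (n + 2) := by
    rw [div_le_iff₀ (by linarith)] at hn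
    nlinarith
  set C1 : ℝ := 8 * (n + 2) ^ 2 + 2 * (n + 2) * m with hC1
  set c2 : ℝ := 2 ^ (θ - 1) with hc2
  have hc20 : 0 ≤ c2 := by positivity
  have hmm : (1 : ℝ) ≤ m := by exact_mod_cast hm
  set C' : ℝ := (2 * K ^ 2 + K ^ 2 * m * (C1 + 8 * m * K)) + 4 * (n + 2) * K ^ 3 * m * c2 + 1 with hC'
  have hC'1 : 1 ≤ C' := by
    have : 0 ≤ (2 * K ^ 2 + K ^ 2 * m * (C1 + 8 * m * K)) + 4 * (n + 2) * K ^ 3 * m * c2 := by positivity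
    linarith
  refine ⟨C' ^ (n + 2), fun p hp hyp => ?_⟩
  set v : XX m → ℝ := fun y => ∑ i, p i y ^ 2 with hv
  have hvC : ContDiff ℝ 2 v := ContDiff.sum fun i _ => (hp i).pow 2
  have hv0 : ∀ y, 0 ≤ v y := fun y => Finset.sum_nonneg fun i _ => sq_nonneg _
  obtain ⟨x, hxB, hxmax⟩ := (isCompact_closedBall (0 : XX m) 1).exists_isMaxOn ⟨0, by simp⟩
    ((eta_C2.continuous.pow (n + 2)).mul hvC.continuous).continuousOn
  have hx1 : ‖x‖ ≤ 1 := by simpa using hxB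
  have hw0 : v 0 ≤ eta x ^ (n + 2) * v x := by
    have := hxmax (show (0 : XX m) ∈ closedBall 0 1 by simp)
    simpa [eta] using this
  show v 0 ≤ _
  refine hw0.trans ?_
  have hη0 : 0 ≤ eta x := by unfold eta; nlinarith [norm_nonneg x]
  have hη1 : eta x ≤ 1 := by unfold eta; nlinarith [norm_nonneg x]
  have hC'k : 1 ≤ C' ^ (n + 2) := one_le_pow₀ hC'1
  have hηk : eta x ^ (n + 2) ≤ 1 := pow_le_one₀ hη0 hη1
  rcases lt_or_ge (v x) 1 with hlt | hge
  · refine le_trans ?_ hC'k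
    calc eta x ^ (n + 2) * v x ≤ 1 * v x := by gcongr
      _ ≤ 1 := by linarith
  rcases hη0.eq_or_lt with h0 | hηpos
  · rw [← h0]; simp; linarith
  have hx1' : ‖x‖ < 1 := by
    by_contra hcon
    have : ‖x‖ = 1 := by linarith
    unfold eta at hηpos
    rw [this] at hηpos
    norm_num at hηpos
  have hloc : IsLocalMax (fun y => eta y ^ (n + 2) * v y) x :=
    hxmax.isLocalMax (closedBall_mem_nhds_of_mem (by simpa using hx1'))
  obtain ⟨hd, hl⟩ := max_calc hvC n hx1' (hv0 x) hloc
  obtain ⟨hs1, hs2⟩ := sumsq_calc hp x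
  set s := √(v x) with hs
  have hss : s ^ 2 = v x := Real.sq_sqrt (hv0 x)
  have hs1' : 1 ≤ s := Real.one_le_sqrt.2 hge
  obtain ⟨hD, b, hb, hbe⟩ := hyp x hx1 s rfl
  set σ := s ^ (θ - 1) with hσ
  have hσ0 : 0 ≤ σ := by positivity
  have hσs : s ^ θ = σ * s := by
    rw [hσ, ← Real.rpow_add_one (by positivity)]; ring_nf
  have hps : ∀ i, |p i x| ≤ s := by
    intro i
    refine Real.abs_le_sqrt ?_
    exact Finset.single_le_sum (f := fun i => p i x ^ 2) (fun i _ => sq_nonneg _) (Finset.mem_univ i)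
  set E := ∑ i, p i x * (-(1/2) * lap (p i) x + ∑ j, b j * dd j (p i) x) with hE
  set B := ∑ j, b j * x j with hB
  have hz : eta x * σ ≤ C' := by
    refine bern_alg (θ := θ) (s := s) (S2 := ∑ i, ∑ j, (dd j (p i) x) ^ 2)
      (D := ∑ i, dd i (p i) x) (v := v x) (B := B) (E := E) (k := n + 2)
      hmm hK (by positivity) (by positivity) hc20 hs1' hηpos hη1 hσ0 hss.symm ?_ ?_ ?_ ?_ ?_
    · have h1 := Finset.sum_mul_sq_le_sq_mul_sq Finset.univ (fun _ : Fin m => (1 : ℝ)) (fun i => dd i (p i) x)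
      simp at h1
      refine h1.trans ?_
      gcongr with i
      exact Finset.single_le_sum (f := fun j => dd j (p i) x ^ 2) (fun i _ => sq_nonneg _) (Finset.mem_univ i)
    · rw [← hσs]; exact hD
    · have h1 : |B| ≤ ‖b‖ * ‖x‖ := by
        have := abs_real_inner_le_norm b x
        rw [PiLp.inner_apply] at this
        simpa [hB, mul_comm] using this
      refine h1.trans ?_
      calc ‖b‖ * ‖x‖ ≤ ‖b‖ * 1 := by gcongr
        _ ≤ K * (1 + s) ^ (θ - 1) := by simpa using hb
        _ ≤ K * (2 * s) ^ (θ - 1) := by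
            gcongr
            · linarith
        _ = K * (c2 * σ) := by rw [Real.mul_rpow (by norm_num) (by positivity)]
    · refine (Finset.abs_sum_le_sum_abs _ _).trans ?_
      have : ∀ i ∈ (Finset.univ : Finset (Fin m)), |p i x * (-(1/2) * lap (p i) x + ∑ j, b j * dd j (p i) x)| ≤ s * (K * (1 + s)) := by
        intro i _
        rw [abs_mul]
        exact mul_le_mul (hps i) (hbe i) (abs_nonneg _) (by positivity)
      refine (Finset.sum_le_card_nsmul _ _ _ this).trans ?_
      simp
    · refine le_trans (le_of_eq ?_) hl
      rw [hs2]
      have e1 : eta x * ∑ i, ∑ j, b j * (2 * p i x * dd j (p i) x) = 2 * (n + 2) * (v x * B) := by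
        rw [Finset.sum_comm]
        simp only [← Finset.mul_sum, ← hs1]
        rw [hB, Finset.mul_sum, Finset.mul_sum, Finset.mul_sum]
        refine Finset.sum_congr rfl fun j _ => ?_
        linear_combination b j * hd j
      have e2 : E = -(1/2) * ∑ i, p i x * lap (p i) x
          + (1/2) * ∑ i, ∑ j, b j * (2 * p i x * dd j (p i) x) := by
        rw [hE, Finset.mul_sum, Finset.mul_sum, ← Finset.sum_add_distrib]
        refine Finset.sum_congr rfl fun i _ => ?_
        rw [mul_add, Finset.mul_sum, Finset.mul_sum]
        congr 1
        · ring
        · refine Finset.sum_congr rfl fun j _ => ?_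
          ring
      rw [e2]
      linear_combination (-2 * eta x) * e1
  have h1 : s ^ 2 ≤ σ ^ (n + 2) := by
    rw [hσ, ← Real.rpow_natCast (s ^ (θ - 1)), ← Real.rpow_mul (by positivity), ← Real.rpow_two]
    refine Real.rpow_le_rpow_of_exponent_le hs1' ?_
    push_cast
    exact hn2
  calc eta x ^ (n + 2) * v x = eta x ^ (n + 2) * s ^ 2 := by rw [hss]
    _ ≤ eta x ^ (n + 2) * σ ^ (n + 2) := by gcongr
    _ = (eta x * σ) ^ (n + 2) := by rw [mul_pow]
    _ ≤ C' ^ (n + 2) := by gcongr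

end EllipticKernel11

set_option linter.unusedSectionVars false
set_option linter.unusedVariables false

section EllipticKernel12

open MeasureTheory Topology Metric Set
open scoped BoundedContinuousFunction

variable {m : ℕ}

theorem unif_dq {F : Type*} [NormedAddCommGroup F] [NormedSpace ℝ F] {g : XX m → F}
    (hg : ContDiff ℝ 1 g) (e : XX m) (he : ‖e‖ = 1) {ε : ℝ} (hε : 0 < ε) :
    ∀ᶠ h in 𝓝[>] (0 : ℝ), ∀ x : XX m, ‖x‖ ≤ 1 →
      ‖h⁻¹ • (g (x + h • e) - g x) - fderiv ℝ g x e‖ ≤ ε := by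
  have hc : Continuous (fderiv ℝ g) := hg.continuous_fderiv one_ne_zero
  have huc := (isCompact_closedBall (0 : XX m) 2).uniformContinuousOn_of_continuous hc.continuousOn
  obtain ⟨d, hd, hdd⟩ := Metric.uniformContinuousOn_iff.1 huc ε hε
  have hmem : Ioo (0 : ℝ) (min d 1) ∈ 𝓝[>] (0 : ℝ) := Ioo_mem_nhdsGT (lt_min hd one_pos)
  filter_upwards [hmem] with h hh x hx
  have hh1 : h < 1 := lt_of_lt_of_le hh.2 (min_le_right _ _)
  have hhd : h < d := lt_of_lt_of_le hh.2 (min_le_left _ _)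
  have hseg : ∀ y ∈ closedBall x h, ‖fderiv ℝ g y - fderiv ℝ g x‖ ≤ ε := by
    intro y hy
    rw [mem_closedBall] at hy
    have h2 : ‖y‖ ≤ 2 := by
      have := norm_le_norm_add_norm_sub' y x
      rw [dist_eq_norm] at hy
      linarith
    have := hdd y (by simpa using h2) x (by simp; linarith) (by linarith)
    rw [dist_eq_norm] at this
    exact this.le
  have := (convex_closedBall x h).norm_image_sub_le_of_norm_fderiv_le' (𝕜 := ℝ) (f := g)
    (fun y _ => hg.differentiable one_ne_zero y) hseg (mem_closedBall_self hh.1.le)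
    (y := x + h • e) (by simp [norm_smul, he, abs_of_pos hh.1])
  simp only [add_sub_cancel_left, map_smul, norm_smul, he, mul_one, Real.norm_eq_abs,
    abs_of_pos hh.1] at this
  have e1 : h⁻¹ • (g (x + h • e) - g x) - fderiv ℝ g x e =
      h⁻¹ • (g (x + h • e) - g x - h • fderiv ℝ g x e) := by
    rw [smul_sub h⁻¹ (g (x + h • e) - g x), smul_smul, inv_mul_cancel₀ hh.1.ne', one_smul]
  rw [e1, norm_smul, norm_inv, Real.norm_eq_abs, abs_of_pos hh.1, inv_mul_le_iff₀ hh.1]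
  linarith

theorem gu_C1 {u : XX m → ℝ} (hu : ContDiff ℝ 2 u) : ContDiff ℝ 1 (gradient u) := by
  have : ContDiff ℝ 1 (fderiv ℝ u) := hu.fderiv_right (m := 1) (by norm_num [one_add_one_eq_two])
  exact (InnerProductSpace.toDual ℝ (XX m)).symm.toContinuousLinearEquiv.toContinuousLinearMap.contDiff.comp this

theorem gu_coord (k : XX m → ℝ) (y : XX m) (i : Fin m) : gradient k y i = dd i k y := by
  have h := EuclideanSpace.inner_single_right (𝕜 := ℝ) i 1 (gradient k y)
  unfold gradient at h ⊢
  rw [InnerProductSpace.toDual_symm_apply] at h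
  unfold dd ee
  rw [h]; simp

theorem gu_norm (k : XX m → ℝ) (y : XX m) : ‖gradient k y‖ = ‖fderiv ℝ k y‖ := by simp [gradient]

theorem fderiv_eq_sum (k : XX m → ℝ) (y v : XX m) : fderiv ℝ k y v = ∑ j, gradient k y j * v j := by
  have h1 : inner ℝ (gradient k y) v = fderiv ℝ k y v := by
    unfold gradient; simp
  rw [← h1, PiLp.inner_apply]
  simp [mul_comm]

noncomputable def Hx (θ : ℝ) (q : XX m) : ℝ := (1/θ) * ‖q‖ ^ θ

theorem Hx_C1 {θ : ℝ} (hθ : 1 < θ) : ContDiff ℝ 1 (Hx (m := m) θ) :=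
  contDiff_const.mul (contDiff_norm_rpow hθ)

theorem Hx_fderiv {θ : ℝ} (hθ : 1 < θ) (q : XX m) : ‖fderiv ℝ (Hx θ) q‖ = ‖q‖ ^ (θ - 1) := by
  have h : DifferentiableAt ℝ (fun q : XX m => ‖q‖ ^ θ) q :=
    (contDiff_norm_rpow hθ).differentiable one_ne_zero q
  have h2 : fderiv ℝ (Hx θ) q = (1/θ) • fderiv ℝ (fun q : XX m => ‖q‖ ^ θ) q := by
    show fderiv ℝ (fun q : XX m => (1/θ) * ‖q‖ ^ θ) q = _
    exact fderiv_const_mul h _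
  rw [h2, norm_smul, norm_fderiv_norm_id_rpow q hθ]
  rw [Real.norm_of_nonneg (by positivity)]
  field_simp


theorem ee_norm (i : Fin m) : ‖(ee i : XX m)‖ = 1 := by simp [ee]

/-- difference quotient -/
noncomputable def dq (u : XX m → ℝ) (h : ℝ) (i : Fin m) (x : XX m) : ℝ := h⁻¹ * (u (x + h • ee i) - u x)

theorem dq_C2 {u : XX m → ℝ} (hu : ContDiff ℝ 2 u) (h : ℝ) (i : Fin m) : ContDiff ℝ 2 (dq u h i) :=
  contDiff_const.mul ((lap_translate hu (h • ee i) 0).1.sub hu)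

theorem dq_lap {u : XX m → ℝ} (hu : ContDiff ℝ 2 u) (h : ℝ) (i : Fin m) (x) :
    lap (dq u h i) x = h⁻¹ * (lap u (x + h • ee i) - lap u x) := by
  have h1 := lap_translate hu (h • ee i) x
  show lap (fun x => h⁻¹ * (u (x + h • ee i) - u x)) x = _
  rw [lap_const_mul _ (h1.1.sub hu), lap_sub h1.1 hu, h1.2.1]

theorem dq_dd {u : XX m → ℝ} (hu : ContDiff ℝ 2 u) (h : ℝ) (i j : Fin m) (x) :
    dd j (dq u h i) x = h⁻¹ * (dd j u (x + h • ee i) - dd j u x) := by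
  have h1 := lap_translate hu (h • ee i) x
  show dd j (fun x => h⁻¹ * (u (x + h • ee i) - u x)) x = _
  rw [dd_const_mul (g := fun x => u (x + h • ee i) - u x) _ ((C2_diff h1.1 x).sub (C2_diff hu x)),
    dd_sub (C2_diff h1.1 x) (C2_diff hu x)]
  unfold dd
  rw [h1.2.2]

theorem grad_est (hm : 1 ≤ m) {θ K0 : ℝ} (hθ : 1 < θ) (hK0 : 0 ≤ K0) :
    ∃ C : ℝ, 0 ≤ C ∧ ∀ u F : XX m → ℝ, ContDiff ℝ 2 u →
      (∀ x, ‖x‖ ≤ 2 → -(1/2) * lap u x + (1/θ) * ‖fderiv ℝ u x‖ ^ θ = F x) →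
      (∀ x, ‖x‖ ≤ 2 → |F x| ≤ K0) →
      (∀ x y, ‖x‖ ≤ 2 → ‖y‖ ≤ 2 → |F x - F y| ≤ K0 * ‖x - y‖ + |u x - u y|) →
      ‖fderiv ℝ u 0‖ ≤ C := by
  set K := 2 ^ θ * (1 + θ * (K0 + 1)) + K0 + 3 with hK
  have hA0 : 0 ≤ (2 : ℝ) ^ θ * (1 + θ * (K0 + 1)) := by positivity
  have hK1 : 1 ≤ K := by linarith
  obtain ⟨C, hC⟩ := bernstein_est hm hθ hK1
  refine ⟨√C, Real.sqrt_nonneg _, fun u F hu heq hF1 hF2 => ?_⟩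
  apply Real.le_sqrt_of_sq_le
  rw [norm_fderiv_sq]
  have hmm : (1 : ℝ) ≤ m := by exact_mod_cast hm
  have hgu := gu_C1 hu
  have hHg : ContDiff ℝ 1 (fun x => Hx θ (gradient u x)) := (Hx_C1 hθ).comp hgu
  obtain ⟨Mu, hMu0, hMu⟩ := bdd_on_ball (k := fun x => ‖fderiv ℝ (Hx θ) (gradient u x)‖)
    ((((Hx_C1 (m := m) hθ).continuous_fderiv one_ne_zero).comp hgu.continuous).norm) 1
  -- convergence of difference quotients
  have hlim : Tendsto (fun h => ∑ i, dq u h i 0 ^ 2) (𝓝[>] 0) (𝓝 (∑ i, dd i u 0 ^ 2)) := by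
    refine tendsto_finsetSum _ fun i _ => ?_
    refine Tendsto.pow ?_ 2
    rw [Metric.tendsto_nhds]
    intro ε hε
    filter_upwards [unif_dq (hu.of_le one_le_two) (ee i) (ee_norm i) (half_pos hε)] with h hh
    have := hh 0 (by simp)
    rw [Real.dist_eq]
    refine lt_of_le_of_lt this (by linarith)
  refine le_of_tendsto hlim ?_
  have hmp : (0 : ℝ) < 1 / m := by positivity
  have ev1 : ∀ᶠ h in 𝓝[>] (0 : ℝ), ∀ i, ∀ x : XX m, ‖x‖ ≤ 1 → |dq u h i x - dd i u x| ≤ 1 / m :=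
    eventually_all.2 fun i => unif_dq (hu.of_le one_le_two) (ee i) (ee_norm i) hmp
  have ev2 : ∀ᶠ h in 𝓝[>] (0 : ℝ), ∀ i, ∀ x : XX m, ‖x‖ ≤ 1 →
      |dd i (dq u h i) x - dd i (dd i u) x| ≤ 1 / m := by
    refine eventually_all.2 fun i => ?_
    filter_upwards [unif_dq (dd_C1 hu i) (ee i) (ee_norm i) hmp] with h hh x hx
    rw [dq_dd hu]
    exact hh x hx
  have ev3 : ∀ᶠ h in 𝓝[>] (0 : ℝ), ∀ i, ∀ x : XX m, ‖x‖ ≤ 1 →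
      ‖h⁻¹ • (gradient u (x + h • ee i) - gradient u x) - fderiv ℝ (gradient u) x (ee i)‖ ≤ 1 / (Mu + 1) :=
    eventually_all.2 fun i => unif_dq hgu (ee i) (ee_norm i) (by positivity)
  have ev4 : ∀ᶠ h in 𝓝[>] (0 : ℝ), ∀ i, ∀ x : XX m, ‖x‖ ≤ 1 →
      |h⁻¹ * (Hx θ (gradient u (x + h • ee i)) - Hx θ (gradient u x))
        - fderiv ℝ (Hx θ) (gradient u x) (fderiv ℝ (gradient u) x (ee i))| ≤ 1 := by
    refine eventually_all.2 fun i => ?_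
    filter_upwards [unif_dq hHg (ee i) (ee_norm i) one_pos] with h hh x hx
    have h1 := hh x hx
    have h2 : fderiv ℝ (fun x => Hx θ (gradient u x)) x =
        (fderiv ℝ (Hx θ) (gradient u x)).comp (fderiv ℝ (gradient u) x) :=
      fderiv_comp x ((Hx_C1 hθ).differentiable one_ne_zero _) (hgu.differentiable one_ne_zero x)
    rw [h2] at h1
    exact h1
  have ev5 : Ioo (0 : ℝ) 1 ∈ 𝓝[>] (0 : ℝ) := Ioo_mem_nhdsGT one_pos
  filter_upwards [ev1, ev2, ev3, ev4, ev5] with h e1 e2 e3 e4 e5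
  refine hC (dq u h) (fun i => dq_C2 hu h i) ?_
  intro x hx s hs
  have hx2 : ‖x‖ ≤ 2 := by linarith
  have hxe : ∀ i : Fin m, ‖x + h • ee i‖ ≤ 2 := by
    intro i
    refine (norm_add_le _ _).trans ?_
    rw [norm_smul, ee_norm, Real.norm_eq_abs, abs_of_pos e5.1]
    linarith [e5.2]
  have hs0 : 0 ≤ s := by rw [hs]; exact Real.sqrt_nonneg _
  -- compare s with the gradient
  have hsg : |s - ‖gradient u x‖| ≤ 1 := by
    have e : s = ‖(WithLp.toLp 2 (fun i => dq u h i x) : XX m)‖ := by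
      rw [hs, EuclideanSpace.norm_eq]; simp
    rw [e]
    refine (abs_norm_sub_norm_le _ _).trans ?_
    rw [EuclideanSpace.norm_eq]
    rw [Real.sqrt_le_one]
    have : ∀ i ∈ (Finset.univ : Finset (Fin m)),
        ‖((WithLp.toLp 2 (fun i => dq u h i x) : XX m) - gradient u x) i‖ ^ 2 ≤ 1 / m := by
      intro i _
      have h1 := e1 i x hx
      simp only [PiLp.sub_apply, gu_coord, Real.norm_eq_abs]
      have h2 : (1 : ℝ) / m ≤ 1 := by rw [div_le_one (by positivity)]; exact hmm
      nlinarith [abs_nonneg (dq u h i x - dd i u x)]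
    refine (Finset.sum_le_card_nsmul _ _ _ this).trans ?_
    simp
    rw [mul_inv_cancel₀ (by positivity)]
  have hsg' := abs_le.1 hsg
  have hHxu : Hx θ (gradient u x) = F x + (1/2) * lap u x := by
    have := heq x hx2
    rw [← gu_norm] at this
    unfold Hx; linarith
  constructor
  · set D := ∑ i, dd i (dq u h i) x with hD
    have hlD : |lap u x - D| ≤ 1 := by
      rw [lap_dd hu, hD, ← Finset.sum_sub_distrib]
      refine (Finset.abs_sum_le_sum_abs _ _).trans ?_
      have : ∀ i ∈ (Finset.univ : Finset (Fin m)), |dd i (dd i u) x - dd i (dq u h i) x| ≤ 1 / m := by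
        intro i _
        rw [abs_sub_comm]; exact e2 i x hx
      refine (Finset.sum_le_card_nsmul _ _ _ this).trans ?_
      simp
      rw [mul_inv_cancel₀ (by positivity)]
    set t := ‖gradient u x‖ with ht
    have ht0 : 0 ≤ t := norm_nonneg _
    have h1 : s ^ θ ≤ 2 ^ θ * (1 + t ^ θ) := by
      calc s ^ θ ≤ (1 + t) ^ θ := Real.rpow_le_rpow hs0 (by linarith) (by linarith)
        _ ≤ (2 * max 1 t) ^ θ := Real.rpow_le_rpow (by positivity)
            (by linarith [le_max_left 1 t, le_max_right 1 t]) (by linarith)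
        _ = 2 ^ θ * (max 1 t) ^ θ := Real.mul_rpow (by norm_num) (by positivity)
        _ ≤ 2 ^ θ * (1 + t ^ θ) := by
            gcongr
            have : 0 ≤ t ^ θ := by positivity
            rcases max_choice 1 t with h | h <;> rw [h]
            · simp; exact this
            · linarith
    have h2 : t ^ θ = θ * (F x + (1/2) * lap u x) := by
      rw [← hHxu]; unfold Hx; field_simp; rw [ht]
    have h3 := (abs_le.1 (hF1 x hx2)).2
    have h4 := (abs_le.1 hlD).2
    have h5 := le_abs_self D
    have h6 : t ^ θ ≤ θ * (K0 + 1 + |D|) := by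
      rw [h2]
      refine mul_le_mul_of_nonneg_left ?_ (by linarith)
      have := abs_nonneg D
      linarith
    refine h1.trans ?_
    calc 2 ^ θ * (1 + t ^ θ) ≤ 2 ^ θ * (1 + θ * (K0 + 1 + |D|)) := by gcongr
      _ ≤ 2 ^ θ * ((1 + θ * (K0 + 1)) * (1 + |D|)) := by
          gcongr
          have := abs_nonneg D
          have : 0 ≤ θ * K0 * |D| := by positivity
          nlinarith
      _ = 2 ^ θ * (1 + θ * (K0 + 1)) * (1 + |D|) := by ring
      _ ≤ K * (1 + |D|) := by
          gcongr
          linarith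
  · refine ⟨gradient (Hx θ) (gradient u x), ?_, ?_⟩
    · rw [gu_norm, Hx_fderiv hθ]
      have h1 : ‖gradient u x‖ ^ (θ - 1) ≤ (1 + s) ^ (θ - 1) :=
        Real.rpow_le_rpow (norm_nonneg _) (by linarith) (by linarith)
      refine h1.trans ?_
      exact le_mul_of_one_le_left (by positivity) hK1
    · intro i
      have hl : -(1/2) * lap (dq u h i) x = h⁻¹ * (F (x + h • ee i) - F x)
          - h⁻¹ * (Hx θ (gradient u (x + h • ee i)) - Hx θ (gradient u x)) := by
        rw [dq_lap hu, hHxu]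
        have := heq _ (hxe i)
        rw [← gu_norm] at this
        unfold Hx
        linear_combination h⁻¹ * this
      have hb : ∑ j, gradient (Hx θ) (gradient u x) j * dd j (dq u h i) x =
          fderiv ℝ (Hx θ) (gradient u x) (h⁻¹ • (gradient u (x + h • ee i) - gradient u x)) := by
        rw [fderiv_eq_sum]
        refine Finset.sum_congr rfl fun j _ => ?_
        rw [dq_dd hu]
        simp [gu_coord]
      rw [hl, hb]
      have h3 := e3 i x hx
      have h4 := e4 i x hx
      set L := fderiv ℝ (Hx θ) (gradient u x) with hL
      set z := h⁻¹ • (gradient u (x + h • ee i) - gradient u x) with hz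
      set z' := fderiv ℝ (gradient u) x (ee i) with hz'
      have h5 : |L z - L z'| ≤ 1 := by
        rw [← map_sub, ← Real.norm_eq_abs]
        refine (L.le_opNorm _).trans ?_
        have h6 : ‖L‖ ≤ Mu := by have := hMu x hx; simpa using this
        calc ‖L‖ * ‖z - z'‖ ≤ (Mu + 1) * (1 / (Mu + 1)) := by
              gcongr; linarith
          _ = 1 := by field_simp
      have h7 : |h⁻¹ * (F (x + h • ee i) - F x)| ≤ K0 + s := by
        rw [abs_mul, abs_of_pos (inv_pos.2 e5.1)]
        have h8 := hF2 (x + h • ee i) x (hxe i) hx2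
        rw [add_sub_cancel_left, norm_smul, ee_norm, Real.norm_eq_abs, abs_of_pos e5.1, mul_one] at h8
        have h9 : |dq u h i x| ≤ s := by
          rw [hs]
          refine Real.abs_le_sqrt ?_
          exact Finset.single_le_sum (f := fun i => dq u h i x ^ 2) (fun i _ => sq_nonneg _) (Finset.mem_univ i)
        have h10 : |u (x + h • ee i) - u x| = h * |dq u h i x| := by
          unfold dq
          rw [abs_mul, abs_of_pos (inv_pos.2 e5.1), ← mul_assoc, mul_inv_cancel₀ e5.1.ne', one_mul]
        rw [h10] at h8
        rw [inv_mul_le_iff₀ e5.1]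
        nlinarith [mul_le_mul_of_nonneg_left h9 e5.1.le]
      have h11 := abs_le.1 h7
      have h12 := abs_le.1 h5
      have h13 := abs_le.1 h4
      have h14 : K0 + s + 2 ≤ K * (1 + s) := by nlinarith
      rw [abs_le]
      constructor <;> linarith

end EllipticKernel12

set_option linter.unusedSectionVars false
set_option linter.unusedVariables false

section EllipticKernel13

open MeasureTheory Topology Metric Set
open scoped BoundedContinuousFunction

variable {m : ℕ}

theorem cpt_subseq {Y : Type*} [NormedAddCommGroup Y] [ProperSpace Y] {Wn : ℕ → XX m → Y}
    (h : ∀ ρ : ℝ, ∃ B C : ℝ, 0 ≤ C ∧ ∀ᶠ n in atTop, ∀ x y, ‖x‖ ≤ ρ → ‖y‖ ≤ ρ →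
      ‖Wn n x‖ ≤ B ∧ ‖Wn n x - Wn n y‖ ≤ C * √‖x - y‖) :
    ∃ (W : XX m → Y) (φ : ℕ → ℕ), (∀ n, n ≤ φ n) ∧
      ∀ (n : ℕ) x, ‖x‖ ≤ (n : ℝ) → ‖Wn (φ n) x - W x‖ ≤ 1 / ((n : ℝ) + 1) := by
  have hle : (hyperfilter ℕ : Filter ℕ) ≤ atTop := Nat.hyperfilter_le_atTop
  have hex : ∀ x : XX m, ∃ y, Tendsto (fun n => Wn n x) (hyperfilter ℕ) (𝓝 y) := by
    intro x
    obtain ⟨B, C, -, hB⟩ := h ‖x‖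
    have h1 : ∀ᶠ n in (hyperfilter ℕ : Filter ℕ), Wn n x ∈ closedBall (0 : Y) B := by
      filter_upwards [hle hB] with n hn
      simpa using (hn x x le_rfl le_rfl).1
    obtain ⟨y, -, hy⟩ := isCompact_iff_ultrafilter_le_nhds.1 (isCompact_closedBall (0 : Y) B)
      ((hyperfilter ℕ).map fun n => Wn n x) (le_principal_iff.2 h1)
    exact ⟨y, hy⟩
  choose W hW using hex
  have hun : ∀ ρ ε : ℝ, 0 < ε → ∀ᶠ n in (hyperfilter ℕ : Filter ℕ), ∀ x, ‖x‖ ≤ ρ →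
      ‖Wn n x - W x‖ ≤ ε := by
    intro ρ ε hε
    obtain ⟨B, C, hC, hB⟩ := h ρ
    have hWH : ∀ x y, ‖x‖ ≤ ρ → ‖y‖ ≤ ρ → ‖W x - W y‖ ≤ C * √‖x - y‖ := by
      intro x y hx hy
      refine le_of_tendsto ((hW x).sub (hW y)).norm ?_
      filter_upwards [hle hB] with n hn
      exact (hn x y hx hy).2
    set η := (ε / (3 * (C + 1))) ^ 2 with hη
    have hη0 : 0 < η := by positivity
    have hηC : C * √η ≤ ε / 3 := by
      rw [hη, Real.sqrt_sq (by positivity)]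
      have : C * (ε / (3 * (C + 1))) = (C / (C + 1)) * (ε / 3) := by field_simp
      rw [this]
      exact mul_le_of_le_one_left (by positivity) (by rw [div_le_one (by positivity)]; linarith)
    obtain ⟨t, hts, htf, hcov⟩ := (isCompact_closedBall (0 : XX m) ρ).finite_cover_balls hη0
    have h1 : ∀ᶠ n in (hyperfilter ℕ : Filter ℕ), ∀ z ∈ t, ‖Wn n z - W z‖ ≤ ε / 3 := by
      rw [eventually_all_finite htf]
      intro z hz
      have := (tendsto_iff_norm_sub_tendsto_zero.1 (hW z))
      exact (this.eventually (gt_mem_nhds (by positivity : 0 < ε / 3))).mono fun n hn => le_of_lt hn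
    filter_upwards [h1, hle hB] with n hn1 hn2 x hx
    obtain ⟨z, hz⟩ := mem_iUnion.1 (hcov (show x ∈ closedBall 0 ρ by simpa using hx))
    obtain ⟨hzt, hxz⟩ := mem_iUnion.1 hz
    have hzρ : ‖z‖ ≤ ρ := by simpa using hts hzt
    rw [mem_ball, dist_eq_norm] at hxz
    have hsq : C * √‖x - z‖ ≤ ε / 3 := le_trans (by gcongr) hηC
    have a1 := (hn2 x z hx hzρ).2
    have a2 := hn1 z hzt
    have a3 := hWH z x hzρ hx
    rw [norm_sub_rev z x] at a3
    have e : Wn n x - W x = (Wn n x - Wn n z) + (Wn n z - W z) + (W z - W x) := by abel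
    rw [e]
    refine (norm_add₃_le).trans ?_
    linarith
  have hch : ∀ n : ℕ, ∃ k : ℕ, n ≤ k ∧ ∀ x, ‖x‖ ≤ n → ‖Wn k x - W x‖ ≤ 1 / ((n : ℝ) + 1) := by
    intro n
    have h0 : ∀ᶠ k in (hyperfilter ℕ : Filter ℕ), n ≤ k := hle (eventually_ge_atTop n)
    exact (h0.and (hun n (1 / ((n : ℝ) + 1)) (by positivity))).exists
  choose φ hφ1 hφ2 using hch
  exact ⟨W, φ, hφ1, hφ2⟩

theorem grad_loc (hm : 1 ≤ m) {θ lam : ℝ} (hθ : 1 < θ) {f : XX m → ℝ} (hf : LocallyLipschitz f)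
    (ρ : ℝ) : ∃ C, 0 ≤ C ∧ ∀ (u : XX m → ℝ) (δ R : ℝ), ContDiff ℝ 2 u → 0 < δ → δ ≤ 1 → 1 ≤ R →
      (∀ y, |δ * u y| ≤ 1 / R) →
      (∀ y, ‖y‖ ≤ R → -(1/2) * lap u y + (1/θ) * ‖fderiv ℝ u y‖ ^ θ = f y - lam - δ * u y) →
      ρ + 2 ≤ R → ∀ x, ‖x‖ ≤ ρ → ‖fderiv ℝ u x‖ ≤ C := by
  have hF : LocallyLipschitz fun y => f y - lam := by
    simpa using hf.sub (LocallyLipschitz.const lam)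
  obtain ⟨g, L, B, hL, hB, hgL, hgB, hg⟩ := lip_extend hF (ρ + 2)
  obtain ⟨C, hC0, hC⟩ := grad_est hm hθ (K0 := L + B + 1) (by positivity)
  refine ⟨C, hC0, fun u δ R hu hδ0 hδ1 hR hδu heq hρR x hx => ?_⟩
  have ht := fun y => lap_translate hu x y
  have hball : ∀ y : XX m, ‖y‖ ≤ 2 → ‖y + x‖ ≤ ρ + 2 := fun y hy =>
    (norm_add_le _ _).trans (by linarith)
  have := hC (fun y => u (y + x)) (fun y => f (y + x) - lam - δ * u (y + x)) (ht 0).1 ?_ ?_ ?_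
  · rw [(ht 0).2.2, zero_add] at this
    exact this
  · intro y hy
    rw [(ht y).2.1, (ht y).2.2]
    exact heq _ ((hball y hy).trans hρR)
  · intro y hy
    have h1 := hg _ (hball y hy)
    have h2 := hgB (y + x)
    have h3 := hδu (y + x)
    have h4 : 1 / R ≤ 1 := by rw [div_le_one (by linarith)]; exact hR
    rw [h1] at h2
    refine (abs_sub _ _).trans ?_
    linarith
  · intro y z hy hz
    have h1 := hg _ (hball y hy)
    have h2 := hg _ (hball z hz)
    have h3 := hgL (y + x) (z + x)
    rw [h1, h2, add_sub_add_right_eq_sub] at h3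
    have e : f (y + x) - lam - δ * u (y + x) - (f (z + x) - lam - δ * u (z + x)) =
      (f (y + x) - lam - (f (z + x) - lam)) - δ * (u (y + x) - u (z + x)) := by ring
    simp only [e]
    refine (abs_sub _ _).trans ?_
    rw [abs_mul, abs_of_pos hδ0]
    have h5 : δ * |u (y + x) - u (z + x)| ≤ |u (y + x) - u (z + x)| :=
      mul_le_of_le_one_left (abs_nonneg _) hδ1
    have h6 : 0 ≤ (B + 1) * ‖y - z‖ := by positivity
    linarith

theorem repr_eq {u : XX m → ℝ} (hu : ContDiff ℝ 2 u) {r : ℝ} (hr : 0 < r) (x) :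
    u x = Aop r u x + Eop r (fun y => -(1/2) * lap u y) x := by
  have h1 := Eop_lap hr hu x
  have h2 : Eop r (fun y => -(1/2) * lap u y) x = -(1/2) * Eop r (lap u) x := by
    unfold Eop Tint Mop
    rw [← intervalIntegral.integral_const_mul]
    refine intervalIntegral.integral_congr fun s _ => ?_
    simp only [smul_eq_mul, mul_assoc]
    rw [integral_const_mul]
    ring
  rw [h2, h1]; ring

theorem DA_holder : ∃ C, 0 ≤ C ∧ ∀ (k : XX m → ℝ) (ρ B : ℝ), Continuous k →
    0 ≤ B → (∀ y, ‖y‖ ≤ ρ + 1 → |k y| ≤ B) →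
      ∀ x y, ‖x‖ ≤ ρ → ‖y‖ ≤ ρ → ‖fderiv ℝ (Aop 1 k) x - fderiv ℝ (Aop 1 k) y‖ ≤ C * B * √‖x - y‖ := by
  have hw : Continuous (fun _ : ℝ => (2 : ℝ) / 1 ^ 2) := continuous_const
  have h1 : ContDiff ℝ 1 (rho : XX m → ℝ) := rho_contDiff.of_le one_le_two
  obtain ⟨C, hC0, hC⟩ := Tint_holder (E := XX m) one_pos hw (rho_ker.fderivK h1)
    (rho_contDiff.fderiv_right (m := 1) (by norm_num [one_add_one_eq_two]))
  refine ⟨C, hC0, fun k ρ B hk hB0 hB x y hx hy => ?_⟩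
  have e := fun x => (Tint_hasFDerivAt_one one_pos hw rho_ker h1 hk x).fderiv
  have e' : ∀ x, fderiv ℝ (Aop 1 k) x = Tint 1 (fun _ => 2 / 1 ^ 2) (fderiv ℝ rho) k x := e
  rw [e', e']
  exact hC k ρ B hk hB0 hB x y hx hy

theorem fd_holder : ∃ C, 0 ≤ C ∧ ∀ (u : XX m → ℝ) (ρ B : ℝ), ContDiff ℝ 2 u →
    0 ≤ B → (∀ y, ‖y‖ ≤ ρ + 1 → |u y| ≤ B) → (∀ y, ‖y‖ ≤ ρ + 1 → |-(1/2) * lap u y| ≤ B) →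
      ∀ x y, ‖x‖ ≤ ρ → ‖y‖ ≤ ρ → ‖fderiv ℝ u x - fderiv ℝ u y‖ ≤ C * B * √‖x - y‖ := by
  obtain ⟨C1, hC10, hC1⟩ := DA_holder (m := m)
  obtain ⟨C2, hC20, hC2⟩ := DE_holder (m := m) one_pos
  refine ⟨C1 + C2, by positivity, fun u ρ B hu hB0 h1 h2 x y hx hy => ?_⟩
  have hkc : Continuous (fun y => -(1/2) * lap u y) := continuous_const.mul (lap_continuous hu)
  have e : u = fun x => Aop 1 u x + Eop 1 (fun y => -(1/2) * lap u y) x :=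
    funext fun x => repr_eq hu one_pos x
  have e2 : ∀ x, fderiv ℝ u x = fderiv ℝ (Aop 1 u) x + DE 1 (fun y => -(1/2) * lap u y) x := by
    intro x
    conv_lhs => rw [e]
    rw [fderiv_fun_add ((Aop_C1 one_pos hu.continuous).differentiable one_ne_zero x)
      ((Eop_C1 one_pos hkc).differentiable one_ne_zero x), Eop_fderiv one_pos hkc]
  rw [e2, e2, add_sub_add_comm]
  refine (norm_add_le _ _).trans ?_
  have a1 := hC1 u ρ B hu.continuous hB0 h1 x y hx hy
  have a2 := hC2 _ ρ B hkc hB0 h2 x y hx hy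
  linarith

end EllipticKernel13

set_option linter.unusedSectionVars false
set_option linter.unusedVariables false

section EllipticKernel14

open MeasureTheory Topology Metric Set
open scoped BoundedContinuousFunction

variable {m : ℕ}

theorem seq_exists (hm : 1 ≤ m) {θ lam : ℝ} (hθ : 1 < θ) {f : XX m → ℝ} (hf : LocallyLipschitz f)
    {ψ : XX m → ℝ} (hψ : ContDiff ℝ 2 ψ)
    (hsub : ∀ y, -(1/2) * lap ψ y + (1/θ) * ‖fderiv ℝ ψ y‖ ^ θ ≤ f y - lam) :
    ∃ U : ℕ → XX m → ℝ, (∀ n, ContDiff ℝ 2 (U n)) ∧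
      (∀ (n : ℕ) y, ‖y‖ ≤ (n:ℝ) + 1 →
        |-(1/2) * lap (U n) y + (1/θ) * ‖fderiv ℝ (U n) y‖ ^ θ - (f y - lam)| ≤ 1 / ((n:ℝ) + 1)) ∧
      ∀ ρ : ℝ, ∃ C, 0 ≤ C ∧ ∀ n : ℕ, ρ + 2 ≤ (n:ℝ) + 1 → ∀ x, ‖x‖ ≤ ρ →
        ‖fderiv ℝ (U n) x‖ ≤ C ∧ |U n x| ≤ C := by
  have hch := fun n : ℕ => stepA hm hθ hf hψ hsub (R := (n:ℝ) + 1) (by simp)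
  choose u δ hu hδ0 hδ1 hδu heq using hch
  have hfd : ∀ n y, fderiv ℝ (fun y => u n y - u n 0) y = fderiv ℝ (u n) y := by
    intro n y
    rw [fderiv_sub_const]
  refine ⟨fun n y => u n y - u n 0, fun n => (hu n).sub contDiff_const, ?_, ?_⟩
  · intro n y hy
    rw [hfd, lap_sub (hu n) contDiff_const, lap_const, sub_zero, heq n y hy]
    have := hδu n y
    rwa [show f y - lam - δ n * u n y - (f y - lam) = -(δ n * u n y) by ring, abs_neg]
  · intro ρ
    obtain ⟨C, hC, h⟩ := grad_loc hm (lam := lam) hθ hf ρ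
    refine ⟨C + C * |ρ|, by positivity, fun n hn x hx => ?_⟩
    have hb : ∀ z, ‖z‖ ≤ ρ → ‖fderiv ℝ (u n) z‖ ≤ C := fun z hz =>
      h (u n) (δ n) (n + 1) (hu n) (hδ0 n) (hδ1 n) (by simp) (hδu n) (heq n) hn z hz
    have hρ : 0 ≤ ρ := (norm_nonneg x).trans hx
    constructor
    · rw [hfd]
      have : 0 ≤ C * |ρ| := by positivity
      linarith [hb x hx]
    · have hd : Differentiable ℝ (u n) := (hu n).differentiable (by norm_num)
      have := (convex_closedBall (0 : XX m) ρ).norm_image_sub_le_of_norm_fderiv_le (𝕜 := ℝ)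
        (f := u n) (C := C) (fun z _ => hd z) (fun z hz => hb z (by simpa using hz))
        (x := 0) (y := x) (by simpa using hρ) (by simpa using hx)
      rw [sub_zero, Real.norm_eq_abs] at this
      have h2 : C * ‖x‖ ≤ C * |ρ| := by gcongr; exact hx.trans (le_abs_self ρ)
      show |u n x - u n 0| ≤ _
      linarith

theorem lip_sqrt {a C ρ : ℝ} {x y : XX m} (hC : 0 ≤ C) (hx : ‖x‖ ≤ ρ) (hy : ‖y‖ ≤ ρ)
    (h : a ≤ C * ‖x - y‖) : a ≤ C * √(2 * ρ) * √‖x - y‖ := by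
  have h1 : ‖x - y‖ ≤ 2 * ρ := (norm_sub_le x y).trans (by linarith)
  have h2 : ‖x - y‖ ≤ √(2 * ρ) * √‖x - y‖ := by
    nth_rewrite 1 [← Real.mul_self_sqrt (norm_nonneg (x - y))]
    gcongr
  calc a ≤ C * ‖x - y‖ := h
    _ ≤ C * (√(2 * ρ) * √‖x - y‖) := by gcongr
    _ = _ := by ring

theorem LH_of_locLip {f : XX m → ℝ} (hf : LocallyLipschitz f) : LH f := by
  intro ρ
  obtain ⟨g, L, B, hL, hB, h1, h2, h3⟩ := lip_extend hf ρ
  refine ⟨L * √(2 * ρ), by positivity, fun x y hx hy => ?_⟩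
  rw [← h3 x hx, ← h3 y hy]
  exact lip_sqrt hL hx hy (h1 x y)

theorem H_lip {θ M : ℝ} (hθ : 1 < θ) (hM : 0 ≤ M) {p q : XX m →L[ℝ] ℝ} (hp : ‖p‖ ≤ M)
    (hq : ‖q‖ ≤ M) : |(1/θ) * ‖p‖ ^ θ - (1/θ) * ‖q‖ ^ θ| ≤ M ^ (θ - 1) * ‖p - q‖ := by
  rw [← Gtr_eq hp, ← Gtr_eq hq]
  exact Gtr_lip hθ hM p q

theorem seq_cpt {θ lam : ℝ} (hθ : 1 < θ) {f : XX m → ℝ} (hf : LocallyLipschitz f)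
    {U : ℕ → XX m → ℝ} (hU : ∀ n, ContDiff ℝ 2 (U n))
    (heq : ∀ (n : ℕ) y, ‖y‖ ≤ (n:ℝ) + 1 →
        |-(1/2) * lap (U n) y + (1/θ) * ‖fderiv ℝ (U n) y‖ ^ θ - (f y - lam)| ≤ 1 / ((n:ℝ) + 1))
    (hb : ∀ ρ : ℝ, ∃ C, 0 ≤ C ∧ ∀ n : ℕ, ρ + 2 ≤ (n:ℝ) + 1 → ∀ x, ‖x‖ ≤ ρ →
        ‖fderiv ℝ (U n) x‖ ≤ C ∧ |U n x| ≤ C) (ρ : ℝ) :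
    ∃ B C : ℝ, 0 ≤ C ∧ ∀ᶠ n : ℕ in atTop, ∀ x y, ‖x‖ ≤ ρ → ‖y‖ ≤ ρ →
      ‖(U n x, fderiv ℝ (U n) x)‖ ≤ B ∧
      ‖(U n x, fderiv ℝ (U n) x) - (U n y, fderiv ℝ (U n) y)‖ ≤ C * √‖x - y‖ := by
  obtain ⟨C1, hC1, h1⟩ := hb (ρ + 1)
  obtain ⟨C2, hC2, h2⟩ := fd_holder (m := m)
  obtain ⟨Bf, hBf, h3⟩ := bdd_on_ball (LH_of_locLip hf).continuous (ρ + 1)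
  set B : ℝ := C1 + (Bf + |lam| + 1 + (1/θ) * C1 ^ θ) with hBdef
  have hB1 : 0 ≤ Bf + |lam| + 1 + (1/θ) * C1 ^ θ := by positivity
  have hB : 0 ≤ B := by positivity
  refine ⟨C1, max (C1 * √(2 * ρ)) (C2 * B), le_max_of_le_right (by positivity), ?_⟩
  obtain ⟨N, hN⟩ := exists_nat_ge (ρ + 2)
  filter_upwards [eventually_ge_atTop N] with n hn x y hx hy
  have hn' : (N:ℝ) ≤ n := by exact_mod_cast hn
  have h1' := h1 n (by linarith)
  have hkb : ∀ z, ‖z‖ ≤ ρ + 1 → |-(1/2) * lap (U n) z| ≤ B := by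
    intro z hz
    have e := heq n z (by linarith)
    have e1 : 1 / ((n:ℝ) + 1) ≤ 1 := by
      rw [div_le_one (by positivity)]; linarith [(Nat.cast_nonneg n : (0:ℝ) ≤ n)]
    have e2 : (1/θ) * ‖fderiv ℝ (U n) z‖ ^ θ ≤ (1/θ) * C1 ^ θ := by
      gcongr
      exact (h1' z hz).1
    have e3 : 0 ≤ (1/θ) * ‖fderiv ℝ (U n) z‖ ^ θ := by positivity
    have e4 := h3 z hz
    rw [Real.norm_eq_abs] at e4
    rw [abs_le] at e e4 ⊢
    have e5 := neg_abs_le lam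
    have e6 := le_abs_self lam
    constructor <;> linarith [e.1, e.2, e4.1, e4.2]
  have hd : Differentiable ℝ (U n) := (hU n).differentiable (by norm_num)
  have hmv := (convex_closedBall (0 : XX m) ρ).norm_image_sub_le_of_norm_fderiv_le (𝕜 := ℝ)
        (f := U n) (C := C1) (fun z _ => hd z)
        (fun z hz => (h1' z (by have : ‖z‖ ≤ ρ := by simpa using hz
                                linarith)).1)
        (x := y) (y := x) (by simpa using hy) (by simpa using hx)
  refine ⟨?_, ?_⟩
  · rw [Prod.norm_def]
    exact max_le (h1' x (by linarith)).2 (h1' x (by linarith)).1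
  · rw [Prod.mk_sub_mk, Prod.norm_def]
    refine max_le ?_ ?_
    · refine (lip_sqrt hC1 hx hy hmv).trans ?_
      gcongr
      exact le_max_left _ _
    · refine (h2 (U n) ρ B (hU n) hB (fun z hz => ?_) hkb x y hx hy).trans ?_
      · linarith [(h1' z hz).2]
      · gcongr
        exact le_max_right _ _

theorem Tint_tendsto' {r : ℝ} (hr : 0 < r) {w : ℝ → ℝ} (hw : Continuous w)
    {a : XX m → ℝ} (ha : Ker a) {k : XX m → ℝ} {kn : ℕ → XX m → ℝ} (hk : Continuous k)
    (hkn : ∀ n, Continuous (kn n)) (x : XX m) {C : ℝ} {N : ℕ}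
    (h : ∀ n : ℕ, N ≤ n → ∀ y, ‖y‖ ≤ ‖x‖ + r → |kn n y - k y| ≤ C * (1 / ((n:ℝ) + 1))) :
    Tendsto (fun n => Tint r w a (kn n) x) atTop (𝓝 (Tint r w a k x)) := by
  rw [← tendsto_add_atTop_iff_nat N]
  refine Tint_tendsto hr hw ha hk (kn := fun n => kn (n + N)) (fun n => hkn _) x
    (ε := fun n => C * (1 / (((n + N : ℕ):ℝ) + 1))) ?_ ?_
  · have h0 := (tendsto_add_atTop_iff_nat N).2 (tendsto_one_div_add_atTop_nhds_zero_nat (𝕜 := ℝ))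
    simpa using h0.const_mul C
  · intro n y hy
    refine h (n + N) (by omega) y ?_
    have : y = x + (y - x) := by abel
    rw [this]
    exact (norm_add_le _ _).trans (by linarith)

theorem limit_sol {θ lam : ℝ} (hθ : 1 < θ) {f : XX m → ℝ} (hf : LocallyLipschitz f)
    {V : ℕ → XX m → ℝ} (hV : ∀ n, ContDiff ℝ 2 (V n))
    (heq : ∀ (n : ℕ) y, ‖y‖ ≤ (n:ℝ) →
        |-(1/2) * lap (V n) y + (1/θ) * ‖fderiv ℝ (V n) y‖ ^ θ - (f y - lam)| ≤ 1 / ((n:ℝ) + 1))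
    {U : XX m → ℝ} {P : XX m → XX m →L[ℝ] ℝ}
    (hVU : ∀ (n : ℕ) y, ‖y‖ ≤ (n:ℝ) → |V n y - U y| ≤ 1 / ((n:ℝ) + 1))
    (hVP : ∀ (n : ℕ) y, ‖y‖ ≤ (n:ℝ) → ‖fderiv ℝ (V n) y - P y‖ ≤ 1 / ((n:ℝ) + 1))
    (hb : ∀ ρ : ℝ, ∃ B C : ℝ, 0 ≤ C ∧ ∀ᶠ n : ℕ in atTop, ∀ x y, ‖x‖ ≤ ρ → ‖y‖ ≤ ρ →
      ‖fderiv ℝ (V n) x‖ ≤ B ∧ ‖fderiv ℝ (V n) x - fderiv ℝ (V n) y‖ ≤ C * √‖x - y‖) :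
    ContDiff ℝ 2 U ∧ ∀ y, -(1/2) * lap U y + (1/θ) * ‖fderiv ℝ U y‖ ^ θ = f y - lam := by
  have h0 := tendsto_one_div_add_atTop_nhds_zero_nat (𝕜 := ℝ)
  have hge : ∀ y : XX m, ∀ᶠ n : ℕ in atTop, ‖y‖ ≤ (n:ℝ) := fun y =>
    tendsto_natCast_atTop_atTop.eventually_ge_atTop _
  have htU : ∀ y, Tendsto (fun n => V n y) atTop (𝓝 (U y)) := by
    intro y
    rw [tendsto_iff_norm_sub_tendsto_zero]
    refine squeeze_zero' (Eventually.of_forall fun n => norm_nonneg _) ?_ h0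
    filter_upwards [hge y] with n hn
    exact hVU n y hn
  have htP : ∀ y, Tendsto (fun n => fderiv ℝ (V n) y) atTop (𝓝 (P y)) := by
    intro y
    rw [tendsto_iff_norm_sub_tendsto_zero]
    refine squeeze_zero' (Eventually.of_forall fun n => norm_nonneg _) ?_ h0
    filter_upwards [hge y] with n hn
    exact hVP n y hn
  have hder : ∀ x, HasFDerivAt U (P x) x := by
    intro x
    refine hasFDerivAt_of_tendstoLocallyUniformlyOn (l := atTop) (s := univ) (f := V)
      (f' := fun n => fderiv ℝ (V n)) isOpen_univ ?_
      (fun n y _ => ((hV n).differentiable (by norm_num) y).hasFDerivAt) (fun y _ => htU y)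
      (mem_univ x)
    rw [tendstoLocallyUniformlyOn_univ, Metric.tendstoLocallyUniformly_iff]
    intro ε hε z
    refine ⟨ball z 1, ball_mem_nhds z one_pos, ?_⟩
    filter_upwards [tendsto_natCast_atTop_atTop.eventually_ge_atTop (‖z‖ + 1),
      h0.eventually (gt_mem_nhds hε)] with n hn1 hn2 y hy
    rw [dist_comm, dist_eq_norm]
    refine (hVP n y ?_).trans_lt hn2
    rw [mem_ball, dist_eq_norm] at hy
    have : y = z + (y - z) := by abel
    rw [this]
    exact (norm_add_le _ _).trans (by linarith)
  have hPb : ∀ ρ : ℝ, ∃ M C : ℝ, 0 ≤ M ∧ 0 ≤ C ∧ ∃ N : ℕ, ρ ≤ N ∧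
      (∀ n, N ≤ n → ∀ x, ‖x‖ ≤ ρ → ‖fderiv ℝ (V n) x‖ ≤ M) ∧
      (∀ x, ‖x‖ ≤ ρ → ‖P x‖ ≤ M) ∧
      (∀ x y, ‖x‖ ≤ ρ → ‖y‖ ≤ ρ → ‖P x - P y‖ ≤ C * √‖x - y‖) := by
    intro ρ
    obtain ⟨B, C, hC, h⟩ := hb ρ
    obtain ⟨N1, hN1⟩ := eventually_atTop.1 h
    obtain ⟨N2, hN2⟩ := exists_nat_ge ρ
    refine ⟨|B|, C, abs_nonneg _, hC, max N1 N2, hN2.trans (by exact_mod_cast le_max_right _ _),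
      ?_, ?_, ?_⟩
    · intro n hn x hx
      exact ((hN1 n ((le_max_left _ _).trans hn) x x hx hx).1).trans (le_abs_self _)
    · intro x hx
      refine le_of_tendsto (htP x).norm ?_
      filter_upwards [h] with n hn
      exact (hn x x hx hx).1.trans (le_abs_self _)
    · intro x y hx hy
      refine le_of_tendsto ((htP x).sub (htP y)).norm ?_
      filter_upwards [h] with n hn
      exact (hn x y hx hy).2
  have hUc : Continuous U := continuous_iff_continuousAt.2 fun x => (hder x).continuousAt
  have hkLH : LH (fun y => f y - lam - (1/θ) * ‖P y‖ ^ θ) := by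
    intro ρ
    obtain ⟨M, C, hM, hC, N, -, -, hP1, hP2⟩ := hPb ρ
    obtain ⟨Cf, hCf, hff⟩ := LH_of_locLip hf ρ
    refine ⟨Cf + M ^ (θ - 1) * C, by positivity, fun x y hx hy => ?_⟩
    have e1 := hff x y hx hy
    have e2 := H_lip hθ hM (hP1 x hx) (hP1 y hy)
    have e3 : M ^ (θ - 1) * ‖P x - P y‖ ≤ M ^ (θ - 1) * (C * √‖x - y‖) := by
      gcongr
      exact hP2 x y hx hy
    rw [abs_le] at e1 e2 ⊢
    constructor <;> nlinarith [e1.1, e1.2, e2.1, e2.2, e3]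
  have hrep : ∀ r, 0 < r → ∀ x, U x = Aop r U x +
      Eop r (fun y => f y - lam - (1/θ) * ‖P y‖ ^ θ) x := by
    intro r hr x
    obtain ⟨M, C, hM, hC, N, hN, hP0, hP1, hP2⟩ := hPb (‖x‖ + r)
    have t1 : Tendsto (fun n => Aop r (V n) x) atTop (𝓝 (Aop r U x)) := by
      refine Tint_tendsto' hr (by fun_prop) rho_ker hUc (fun n => (hV n).continuous) x (C := 1)
        (N := N) (fun n hn y hy => ?_)
      rw [one_mul]
      have : (N:ℝ) ≤ n := by exact_mod_cast hn
      exact hVU n y (by linarith)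
    have t2 : Tendsto (fun n => Eop r (fun y => -(1/2) * lap (V n) y) x) atTop
        (𝓝 (Eop r (fun y => f y - lam - (1/θ) * ‖P y‖ ^ θ) x)) := by
      refine Tint_tendsto' hr (by fun_prop) kap_ker hkLH.continuous
        (fun n => continuous_const.mul (lap_continuous (hV n))) x (C := 1 + M ^ (θ - 1))
        (N := N) (fun n hn y hy => ?_)
      have : (N:ℝ) ≤ n := by exact_mod_cast hn
      have hyn : ‖y‖ ≤ (n:ℝ) := by linarith
      have e1 := heq n y hyn
      have e2 := H_lip hθ hM (hP0 n hn y hy) (hP1 y hy)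
      have e3 : M ^ (θ - 1) * ‖fderiv ℝ (V n) y - P y‖ ≤ M ^ (θ - 1) * (1 / ((n:ℝ) + 1)) := by
        gcongr
        exact hVP n y hyn
      have e4 := e2.trans e3
      rw [add_mul, one_mul]
      show |-(1/2) * lap (V n) y - _| ≤ _
      rw [abs_le] at e1 e4 ⊢
      constructor <;> linarith [e1.1, e1.2, e4.1, e4.2]
    refine tendsto_nhds_unique (htU x) ((t1.add t2).congr fun n => ?_)
    exact (repr_eq (hV n) hr x).symm
  obtain ⟨hU2, hlap⟩ := repr_C2 hUc hkLH hrep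
  refine ⟨hU2, fun y => ?_⟩
  rw [hlap y, (hder y).fderiv]
  ring

theorem exists_sol_final (hm : 1 ≤ m) {θ lam : ℝ} (hθ : 1 < θ) {f : XX m → ℝ} (hf : LocallyLipschitz f)
    {ψ : XX m → ℝ} (hψ : ContDiff ℝ 2 ψ)
    (hsub : ∀ y, -(1/2) * lap ψ y + (1/θ) * ‖fderiv ℝ ψ y‖ ^ θ ≤ f y - lam) :
    ∃ U : XX m → ℝ, ContDiff ℝ 2 U ∧
      ∀ y, -(1/2) * lap U y + (1/θ) * ‖fderiv ℝ U y‖ ^ θ = f y - lam := by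
  obtain ⟨U, hU, heq, hb⟩ := seq_exists hm hθ hf hψ hsub
  have hcp := seq_cpt hθ hf hU heq hb
  have : ProperSpace (ℝ × (XX m →L[ℝ] ℝ)) := FiniteDimensional.proper ℝ _
  obtain ⟨W, φ, hφ, hW⟩ := cpt_subseq (Wn := fun n x => (U n x, fderiv ℝ (U n) x)) hcp
  refine ⟨fun y => (W y).1, limit_sol hθ hf (V := fun n => U (φ n)) (P := fun y => (W y).2)
    (fun n => hU _) ?_ ?_ ?_ ?_⟩
  · intro n y hy
    have hn : (n:ℝ) ≤ φ n := by exact_mod_cast hφ n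
    refine (heq (φ n) y (by linarith)).trans ?_
    gcongr
  · intro n y hy
    exact (norm_fst_le _).trans (hW n y hy)
  · intro n y hy
    exact (norm_snd_le _).trans (hW n y hy)
  · intro ρ
    obtain ⟨B, C, hC, h⟩ := hcp ρ
    refine ⟨B, C, hC, ?_⟩
    have ht : Tendsto φ atTop atTop := tendsto_atTop_mono hφ tendsto_id
    filter_upwards [ht.eventually h] with n hn x y hx hy
    exact ⟨(norm_snd_le _).trans (hn x y hx hy).1, (norm_snd_le _).trans (hn x y hx hy).2⟩

end EllipticKernel14

theorem stmt0 (m : ℕ) (hm : 1 ≤ m) (θ lam : ℝ) (hθ : 1 < θ)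
    (f : EuclideanSpace ℝ (Fin m) → ℝ) (hf : LocallyLipschitz f)
    (hsub : ∃ ψ, IsSubsolution θ f lam ψ) :
    ∃ φ, IsSolution θ f lam φ := by
  obtain ⟨ψ, hψ, hs⟩ := hsub
  obtain ⟨U, hU, h⟩ := exists_sol_final hm (lam := lam) hθ hf hψ
    (fun y => by rw [← gu_norm]; exact hs y)
  exact ⟨U, hU, fun y => by rw [gu_norm]; exact h y⟩
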